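/- (Dual parametric representation.) Let G be a Feynman graph with edges labelled 1,…,E (E ≥ 1) which is ultraviolet convergent and infrared convergent, such that M_G > 0, every connected component of G contains an external vertex, and some two external vertices lie in the same connected component. Let n_e ∈ ℕ be chosen with n_e + λν_e > 0 for every edge e, and let x = (x_v)_{v ∈ V_ext} be pairwise distinct external positions. Define h : (0,∞)^E → ℝ by h(α) = Φ̃_G(α,x)^{−M_G} · Ψ̃_G(α)^{−(d/2 − M_G)} (real powers of positive reals), and let D h = (∏_e ∂_{α_e}^{n_e}) h be the iterated partial derivatives on the open orthant. Then the integral below converges absolutely and f_G(x) = ((−1)^{Σ_e n_e} · Γ(M_G) / ∏_e Γ(n_e + λν_e)) · ∫_{(0,∞)^{E−1}} [ (∏_e α_e^{n_e + λν_e − 1}) · (D h)(α) ] restricted to α_1 = 1, integrated with respect to dα_2 ⋯ dα_E. -/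

import Mathlib

open scoped Classical ENNReal
open MeasureTheory

noncomputable section

/-- A Feynman graph with vertices `Fin nV`, edges `Fin nE` (each edge has two
distinct endpoints, multiple edges allowed), a set of external vertices and
real edge weights. -/
structure FeynmanGraph (nV nE : ℕ) where
  ends : Fin nE → Fin nV × Fin nV
  ends_ne : ∀ e, (ends e).1 ≠ (ends e).2
  ext : Finset (Fin nV)
  ν : Fin nE → ℝ

/-- `λ = d/2 - 1`. -/
def lam (d : ℕ) : ℝ := (d : ℝ) / 2 - 1

namespace FeynmanGraph

variable {nV nE : ℕ} (G : FeynmanGraph nV nE)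

/-- The edge `e` is incident to the vertex `v`. -/
def Incident (e : Fin nE) (v : Fin nV) : Prop :=
  (G.ends e).1 = v ∨ (G.ends e).2 = v

/-- The edge `e` joins the vertices `u` and `v`. -/
def Joins (e : Fin nE) (u v : Fin nV) : Prop :=
  G.ends e = (u, v) ∨ G.ends e = (v, u)

/-- The internal vertices of `G`. -/
def intVerts : Finset (Fin nV) := Finset.univ.filter (fun v => v ∉ G.ext)

/-- The simple graph on the vertices of `G` induced by a subset `F` of the edges. -/
def edgeGraph (F : Finset (Fin nE)) : SimpleGraph (Fin nV) :=
  SimpleGraph.fromRel (fun u v => ∃ e ∈ F, G.Joins e u v)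

/-- `F` is a spanning forest of `G` compatible with the collection `p` of pairwise
disjoint vertex sets: `F` is acyclic (as a set of multigraph edges), the graph
`(V, F)` has exactly `p.card` connected components, and distinct parts of `p` lie in
distinct components.  (Acyclicity together with the component count is expressed by
the edge count `F.card + p.card = nV`.) -/
def IsForest (p : Finset (Finset (Fin nV))) (F : Finset (Fin nE)) : Prop :=
  F.card + p.card = nV ∧
  Nat.card (G.edgeGraph F).ConnectedComponent = p.card ∧
  (∀ P ∈ p, ∀ u ∈ P, ∀ v ∈ P, (G.edgeGraph F).Reachable u v) ∧
  (∀ P ∈ p, ∀ Q ∈ p, P ≠ Q → ∀ u ∈ P, ∀ v ∈ Q, ¬ (G.edgeGraph F).Reachable u v)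

/-- The set `𝓕_G^p` of spanning forests compatible with `p`. -/
def forests (p : Finset (Finset (Fin nV))) : Finset (Finset (Fin nE)) :=
  Finset.univ.filter (fun F => G.IsForest p F)

/-- The dual spanning forest polynomial `Ψ̃_G^p`, evaluated at `α`. -/
def dualForestPoly (p : Finset (Finset (Fin nV))) (α : Fin nE → ℝ) : ℝ :=
  ∑ F ∈ G.forests p, ∏ e ∈ F, α e

/-- The spanning forest polynomial `Ψ_G^p`, evaluated at `α`. -/
def forestPoly (p : Finset (Finset (Fin nV))) (α : Fin nE → ℝ) : ℝ :=
  ∑ F ∈ G.forests p, ∏ e ∈ Finset.univ \ F, α e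

/-- The partition of the external vertices into singletons. -/
def singlePart : Finset (Finset (Fin nV)) := G.ext.image (fun v => {v})

/-- The collection `p(i,j)` consisting of `{i, j}` together with the singletons of the
remaining external vertices. -/
def pairPart (i j : Fin nV) : Finset (Finset (Fin nV)) :=
  insert ({i, j} : Finset (Fin nV)) (((G.ext.erase i).erase j).image (fun v => {v}))

/-- `Ψ̃_G`, evaluated at `α`. -/
def psiTilde (α : Fin nE → ℝ) : ℝ := G.dualForestPoly G.singlePart α

/-- `Φ̃_G(α, x) = Σ_{i<j external} ‖x_i - x_j‖² Ψ̃_G^{p(i,j)}(α)`. -/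
def phiTilde {d : ℕ} (x : Fin nV → EuclideanSpace ℝ (Fin d)) (α : Fin nE → ℝ) : ℝ :=
  ∑ i ∈ G.ext, ∑ j ∈ G.ext.filter (fun j => i < j),
    ‖x i - x j‖ ^ 2 * G.dualForestPoly (G.pairPart i j) α

/-- Positions of all vertices: external vertices are placed according to `x`,
internal vertices according to `y`. -/
def assemble {E : Type*} (x : Fin nV → E) (y : {v : Fin nV // v ∉ G.ext} → E) :
    Fin nV → E :=
  fun v => if h : v ∉ G.ext then y ⟨v, h⟩ else x v

/-- The position space Feynman integral
`f_G(x) = ∫ ∏_{v internal} d^d x_v/π^{d/2} ∏_e ‖x_{u(e)} - x_{w(e)}‖^{-2λν_e}`,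
a Lebesgue integral of a nonnegative function, with values in `[0,∞]`.  Only the
external components of `x` matter. -/
def posIntegral (d : ℕ) (x : Fin nV → EuclideanSpace ℝ (Fin d)) : ℝ≥0∞ :=
  (∫⁻ y : {v : Fin nV // v ∉ G.ext} → EuclideanSpace ℝ (Fin d),
      ENNReal.ofReal (∏ e,
        ‖G.assemble x y (G.ends e).1 - G.assemble x y (G.ends e).2‖ ^ (-(2 * lam d * G.ν e)))) /
    ENNReal.ofReal (Real.pi ^ ((d : ℝ) / 2 * (G.intVerts.card : ℝ)))

/-- The standard positions of the three external vertices `0`, `1`, `z`. -/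
def extPos (d : ℕ) (v0 v1 vz : Fin nV) (z : ℂ) : Fin nV → EuclideanSpace ℝ (Fin d) :=
  fun v =>
    if v = v0 then 0
    else if v = v1 then WithLp.toLp 2 (fun i : Fin d => if (i : ℕ) = 0 then 1 else 0)
    else if v = vz then
      WithLp.toLp 2 (fun i : Fin d => if (i : ℕ) = 0 then z.re else if (i : ℕ) = 1 then z.im else 0)
    else 0

/-- The graphical function `f_G(z)` of a graph with the three external vertices
`v0`, `v1`, `vz`. -/
def graphicalFn (d : ℕ) (v0 v1 vz : Fin nV) (z : ℂ) : ℝ≥0∞ :=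
  G.posIntegral d (extPos d v0 v1 vz z)

/-- The edges of `G` having both endpoints in `Vg`. -/
def edgesWithin (Vg : Finset (Fin nV)) : Finset (Fin nE) :=
  Finset.univ.filter (fun e => (G.ends e).1 ∈ Vg ∧ (G.ends e).2 ∈ Vg)

/-- Ultraviolet convergence. -/
def UVConvergent (d : ℕ) : Prop :=
  ∀ Vg : Finset (Fin nV), 2 ≤ Vg.card → (Vg ∩ G.ext).card ≤ 1 →
    lam d * ∑ e ∈ G.edgesWithin Vg, G.ν e < (d : ℝ) / 2 * ((Vg.card : ℝ) - 1)

/-- `(Vg, Eg)` is a subgraph of `G`. -/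
def IsSubgraph (Vg : Finset (Fin nV)) (Eg : Finset (Fin nE)) : Prop :=
  ∀ e ∈ Eg, (G.ends e).1 ∈ Vg ∧ (G.ends e).2 ∈ Vg

/-- `v` is a `g`-internal vertex of the subgraph `g = (Vg, Eg)`. -/
def GInternal (Vg : Finset (Fin nV)) (Eg : Finset (Fin nE)) (v : Fin nV) : Prop :=
  v ∉ G.ext ∧ v ∈ Vg ∧ ∀ e, G.Incident e v → e ∈ Eg

/-- The set of `g`-internal vertices of the subgraph `g = (Vg, Eg)`. -/
def gInternalSet (Vg : Finset (Fin nV)) (Eg : Finset (Fin nE)) : Finset (Fin nV) :=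
  Finset.univ.filter (fun v => G.GInternal Vg Eg v)

/-- Infrared convergence. -/
def IRConvergent (d : ℕ) : Prop :=
  ∀ Vg : Finset (Fin nV), ∀ Eg : Finset (Fin nE), G.IsSubgraph Vg Eg →
    0 < (G.gInternalSet Vg Eg).card →
    (∀ e ∈ Eg, G.GInternal Vg Eg (G.ends e).1 ∨ G.GInternal Vg Eg (G.ends e).2) →
    (d : ℝ) / 2 * ((G.gInternalSet Vg Eg).card : ℝ) < lam d * ∑ e ∈ Eg, G.ν e

/-- The superficial degree of divergence `M_G = λ ν_G - (d/2)·V_int`. -/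
def Mdeg (d : ℕ) : ℝ := lam d * ∑ e, G.ν e - (d : ℝ) / 2 * (G.intVerts.card : ℝ)

end FeynmanGraph

/-- The affine chart `α_1 = 1`: the first Schwinger parameter (edge `0`) is set to `1`,
the remaining ones are given by `β`. -/
def chart {m : ℕ} (β : {e : Fin (m + 1) // e ≠ 0} → ℝ) : Fin (m + 1) → ℝ :=
  fun e => if h : e = 0 then 1 else β ⟨e, h⟩

/-- The partial derivative `∂_{α_e}` of a function on the Schwinger parameters. -/
def pderivE {m : ℕ} (e : Fin (m + 1)) (f : (Fin (m + 1) → ℝ) → ℝ) :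
    (Fin (m + 1) → ℝ) → ℝ :=
  fun α => deriv (fun t => f (Function.update α e t)) (α e)

/-- The iterated partial derivative `∏_e ∂_{α_e}^{n_e}`. -/
def multiDeriv {m : ℕ} (n : Fin (m + 1) → ℕ) (f : (Fin (m + 1) → ℝ) → ℝ) :
    (Fin (m + 1) → ℝ) → ℝ :=
  (Finset.univ : Finset (Fin (m + 1))).toList.foldr (fun e g => (pderivE e)^[n e] g) f

/-- The integrand of the dual parametric representation, in the affine chart `α_1 = 1`:
`(∏_e α_e^{n_e + λν_e - 1}) · (∏_e ∂_{α_e}^{n_e}) (Φ̃_G^{-M_G} Ψ̃_G^{-(d/2 - M_G)})`. -/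
def dualIntegrand (d : ℕ) {nV m : ℕ} (G : FeynmanGraph nV (m + 1))
    (n : Fin (m + 1) → ℕ) (x : Fin nV → EuclideanSpace ℝ (Fin d))
    (β : {e : Fin (m + 1) // e ≠ 0} → ℝ) : ℝ :=
  (∏ e, chart β e ^ ((n e : ℝ) + lam d * G.ν e - 1)) *
    multiDeriv n
      (fun α => G.phiTilde x α ^ (-(G.Mdeg d)) *
        G.psiTilde α ^ (-((d : ℝ) / 2 - G.Mdeg d)))
      (chart β)

section CauchyBinet

variable {I E : Type*} [Fintype I] [Fintype E] [DecidableEq I] [DecidableEq E]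

/-- Symmetrised Cauchy-Binet formula for a weighted Gram matrix. -/
theorem factorial_mul_det_gram (A : Matrix I E ℝ) (α : E → ℝ) :
    ((Fintype.card I).factorial : ℝ) * (A * Matrix.diagonal α * A.transpose).det =
      ∑ f : I → E, (∏ i, α (f i)) * (A.submatrix id f).det ^ 2 := by
  have expand : (A * Matrix.diagonal α * A.transpose).det =
      ∑ f : I → E, (∏ i, A i (f i) * α (f i)) * (A.submatrix id f).det := by
    have h1 : (A * Matrix.diagonal α * A.transpose) =
        fun i => ∑ e, (A i e * α e) • (A.transpose e) := by
      ext i j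
      simp [Matrix.mul_apply, Matrix.diagonal_apply, Finset.sum_apply]
    have h2 := (Matrix.detRowAlternating (n := I) (R := ℝ)).toMultilinearMap.map_sum
      (fun i e => (A i e * α e) • (A.transpose e))
    rw [h1]
    refine Eq.trans h2 (Finset.sum_congr rfl fun f _ => ?_)
    rw [MultilinearMap.map_smul_univ, smul_eq_mul]
    congr 1
    rw [← Matrix.det_transpose (A.submatrix id f)]
    rfl
  have perm : ∀ σ : Equiv.Perm I, (A * Matrix.diagonal α * A.transpose).det =
      ∑ f : I → E, (∏ i, α (f i)) * (A.submatrix id f).det *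
        ((Equiv.Perm.sign σ : ℤ) * ∏ i, (A.submatrix id f) i (σ i)) := by
    intro σ
    rw [expand, ← (Equiv.arrowCongr σ (Equiv.refl E)).symm.sum_comp]
    refine Finset.sum_congr rfl fun f _ => ?_
    have h3 : (A.submatrix id ((Equiv.arrowCongr σ (Equiv.refl E)).symm f)).det =
        (Equiv.Perm.sign σ : ℤ) * (A.submatrix id f).det := by
      rw [← Matrix.det_permute']
      rfl
    rw [h3, Finset.prod_mul_distrib]
    have h4 : ∏ i, α ((Equiv.arrowCongr σ (Equiv.refl E)).symm f i) = ∏ i, α (f i) := by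
      simpa using Equiv.prod_comp σ (fun i => α (f i))
    rw [h4]
    simp only [Equiv.arrowCongr_symm, Equiv.arrowCongr_apply, Matrix.submatrix_apply, id,
      Function.comp, Equiv.symm_symm, Equiv.refl_symm, Equiv.coe_refl]
    ring
  have total := Finset.sum_congr (rfl : (Finset.univ : Finset (Equiv.Perm I)) = Finset.univ)
    (fun σ _ => perm σ)
  rw [Finset.sum_const, Finset.card_univ, Fintype.card_perm, nsmul_eq_mul] at total
  rw [total, Finset.sum_comm]
  refine Finset.sum_congr rfl fun f _ => ?_
  rw [← Finset.mul_sum, ← Matrix.det_transpose (A.submatrix id f), sq, ← mul_assoc]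
  congr 1
  rw [Matrix.det_apply']
  rfl

/-- Cauchy-Binet formula for a weighted Gram matrix, where the squared maximal minors are
given as a function of the set of columns. -/
theorem det_gram_eq_sum (A : Matrix I E ℝ) (α : E → ℝ) (w : Finset E → ℝ)
    (hw : ∀ f : I → E, Function.Injective f →
      (A.submatrix id f).det ^ 2 = w (Finset.univ.image f)) :
    (A * Matrix.diagonal α * A.transpose).det =
      ∑ S ∈ Finset.univ.powersetCard (Fintype.card I), w S * ∏ e ∈ S, α e := by
  have key := factorial_mul_det_gram A α
  have hzero : ∀ f : I → E, ¬ Function.Injective f → (A.submatrix id f).det = 0 := by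
    intro f hf
    simp only [Function.Injective, not_forall] at hf
    obtain ⟨i, j, hij, hne⟩ := hf
    exact Matrix.det_zero_of_column_eq hne (fun k => by simp [hij])
  have hfib : ∑ f : I → E, (∏ i, α (f i)) * (A.submatrix id f).det ^ 2 =
      ∑ S ∈ Finset.univ.powersetCard (Fintype.card I),
        ∑ f ∈ (Finset.univ.filter (fun f : I → E => Function.Injective f)).filter
          (fun f => Finset.univ.image f = S), w S * ∏ e ∈ S, α e := by
    rw [← Finset.sum_filter_add_sum_filter_not Finset.univ (fun f : I → E => Function.Injective f)]
    rw [Finset.sum_eq_zero (s := Finset.univ.filter fun f : I → E => ¬ Function.Injective f)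
      (fun f hf => by rw [hzero f (by simpa using hf)]; simp), add_zero]
    rw [← Finset.sum_fiberwise_of_maps_to
      (s := Finset.univ.filter fun f : I → E => Function.Injective f)
      (t := Finset.univ.powersetCard (Fintype.card I))
      (g := fun f : I → E => Finset.univ.image f)]
    · refine Finset.sum_congr rfl fun S _ => Finset.sum_congr rfl fun f hf => ?_
      simp only [Finset.mem_filter, Finset.mem_univ, true_and] at hf
      rw [hw f hf.1, ← hf.2, Finset.prod_image (fun a _ b _ h => hf.1 h)]
      ring
    · intro f hf
      simp only [Finset.mem_filter, Finset.mem_univ, true_and] at hf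
      rw [Finset.mem_powersetCard]
      exact ⟨Finset.subset_univ _, by
        rw [Finset.card_image_of_injective _ hf, Finset.card_univ]⟩
  have hcount : ∀ S ∈ (Finset.univ : Finset E).powersetCard (Fintype.card I),
      ((Finset.univ.filter (fun f : I → E => Function.Injective f)).filter
          (fun f => Finset.univ.image f = S)).card = (Fintype.card I).factorial := by
    intro S hS
    rw [Finset.mem_powersetCard] at hS
    have hc : Fintype.card I = Fintype.card S := by simp [hS.2]
    let e₀ : I ≃ S := Fintype.equivOfCardEq hc
    rw [← Fintype.card_equiv e₀, ← Finset.card_univ]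
    symm
    refine Finset.card_bij (fun (e : I ≃ S) _ => fun i => (e i : E)) ?_ ?_ ?_
    · intro e _
      simp only [Finset.mem_filter, Finset.mem_univ, true_and]
      refine ⟨Subtype.val_injective.comp e.injective, ?_⟩
      ext a
      simp only [Finset.mem_image, Finset.mem_univ, true_and]
      constructor
      · rintro ⟨i, rfl⟩
        exact (e i).2
      · intro ha
        exact ⟨e.symm ⟨a, ha⟩, by simp⟩
    · intro e _ e' _ h
      ext i
      exact congrFun h i
    · intro f hf
      simp only [Finset.mem_filter, Finset.mem_univ, true_and] at hf
      have hmem : ∀ i, f i ∈ S := fun i => by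
        rw [← hf.2]; exact Finset.mem_image_of_mem _ (Finset.mem_univ i)
      refine ⟨Equiv.ofBijective (fun i => ⟨f i, hmem i⟩) ?_, Finset.mem_univ _, rfl⟩
      rw [Fintype.bijective_iff_injective_and_card]
      exact ⟨fun i j h => hf.1 (by simpa using h), hc⟩
  rw [hfib] at key
  have hsum : ∑ S ∈ Finset.univ.powersetCard (Fintype.card I),
        ∑ f ∈ (Finset.univ.filter (fun f : I → E => Function.Injective f)).filter
          (fun f => Finset.univ.image f = S), w S * ∏ e ∈ S, α e =
      ((Fintype.card I).factorial : ℝ) *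
        ∑ S ∈ Finset.univ.powersetCard (Fintype.card I), w S * ∏ e ∈ S, α e := by
    rw [Finset.mul_sum]
    refine Finset.sum_congr rfl fun S hS => ?_
    rw [Finset.sum_const, hcount S hS, nsmul_eq_mul]
  rw [hsum] at key
  exact mul_left_cancel₀ (by positivity) key

end CauchyBinet

namespace FeynmanGraph

variable {nV nE : ℕ} (G : FeynmanGraph nV nE)

/-- The oriented incidence matrix of `G` with entries in `K`. -/
def inc (K : Type*) [Ring K] (v : Fin nV) (e : Fin nE) : K :=
  (if (G.ends e).1 = v then 1 else 0) - (if (G.ends e).2 = v then 1 else 0)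

theorem sum_mul_inc {K : Type*} [CommRing K] (F : Fin nV → K) (e : Fin nE) :
    ∑ v, F v * G.inc K v e = F (G.ends e).1 - F (G.ends e).2 := by
  simp [inc, mul_sub, Finset.sum_sub_distrib]

theorem reachable_ends {S : Finset (Fin nE)} {e : Fin nE} (he : e ∈ S) :
    (G.edgeGraph S).Reachable (G.ends e).1 (G.ends e).2 := by
  refine SimpleGraph.Adj.reachable ?_
  rw [edgeGraph, SimpleGraph.fromRel_adj]
  exact ⟨G.ends_ne e, Or.inl ⟨e, he, Or.inl rfl⟩⟩

theorem eq_of_reachable {X : Type*} {S : Finset (Fin nE)} {F : Fin nV → X}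
    (hF : ∀ e ∈ S, F (G.ends e).1 = F (G.ends e).2) {u v : Fin nV}
    (h : (G.edgeGraph S).Reachable u v) : F u = F v := by
  obtain ⟨p⟩ := h
  induction p with
  | nil => rfl
  | cons hadj _ ih =>
    rw [← ih]
    rw [edgeGraph, SimpleGraph.fromRel_adj] at hadj
    rcases hadj.2 with ⟨e, he, h | h⟩ | ⟨e, he, h | h⟩ <;>
    · have := hF e he
      rw [h] at this
      first | exact this | exact this.symm

/-- Every vertex is connected to a vertex of `R` by edges in `S`. -/
def Reaches (R : Finset (Fin nV)) (S : Finset (Fin nE)) : Prop :=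
  ∀ v, ∃ w ∈ R, (G.edgeGraph S).Reachable v w

theorem det_inc_ne_zero_iff {J : Type*} [Fintype J] [DecidableEq J] (R : Finset (Fin nV))
    (r : J → Fin nV) (hr : Function.Injective r) (hR : ∀ v, v ∉ R ↔ ∃ j, r j = v)
    (f : J → Fin nE) (K : Type*) [Field K] :
    (Matrix.of fun j i => G.inc K (r j) (f i)).det ≠ 0 ↔
      G.Reaches R (Finset.univ.image f) := by
  have hsum : ∀ (F : Fin nV → K), (∀ v ∈ R, F v = 0) → ∀ e,
      ∑ j, F (r j) * G.inc K (r j) e = F (G.ends e).1 - F (G.ends e).2 := by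
    intro F hF e
    rw [← G.sum_mul_inc F e]
    rw [← Finset.sum_image (s := Finset.univ) (g := r) (f := fun v => F v * G.inc K v e)
      (fun a _ b _ h => hr h)]
    refine Finset.sum_subset (Finset.subset_univ _) fun v _ hv => ?_
    have : v ∈ R := by
      by_contra h
      obtain ⟨j, hj⟩ := (hR v).1 h
      exact hv (Finset.mem_image.2 ⟨j, Finset.mem_univ _, hj⟩)
    rw [hF v this, zero_mul]
  rw [ne_eq, ← Matrix.exists_vecMul_eq_zero_iff]
  constructor
  · intro h
    by_contra hno
    simp only [Reaches, not_forall, not_exists, not_and] at hno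
    obtain ⟨v₀, hv₀⟩ := hno
    let F : Fin nV → K := fun v =>
      if (G.edgeGraph (Finset.univ.image f)).Reachable v₀ v then 1 else 0
    have hv₀R : v₀ ∉ R := fun h => hv₀ v₀ h (SimpleGraph.Reachable.refl _)
    obtain ⟨j₀, hj₀⟩ := (hR v₀).1 hv₀R
    refine h ⟨fun j => F (r j), ?_, ?_⟩
    · intro h0
      have := congrFun h0 j₀
      simp [F, hj₀] at this
    · ext i
      have h1 := hsum F (fun v hv => if_neg (hv₀ v hv)) (f i)
      have h2 : F (G.ends (f i)).1 = F (G.ends (f i)).2 := by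
        have hre := G.reachable_ends (S := Finset.univ.image f)
          (Finset.mem_image_of_mem f (Finset.mem_univ i))
        simp only [F]
        congr 1
        exact propext ⟨fun h => h.trans hre, fun h => h.trans hre.symm⟩
      rw [h2, sub_self] at h1
      simpa [Matrix.vecMul, dotProduct] using h1
  · rintro hreach ⟨c, hc, hc0⟩
    let F : Fin nV → K := fun v => if h : ∃ j, r j = v then c h.choose else 0
    have hFr : ∀ j, F (r j) = c j := by
      intro j
      have h : ∃ j', r j' = r j := ⟨j, rfl⟩
      simp only [F, dif_pos h]
      rw [hr h.choose_spec]
    have hF0 : ∀ v ∈ R, F v = 0 := by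
      intro v hv
      have h : ¬ ∃ j, r j = v := fun h => (hR v).2 h hv
      simp only [F, dif_neg h]
    have hconst : ∀ e ∈ Finset.univ.image f, F (G.ends e).1 = F (G.ends e).2 := by
      intro e he
      obtain ⟨i, _, rfl⟩ := Finset.mem_image.1 he
      have h1 := hsum F hF0 (f i)
      have h2 := congrFun hc0 i
      simp only [Matrix.vecMul, dotProduct, Matrix.of_apply, Pi.zero_apply] at h2
      simp only [hFr] at h1
      rw [h2] at h1
      exact (sub_eq_zero.1 h1.symm)
    refine hc (funext fun j => ?_)
    obtain ⟨w, hw, hjw⟩ := hreach (r j)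
    rw [← hFr j, G.eq_of_reachable hconst hjw, hF0 w hw, Pi.zero_apply]

theorem det_inc_sq {J : Type*} [Fintype J] [DecidableEq J] (R : Finset (Fin nV))
    (r : J → Fin nV) (hr : Function.Injective r) (hR : ∀ v, v ∉ R ↔ ∃ j, r j = v)
    (f : J → Fin nE) :
    (Matrix.of fun j i => G.inc ℝ (r j) (f i)).det ^ 2 =
      if G.Reaches R (Finset.univ.image f) then 1 else 0 := by
  have hmap : ∀ (K : Type) [Field K], (Matrix.of fun j i => G.inc K (r j) (f i)).det =
      ((Matrix.of fun j i => G.inc ℤ (r j) (f i)).det : K) := by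
    intro K _
    have : (Matrix.of fun j i => G.inc K (r j) (f i)) =
        (Int.castRingHom K).mapMatrix (Matrix.of fun j i => G.inc ℤ (r j) (f i)) := by
      ext j i
      simp [inc]
    rw [this, ← RingHom.map_det]
    rfl
  split_ifs with h
  · have hz : (Matrix.of fun j i => G.inc ℤ (r j) (f i)).det.natAbs = 1 := by
      by_contra hne
      obtain ⟨p, hp, hdvd⟩ := Nat.exists_prime_and_dvd hne
      have : Fact p.Prime := ⟨hp⟩
      refine (G.det_inc_ne_zero_iff R r hr hR f (ZMod p)).2 h ?_
      rw [hmap, ZMod.intCast_zmod_eq_zero_iff_dvd]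
      exact Int.natCast_dvd.2 hdvd
    rw [hmap]
    have : (Matrix.of fun j i => G.inc ℤ (r j) (f i)).det ^ 2 = 1 := by
      rw [← Int.natAbs_sq, hz]; rfl
    exact_mod_cast this
  · have : (Matrix.of fun j i => G.inc ℝ (r j) (f i)).det = 0 := by
      by_contra hne
      exact h ((G.det_inc_ne_zero_iff R r hr hR f ℝ).1 hne)
    rw [this]; simp

theorem le_card_add_card_connectedComponent (S : Finset (Fin nE)) :
    nV ≤ S.card + Nat.card (G.edgeGraph S).ConnectedComponent := by
  let φ : (Fin nV → ℝ) →ₗ[ℝ] (S → ℝ) × ((G.edgeGraph S).ConnectedComponent → ℝ) :=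
    { toFun := fun F => (fun e => F (G.ends e).1 - F (G.ends e).2, fun c => F c.out)
      map_add' := by intro a b; ext <;> simp; ring
      map_smul' := by intro a b; ext <;> simp; ring }
  have hinj : Function.Injective φ := by
    rw [injective_iff_map_eq_zero]
    intro F hF
    have h1 : ∀ e ∈ S, F (G.ends e).1 = F (G.ends e).2 := by
      intro e he
      exact sub_eq_zero.1 (congrFun (congrArg Prod.fst hF) ⟨e, he⟩)
    ext v
    have h2 : F ((G.edgeGraph S).connectedComponentMk v).out = 0 :=
      congrFun (congrArg Prod.snd hF) ((G.edgeGraph S).connectedComponentMk v)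
    have h3 : (G.edgeGraph S).Reachable ((G.edgeGraph S).connectedComponentMk v).out v :=
      SimpleGraph.ConnectedComponent.exact (Quot.out_eq _)
    rw [← G.eq_of_reachable h1 h3, h2, Pi.zero_apply]
  have := LinearMap.finrank_le_finrank_of_injective hinj
  rw [Module.finrank_prod, Module.finrank_fintype_fun_eq_card, Module.finrank_fintype_fun_eq_card,
    Module.finrank_fintype_fun_eq_card] at this
  simpa [Nat.card_eq_fintype_card] using this

theorem Reaches.card_connectedComponent {R : Finset (Fin nV)} {S : Finset (Fin nE)}
    (hcard : S.card + R.card = nV) (h : G.Reaches R S) :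
    Nat.card (G.edgeGraph S).ConnectedComponent = R.card ∧
      ∀ u ∈ R, ∀ v ∈ R, u ≠ v → ¬ (G.edgeGraph S).Reachable u v := by
  let g : R → (G.edgeGraph S).ConnectedComponent :=
    fun w => (G.edgeGraph S).connectedComponentMk w
  have hsurj : Function.Surjective g := by
    intro c
    induction c using SimpleGraph.ConnectedComponent.ind with
    | h v =>
      obtain ⟨w, hw, hvw⟩ := h v
      exact ⟨⟨w, hw⟩, SimpleGraph.ConnectedComponent.sound hvw.symm⟩
  have hle : Nat.card (G.edgeGraph S).ConnectedComponent ≤ R.card := by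
    have := Nat.card_le_card_of_surjective g hsurj
    simpa using this
  have hge := G.le_card_add_card_connectedComponent S
  have heq : Nat.card (G.edgeGraph S).ConnectedComponent = R.card := by omega
  refine ⟨heq, fun u hu v hv huv hre => huv ?_⟩
  have hbij : Function.Bijective g := by
    rw [Fintype.bijective_iff_surjective_and_card]
    refine ⟨hsurj, ?_⟩
    rw [← Nat.card_eq_fintype_card (α := (G.edgeGraph S).ConnectedComponent), heq]
    simp
  have := @hbij.1 ⟨u, hu⟩ ⟨v, hv⟩ (SimpleGraph.ConnectedComponent.sound hre)
  simpa using this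

theorem IsForest.exists_reachable {p : Finset (Finset (Fin nV))} {S : Finset (Fin nE)}
    (h : G.IsForest p S) (hne : ∀ P ∈ p, P.Nonempty) (v : Fin nV) :
    ∃ P ∈ p, ∀ u ∈ P, (G.edgeGraph S).Reachable v u := by
  obtain ⟨_, hc, hin, hout⟩ := h
  let g : p → (G.edgeGraph S).ConnectedComponent :=
    fun P => (G.edgeGraph S).connectedComponentMk (hne P.1 P.2).choose
  have hbij : Function.Bijective g := by
    rw [Fintype.bijective_iff_injective_and_card]
    refine ⟨fun P Q hPQ => ?_, ?_⟩
    · by_contra hPQ'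
      exact hout P.1 P.2 Q.1 Q.2 (fun h => hPQ' (Subtype.ext h)) _ (hne P.1 P.2).choose_spec _
        (hne Q.1 Q.2).choose_spec (SimpleGraph.ConnectedComponent.exact hPQ)
    · rw [← Nat.card_eq_fintype_card (α := (G.edgeGraph S).ConnectedComponent), hc]
      simp
  obtain ⟨P, hP⟩ := hbij.2 ((G.edgeGraph S).connectedComponentMk v)
  refine ⟨P.1, P.2, fun u hu => ?_⟩
  have h1 := SimpleGraph.ConnectedComponent.exact hP
  exact h1.symm.trans (hin P.1 P.2 _ (hne P.1 P.2).choose_spec u hu)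

theorem card_singlePart : G.singlePart.card = G.ext.card :=
  Finset.card_image_of_injective _ Finset.singleton_injective

theorem isForest_singlePart_iff (S : Finset (Fin nE)) :
    G.IsForest G.singlePart S ↔ S.card + G.ext.card = nV ∧ G.Reaches G.ext S := by
  constructor
  · intro h
    refine ⟨by rw [← G.card_singlePart]; exact h.1, fun v => ?_⟩
    obtain ⟨P, hP, hv⟩ := h.exists_reachable G (by
      intro P hP
      obtain ⟨w, _, rfl⟩ := Finset.mem_image.1 hP
      exact Finset.singleton_nonempty w) v
    obtain ⟨w, hw, rfl⟩ := Finset.mem_image.1 hP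
    exact ⟨w, hw, hv w (Finset.mem_singleton_self w)⟩
  · rintro ⟨hc, hr⟩
    obtain ⟨h1, h2⟩ := hr.card_connectedComponent G hc
    refine ⟨by rw [G.card_singlePart]; exact hc, by rw [G.card_singlePart]; exact h1, ?_, ?_⟩
    · intro P hP u hu v hv
      obtain ⟨w, _, rfl⟩ := Finset.mem_image.1 hP
      rw [Finset.mem_singleton.1 hu, Finset.mem_singleton.1 hv]
    · intro P hP Q hQ hPQ u hu v hv
      obtain ⟨w, hw, rfl⟩ := Finset.mem_image.1 hP
      obtain ⟨w', hw', rfl⟩ := Finset.mem_image.1 hQ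
      rw [Finset.mem_singleton.1 hu, Finset.mem_singleton.1 hv]
      exact h2 w hw w' hw' (fun h => hPQ (by rw [h]))

theorem card_pairPart {i j : Fin nV} (hj : j ∈ G.ext) (hij : i ≠ j) :
    (G.pairPart i j).card = (G.ext.erase i).card := by
  rw [pairPart, Finset.card_insert_of_notMem,
    Finset.card_image_of_injective _ Finset.singleton_injective,
    Finset.card_erase_add_one (Finset.mem_erase.2 ⟨hij.symm, hj⟩)]
  intro h
  obtain ⟨w, _, hw⟩ := Finset.mem_image.1 h
  have h1 : i ∈ ({w} : Finset (Fin nV)) := by rw [hw]; simp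
  have h2 : j ∈ ({w} : Finset (Fin nV)) := by rw [hw]; simp
  exact hij ((Finset.mem_singleton.1 h1).trans (Finset.mem_singleton.1 h2).symm)

theorem isForest_pairPart_iff (S : Finset (Fin nE)) {i j : Fin nV} (hi : i ∈ G.ext)
    (hj : j ∈ G.ext) (hij : i ≠ j) :
    G.IsForest (G.pairPart i j) S ↔ S.card + (G.ext.erase i).card = nV ∧
      G.Reaches (G.ext.erase i) S ∧ (G.edgeGraph S).Reachable i j := by
  constructor
  · intro h
    refine ⟨by rw [← G.card_pairPart hj hij]; exact h.1, fun v => ?_, ?_⟩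
    · obtain ⟨P, hP, hv⟩ := h.exists_reachable G (by
        intro P hP
        rcases Finset.mem_insert.1 hP with rfl | hP
        · exact ⟨i, by simp⟩
        · obtain ⟨w, _, rfl⟩ := Finset.mem_image.1 hP
          exact Finset.singleton_nonempty w) v
      rcases Finset.mem_insert.1 hP with rfl | hP
      · exact ⟨j, Finset.mem_erase.2 ⟨hij.symm, hj⟩, hv j (by simp)⟩
      · obtain ⟨w, hw, rfl⟩ := Finset.mem_image.1 hP
        exact ⟨w, Finset.mem_of_mem_erase hw, hv w (Finset.mem_singleton_self w)⟩
    · exact h.2.2.1 {i, j} (Finset.mem_insert_self _ _) i (by simp) j (by simp)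
  · rintro ⟨hc, hr, hre⟩
    obtain ⟨h1, h2⟩ := hr.card_connectedComponent G hc
    have hrep : ∀ P ∈ G.pairPart i j, ∀ u ∈ P, ∃ w ∈ P, w ∈ G.ext.erase i ∧
        (G.edgeGraph S).Reachable u w := by
      intro P hP u hu
      rcases Finset.mem_insert.1 hP with rfl | hP
      · refine ⟨j, by simp, Finset.mem_erase.2 ⟨hij.symm, hj⟩, ?_⟩
        rcases Finset.mem_insert.1 hu with rfl | hu
        · exact hre
        · rw [Finset.mem_singleton.1 hu]
      · obtain ⟨w, hw, rfl⟩ := Finset.mem_image.1 hP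
        refine ⟨w, by simp, Finset.mem_of_mem_erase hw, ?_⟩
        rw [Finset.mem_singleton.1 hu]
    have huniq : ∀ P ∈ G.pairPart i j, ∀ w ∈ P, ∀ w' ∈ P, w ∈ G.ext.erase i →
        w' ∈ G.ext.erase i → w = w' := by
      intro P hP w hw w' hw' h h'
      rcases Finset.mem_insert.1 hP with rfl | hP
      · simp only [Finset.mem_insert, Finset.mem_singleton, Finset.mem_erase] at *
        rcases hw with rfl | rfl
        · exact absurd rfl h.1
        · rcases hw' with rfl | rfl
          · exact absurd rfl h'.1
          · rfl
      · obtain ⟨w, hw, rfl⟩ := Finset.mem_image.1 hP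
        simp only [Finset.mem_singleton] at *
        simp_all
    have hdisj : ∀ P ∈ G.pairPart i j, ∀ Q ∈ G.pairPart i j, ∀ w, w ∈ P → w ∈ Q → P = Q := by
      intro P hP Q hQ w hwP hwQ
      rcases Finset.mem_insert.1 hP with rfl | hP <;> rcases Finset.mem_insert.1 hQ with rfl | hQ
      · rfl
      · obtain ⟨z, hz, rfl⟩ := Finset.mem_image.1 hQ
        simp only [Finset.mem_erase, Finset.mem_insert, Finset.mem_singleton] at *
        subst hwQ
        rcases hwP with rfl | rfl <;> simp_all
      · obtain ⟨z, hz, rfl⟩ := Finset.mem_image.1 hP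
        simp only [Finset.mem_erase, Finset.mem_insert, Finset.mem_singleton] at *
        subst hwP
        rcases hwQ with rfl | rfl <;> simp_all
      · obtain ⟨z, hz, rfl⟩ := Finset.mem_image.1 hP
        obtain ⟨z', hz', rfl⟩ := Finset.mem_image.1 hQ
        simp only [Finset.mem_singleton] at *
        rw [← hwP, ← hwQ]
    refine ⟨by rw [G.card_pairPart hj hij]; exact hc,
      by rw [G.card_pairPart hj hij]; exact h1, ?_, ?_⟩
    · intro P hP u hu v hv
      obtain ⟨w, hwP, hw, huw⟩ := hrep P hP u hu
      obtain ⟨w', hwP', hw', hvw⟩ := hrep P hP v hv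
      rw [huniq P hP w hwP w' hwP' hw hw'] at huw
      exact huw.trans hvw.symm
    · intro P hP Q hQ hPQ u hu v hv huv
      obtain ⟨w, hwP, hw, huw⟩ := hrep P hP u hu
      obtain ⟨w', hwQ, hw', hvw⟩ := hrep Q hQ v hv
      by_cases hww : w = w'
      · subst hww
        exact hPQ (hdisj P hP Q hQ w hwP hwQ)
      · exact h2 w hw w' hw' hww (huw.symm.trans (huv.trans hvw))

end FeynmanGraph

namespace FeynmanGraph

variable {nV nE : ℕ} (G : FeynmanGraph nV nE)

/-- The type of internal vertices. -/
abbrev Internal : Type := {v : Fin nV // v ∉ G.ext}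

theorem card_internal : Fintype.card G.Internal + G.ext.card = nV := by
  have h := Fintype.card_subtype_compl (fun v => v ∈ G.ext)
  have h2 : Fintype.card {v // v ∈ G.ext} = G.ext.card := by simp
  have h3 : G.ext.card ≤ nV := by simpa using G.ext.card_le_univ
  rw [h2, Fintype.card_fin] at h
  change Fintype.card {v // v ∉ G.ext} + _ = _
  omega

/-- The rows of the incidence matrix indexed by internal vertices. -/
def incInt : Matrix G.Internal (Fin nE) ℝ := Matrix.of fun v e => G.inc ℝ v e

/-- The differences along the edges of the function that equals `x` on external vertices and
vanishes on internal ones. -/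
def incExt (x : Fin nV → ℝ) (e : Fin nE) : ℝ :=
  (if (G.ends e).1 ∈ G.ext then x (G.ends e).1 else 0) -
    (if (G.ends e).2 ∈ G.ext then x (G.ends e).2 else 0)

/-- The weighted Laplacian of `G` with Dirichlet conditions at the external vertices. -/
def lapInt (α : Fin nE → ℝ) : Matrix G.Internal G.Internal ℝ :=
  G.incInt * Matrix.diagonal α * G.incInt.transpose

theorem sum_internal_inc (F : Fin nV → ℝ) (hF : ∀ v ∈ G.ext, F v = 0) (e : Fin nE) :
    ∑ v : G.Internal, F v * G.inc ℝ v e = F (G.ends e).1 - F (G.ends e).2 := by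
  rw [← G.sum_mul_inc F e]
  have h := Finset.sum_subtype (Finset.univ.filter fun v => v ∉ G.ext)
    (p := fun v => v ∉ G.ext) (F := inferInstance) (fun v => by simp) (fun v => F v * G.inc ℝ v e)
  rw [← h, Finset.sum_filter]
  refine Finset.sum_congr rfl fun v _ => ?_
  split_ifs with hv
  · rw [hF v hv, zero_mul]
  · rfl

theorem psiTilde_eq_det (α : Fin nE → ℝ) : G.psiTilde α = (G.lapInt α).det := by
  rw [lapInt, det_gram_eq_sum G.incInt α (fun S => if G.Reaches G.ext S then 1 else 0)]
  · rw [psiTilde, dualForestPoly, forests]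
    simp only [ite_mul, one_mul, zero_mul]
    rw [← Finset.sum_filter]
    refine Finset.sum_congr ?_ fun _ _ => rfl
    ext S
    have := G.card_internal
    simp only [Finset.mem_filter, Finset.mem_univ, true_and, Finset.mem_powersetCard,
      Finset.subset_univ, isForest_singlePart_iff]
    refine and_congr_left fun _ => ?_
    omega
  · intro f _
    exact G.det_inc_sq G.ext (fun v : G.Internal => (v : Fin nV)) Subtype.val_injective
      (fun v => ⟨fun h => ⟨⟨v, h⟩, rfl⟩, fun ⟨j, hj⟩ => hj ▸ j.2⟩) f

theorem pairPart_comm (i j : Fin nV) : G.pairPart i j = G.pairPart j i := by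
  rw [pairPart, pairPart, Finset.pair_comm, Finset.erase_right_comm]

/-- The internal rows of the incidence matrix, extended by the row of differences of `x`. -/
def incBorder (x : Fin nV → ℝ) : Matrix (G.Internal ⊕ Unit) (Fin nE) ℝ :=
  Matrix.fromRows G.incInt (Matrix.of fun _ e => G.incExt x e)

/-- A maximal minor of `incBorder x`, as a linear function of `x`. -/
def borderMinor (f : G.Internal ⊕ Unit → Fin nE) : (Fin nV → ℝ) →ₗ[ℝ] ℝ where
  toFun x := ((G.incBorder x).submatrix id f).det
  map_add' x y := by
    have key : ∀ z, (G.incBorder z).submatrix id f =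
        ((G.incBorder 0).submatrix id f).updateRow (Sum.inr ()) (fun k => G.incExt z (f k)) := by
      intro z
      ext (j | j) k <;> simp [incBorder, Matrix.updateRow_apply]
    rw [key (x + y), key x, key y, ← Matrix.det_updateRow_add]
    congr 2
    ext k
    simp only [incExt, Pi.add_apply]
    split_ifs <;> ring
  map_smul' c x := by
    have key : ∀ z, (G.incBorder z).submatrix id f =
        ((G.incBorder 0).submatrix id f).updateRow (Sum.inr ()) (fun k => G.incExt z (f k)) := by
      intro z
      ext (j | j) k <;> simp [incBorder, Matrix.updateRow_apply]
    rw [key (c • x), key x, RingHom.id_apply, smul_eq_mul, ← Matrix.det_updateRow_smul]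
    congr 2
    ext k
    simp only [incExt, Pi.smul_apply, smul_eq_mul]
    split_ifs <;> ring

theorem borderMinor_single_sq (f : G.Internal ⊕ Unit → Fin nE) {i : Fin nV} (hi : i ∈ G.ext) :
    G.borderMinor f (Pi.single i 1) ^ 2 =
      if G.Reaches (G.ext.erase i) (Finset.univ.image f) then 1 else 0 := by
  rw [← G.det_inc_sq (G.ext.erase i) (Sum.elim (fun v : G.Internal => (v : Fin nV)) fun _ => i)
    ?_ ?_ f]
  · congr 1
    refine congrArg Matrix.det (Matrix.ext fun j k => ?_)
    rcases j with j | j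
    · simp [incBorder, incInt]
    · have : ∀ v, (if v ∈ G.ext then (Pi.single i (1 : ℝ) : Fin nV → ℝ) v else 0) =
          if v = i then 1 else 0 := by
        intro v
        by_cases h : v = i
        · subst h; simp [hi]
        · simp [h]
      simp only [incBorder, incExt, inc, this, Matrix.submatrix_apply, id, Matrix.of_apply,
        Matrix.fromRows_apply_inr, Sum.elim_inr]
      congr!
  · rintro (a | a) (b | b) h
    · exact congrArg Sum.inl (Subtype.ext h)
    · exact absurd hi (show i ∉ G.ext from (show (a : Fin nV) = i from h) ▸ a.2)
    · exact absurd hi (show i ∉ G.ext from (show i = (b : Fin nV) from h) ▸ b.2)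
    · rfl
  · intro v
    constructor
    · intro h
      by_cases hv : v = i
      · exact ⟨Sum.inr (), hv.symm⟩
      · exact ⟨Sum.inl ⟨v, fun h' => h (Finset.mem_erase.2 ⟨hv, h'⟩)⟩, rfl⟩
    · rintro ⟨a | a, rfl⟩ h
      · exact a.2 (Finset.mem_of_mem_erase h)
      · simp at h

theorem borderMinor_single_of_notMem (f : G.Internal ⊕ Unit → Fin nE) {i : Fin nV}
    (hi : i ∉ G.ext) : G.borderMinor f (Pi.single i 1) = 0 := by
  refine Matrix.det_eq_zero_of_row_eq_zero (Sum.inr ()) fun k => ?_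
  have : ∀ v, (if v ∈ G.ext then (Pi.single i (1 : ℝ) : Fin nV → ℝ) v else 0) = 0 := by
    intro v
    by_cases h : v = i
    · subst h; simp [hi]
    · simp [h]
  simp [incBorder, incExt, this]

/-- In a forest compatible with `p(i,j)`, the only connected pair of external vertices is
`i, j`. -/
theorem IsForest.pair_unique {S : Finset (Fin nE)} {i j : Fin nV} (hi : i ∈ G.ext)
    (hj : j ∈ G.ext) (hij : i ≠ j) (h : G.IsForest (G.pairPart i j) S) {a b : Fin nV}
    (ha : a ∈ G.ext) (hb : b ∈ G.ext) (hab : a ≠ b) (hr : (G.edgeGraph S).Reachable a b) :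
    (a = i ∧ b = j) ∨ (a = j ∧ b = i) := by
  have h1 := (G.isForest_pairPart_iff S hi hj hij).1 h
  have h2 := (G.isForest_pairPart_iff S hj hi hij.symm).1 (by rwa [pairPart_comm])
  have e1 := (h1.2.1.card_connectedComponent G h1.1).2
  have e2 := (h2.2.1.card_connectedComponent G h2.1).2
  have c1 : a = i ∨ b = i := by
    by_contra hc
    push Not at hc
    exact e1 a (Finset.mem_erase.2 ⟨hc.1, ha⟩) b (Finset.mem_erase.2 ⟨hc.2, hb⟩) hab hr
  have c2 : a = j ∨ b = j := by
    by_contra hc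
    push Not at hc
    exact e2 a (Finset.mem_erase.2 ⟨hc.1, ha⟩) b (Finset.mem_erase.2 ⟨hc.2, hb⟩) hab hr
  rcases c1 with rfl | rfl <;> rcases c2 with rfl | rfl
  · exact absurd rfl hij
  · exact Or.inl ⟨rfl, rfl⟩
  · exact Or.inr ⟨rfl, rfl⟩
  · exact absurd rfl hij

theorem borderMinor_eq_zero (f : G.Internal ⊕ Unit → Fin nE) {i j : Fin nV} (hi : i ∈ G.ext)
    (hj : j ∈ G.ext) (hij : i ≠ j) (h : G.IsForest (G.pairPart i j) (Finset.univ.image f))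
    (x : Fin nV → ℝ) (hx : x i = x j) : G.borderMinor f x = 0 := by
  have h1 := ((G.isForest_pairPart_iff _ hi hj hij).1 h).2.1
  choose w hw hvw using h1
  have hw' : ∀ v, w v ∈ G.ext := fun v => Finset.mem_of_mem_erase (hw v)
  have hxx : ∀ a ∈ G.ext, ∀ b ∈ G.ext,
      (G.edgeGraph (Finset.univ.image f)).Reachable a b → x a = x b := by
    intro a ha b hb hab
    by_cases hne : a = b
    · rw [hne]
    · rcases h.pair_unique G hi hj hij ha hb hne hab with ⟨rfl, rfl⟩ | ⟨rfl, rfl⟩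
      · exact hx
      · exact hx.symm
  change ((G.incBorder x).submatrix id f).det = 0
  rw [← Matrix.exists_vecMul_eq_zero_iff]
  refine ⟨Sum.elim (fun v : G.Internal => x (w v)) 1, ?_, ?_⟩
  · intro h0
    simpa using congrFun h0 (Sum.inr ())
  · ext k
    have hFx : ∀ v ∈ G.ext, x (w v) = x v := fun v hv => (hxx v hv _ (hw' v) (hvw v)).symm
    have hs := G.sum_internal_inc (fun v => if v ∈ G.ext then 0 else x (w v))
      (fun v hv => if_pos hv) (f k)
    have hre := G.reachable_ends (S := Finset.univ.image f)
      (Finset.mem_image_of_mem f (Finset.mem_univ k))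
    have hc : x (w (G.ends (f k)).1) = x (w (G.ends (f k)).2) :=
      hxx _ (hw' _) _ (hw' _) ((hvw _).symm.trans (hre.trans (hvw _)))
    have hInt : ∑ v : G.Internal, (if (v : Fin nV) ∈ G.ext then 0 else x (w v)) *
        G.inc ℝ v (f k) = ∑ v : G.Internal, x (w v) * G.inc ℝ v (f k) :=
      Finset.sum_congr rfl fun v _ => by rw [if_neg v.2]
    rw [hInt] at hs
    simp only [Matrix.vecMul, dotProduct, Fintype.sum_sum_type, Sum.elim_inl, Sum.elim_inr,
      Matrix.submatrix_apply, id, incBorder, Matrix.fromRows_apply_inl,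
      Matrix.fromRows_apply_inr, incInt, Matrix.of_apply, hs, Finset.univ_unique,
      Finset.sum_singleton, Pi.one_apply, one_mul, Pi.zero_apply, incExt]
    by_cases hu : (G.ends (f k)).1 ∈ G.ext <;> by_cases hv : (G.ends (f k)).2 ∈ G.ext <;>
      simp only [hu, hv, if_true, if_false]
    · rw [← hFx _ hu, ← hFx _ hv, hc]; ring
    · rw [← hFx _ hu, hc]; ring
    · rw [← hFx _ hv, hc]; ring
    · rw [hc]; ring

theorem borderMinor_sq (f : G.Internal ⊕ Unit → Fin nE) (hf : Function.Injective f)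
    (x : Fin nV → ℝ) :
    G.borderMinor f x ^ 2 = ∑ i ∈ G.ext, ∑ j ∈ G.ext.filter (fun j => i < j),
      if G.IsForest (G.pairPart i j) (Finset.univ.image f) then (x i - x j) ^ 2 else 0 := by
  have hcard : (Finset.univ.image f).card = Fintype.card G.Internal + 1 := by
    rw [Finset.card_image_of_injective _ hf, Finset.card_univ, Fintype.card_sum]
    simp
  have hexists : ∀ i ∈ G.ext, G.Reaches (G.ext.erase i) (Finset.univ.image f) →
      ∃ j ∈ G.ext, i ≠ j ∧ G.IsForest (G.pairPart i j) (Finset.univ.image f) := by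
    intro i hi hr
    obtain ⟨j, hj, hij⟩ := hr i
    rw [Finset.mem_erase] at hj
    refine ⟨j, hj.2, hj.1.symm, (G.isForest_pairPart_iff _ hi hj.2 hj.1.symm).2 ⟨?_, hr, hij⟩⟩
    have h1 := G.card_internal
    have h2 := Finset.card_erase_add_one hi
    omega
  by_cases hp : ∃ i ∈ G.ext, ∃ j ∈ G.ext, i < j ∧
      G.IsForest (G.pairPart i j) (Finset.univ.image f)
  · obtain ⟨i, hi, j, hj, hij, hF⟩ := hp
    have hF' := (G.isForest_pairPart_iff _ hi hj hij.ne).1 hF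
    have hlin : G.borderMinor f x = (x i - x j) * G.borderMinor f (Pi.single i 1) := by
      have hdec : x = Function.update x i (x j) + (x i - x j) • Pi.single i (1 : ℝ) := by
        ext v
        by_cases hv : v = i
        · subst hv; simp
        · simp [hv]
      conv_lhs => rw [hdec]
      rw [map_add, map_smul, G.borderMinor_eq_zero f hi hj hij.ne hF _ (by simp [hij.ne']),
        zero_add, smul_eq_mul]
    rw [hlin, mul_pow, G.borderMinor_single_sq f hi, if_pos hF'.2.1, mul_one]
    rw [Finset.sum_eq_single_of_mem i hi, Finset.sum_eq_single_of_mem j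
      (Finset.mem_filter.2 ⟨hj, hij⟩), if_pos hF]
    · intro b hb hbj
      rw [Finset.mem_filter] at hb
      refine if_neg fun hFb => ?_
      have := ((G.isForest_pairPart_iff _ hi hb.1 hb.2.ne).1 hFb).2.2
      rcases hF.pair_unique G hi hj hij.ne hi hb.1 hb.2.ne this with h | h
      · exact hbj h.2
      · exact hij.ne h.1
    · intro a ha hai
      refine Finset.sum_eq_zero fun b hb => if_neg fun hFb => ?_
      rw [Finset.mem_filter] at hb
      have := ((G.isForest_pairPart_iff _ ha hb.1 hb.2.ne).1 hFb).2.2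
      rcases hF.pair_unique G hi hj hij.ne ha hb.1 hb.2.ne this with h | h
      · exact hai h.1
      · have := hb.2
        rw [h.1, h.2] at this
        exact absurd this hij.not_gt
  · have hz : ∀ i, G.borderMinor f (Pi.single i 1) = 0 := by
      intro i
      by_cases hi : i ∈ G.ext
      · rw [← sq_eq_zero_iff, G.borderMinor_single_sq f hi, if_neg]
        intro hr
        obtain ⟨j, hj, hij, hF⟩ := hexists i hi hr
        rcases lt_or_gt_of_ne hij with h | h
        · exact hp ⟨i, hi, j, hj, h, hF⟩
        · exact hp ⟨j, hj, i, hi, h, by rwa [pairPart_comm]⟩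
      · exact G.borderMinor_single_of_notMem f hi
    have h0 : G.borderMinor f x = 0 := by
      rw [LinearMap.pi_apply_eq_sum_univ]
      refine Finset.sum_eq_zero fun i _ => ?_
      have : (fun j => if i = j then (1 : ℝ) else 0) = Pi.single i 1 := by
        ext j; simp [Pi.single_apply, eq_comm]
      rw [this, hz, smul_zero]
    rw [h0]
    symm
    rw [zero_pow two_ne_zero]
    refine Finset.sum_eq_zero fun i hi => Finset.sum_eq_zero fun j hj => if_neg fun hF => ?_
    rw [Finset.mem_filter] at hj
    exact hp ⟨i, hi, j, hj.1, hj.2, hF⟩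

theorem det_incBorder (x : Fin nV → ℝ) (α : Fin nE → ℝ) :
    (G.incBorder x * Matrix.diagonal α * (G.incBorder x).transpose).det =
      ∑ i ∈ G.ext, ∑ j ∈ G.ext.filter (fun j => i < j),
        (x i - x j) ^ 2 * G.dualForestPoly (G.pairPart i j) α := by
  rw [det_gram_eq_sum (G.incBorder x) α (fun S => ∑ i ∈ G.ext, ∑ j ∈ G.ext.filter (fun j => i < j),
    if G.IsForest (G.pairPart i j) S then (x i - x j) ^ 2 else 0)
    (fun f hf => G.borderMinor_sq f hf x)]
  simp only [Finset.sum_mul]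
  rw [Finset.sum_comm]
  refine Finset.sum_congr rfl fun i hi => ?_
  rw [Finset.sum_comm]
  refine Finset.sum_congr rfl fun j hj => ?_
  rw [Finset.mem_filter] at hj
  simp only [ite_mul, zero_mul]
  rw [← Finset.sum_filter, dualForestPoly, Finset.mul_sum, forests]
  refine Finset.sum_congr ?_ fun _ _ => rfl
  ext S
  simp only [Finset.mem_filter, Finset.mem_powersetCard, Finset.subset_univ, true_and,
    Finset.mem_univ, and_iff_right_iff_imp, Fintype.card_sum, Fintype.card_unit]
  intro h
  have h1 := ((G.isForest_pairPart_iff S hi hj.1 hj.2.ne).1 h).1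
  have h2 := G.card_internal
  have h3 := Finset.card_erase_add_one hi
  omega

end FeynmanGraph

/-- Iterated integration of a product whose factors are constant in the later variables. -/
theorem lintegral_pi_prod_of_rank {ι : Type*} [Fintype ι] {E : Type*} [MeasureSpace E] [Nonempty E]
    [SigmaFinite (volume : Measure E)] (g : ι → (ι → E) → ℝ≥0∞) (hg : ∀ i, Measurable (g i))
    (C : ι → ℝ≥0∞) (rank : ι → ℕ)
    (hC : ∀ i x, ∫⁻ t, g i (Function.update x i t) = C i)
    (hrank : ∀ i j x t, i ≠ j → rank i ≤ rank j → g i (Function.update x j t) = g i x) :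
    ∫⁻ x, ∏ i, g i x = ∏ i, C i := by
  have key : ∀ s : Finset ι,
      (∫⋯∫⁻_s, (fun x => ∏ i ∈ s, g i x) ∂(fun _ => (volume : Measure E))) =
        fun _ => ∏ i ∈ s, C i := by
    intro s
    induction s using Finset.induction_on_max_value rank with
    | empty => simp
    | insert a s ha hmax ih =>
      have hm : Measurable fun x => ∏ i ∈ insert a s, g i x := by fun_prop
      rw [lmarginal_insert' _ hm ha]
      have : (fun x => ∫⁻ t, ∏ i ∈ insert a s, g i (Function.update x a t)) =
          fun x => C a * ∏ i ∈ s, g i x := by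
        funext x
        have h1 : ∀ t, ∏ i ∈ insert a s, g i (Function.update x a t) =
            g a (Function.update x a t) * ∏ i ∈ s, g i x := by
          intro t
          rw [Finset.prod_insert ha]
          congr 1
          refine Finset.prod_congr rfl fun i hi => hrank i a x t ?_ (hmax i hi)
          rintro rfl
          exact ha hi
        simp_rw [h1]
        rw [lintegral_mul_const _ (by have := (hg a).comp (measurable_update x (a := a)); exact this), hC]
      rw [this]
      funext x
      have h2 : (∫⋯∫⁻_s, (fun x => C a * ∏ i ∈ s, g i x) ∂(fun _ => (volume : Measure E))) x =
          C a * (∫⋯∫⁻_s, (fun x => ∏ i ∈ s, g i x) ∂(fun _ => (volume : Measure E))) x := by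
        rw [lmarginal, lmarginal, lintegral_const_mul]
        have : Measurable fun x => ∏ i ∈ s, g i x := by fun_prop
        exact this.comp measurable_updateFinset
      rw [h2, ih, Finset.prod_insert ha]
  have h := key Finset.univ
  rw [lmarginal_univ] at h
  exact congrFun h fun _ => Classical.arbitrary E

theorem lintegral_pi_prod {ι : Type*} [Fintype ι] {E : Type*} [MeasureSpace E] [Nonempty E]
    [SigmaFinite (volume : Measure E)] (f : ι → E → ℝ≥0∞) (hf : ∀ i, Measurable (f i)) :
    ∫⁻ x : ι → E, ∏ i, f i (x i) = ∏ i, ∫⁻ t, f i t := by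
  refine lintegral_pi_prod_of_rank (fun i x => f i (x i))
    (fun i => (hf i).comp (measurable_pi_apply i)) _ (fun _ => 0) (fun i x => by simp) ?_
  intro i j x t hij _
  simp [Function.update_of_ne hij]

theorem measurePreserving_flip (ι κ : Type*) [Fintype ι] [Fintype κ] :
    MeasurePreserving (fun (f : ι → κ → ℝ) (k : κ) (i : ι) => f i k) := by
  have hm : Measurable (fun (f : ι → κ → ℝ) (k : κ) (i : ι) => f i k) := by fun_prop
  refine ⟨hm, ?_⟩
  symm
  refine Measure.pi_eq_generateFrom (C := fun _ => Set.pi Set.univ ''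
    Set.pi Set.univ fun _ : ι => {s : Set ℝ | MeasurableSet s}) (fun _ => generateFrom_pi)
    (fun _ => isPiSystem_pi) (fun _ => Measure.FiniteSpanningSetsIn.pi
      fun _ => (volume : Measure ℝ).toFiniteSpanningSetsIn) ?_
  intro s hs
  choose t ht hts using hs
  have hts : ∀ k, s k = Set.univ.pi (t k) := fun k => (hts k).symm
  rw [Measure.map_apply hm (MeasurableSet.univ_pi fun k => by
    rw [hts k]; exact MeasurableSet.univ_pi fun i => ht k i trivial)]
  have : (fun (f : ι → κ → ℝ) (k : κ) (i : ι) => f i k) ⁻¹' Set.univ.pi s =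
      Set.univ.pi fun i => Set.univ.pi fun k => t k i := by
    ext f
    simp only [Set.mem_preimage, Set.mem_univ_pi, hts]
    exact forall_comm
  rw [this]
  have hv : ∀ k, (volume : Measure (ι → ℝ)) (s k) = ∏ i, volume (t k i) := fun k => by
    rw [hts, volume_pi_pi]
  change volume _ = ∏ k, volume (s k)
  simp_rw [hv, volume_pi_pi]
  exact Finset.prod_comm (f := fun i k => volume (t k i))

open scoped MatrixOrder in
theorem Matrix.PosDef.exists_transpose_mul_self {ι : Type*} [Fintype ι] [DecidableEq ι]
    {L : Matrix ι ι ℝ} (hL : L.PosDef) : ∃ B : Matrix ι ι ℝ, L = B.transpose * B := by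
  have hA : 0 ≤ L := hL.posSemidef.nonneg
  obtain ⟨X, hX, -, h⟩ := CFC.exists_sqrt_of_isSelfAdjoint_of_quasispectrumRestricts
    (a := L) hL.1 (QuasispectrumRestricts.nnreal_of_nonneg hA)
  have hX' : X.transpose = X := by
    simpa [Matrix.star_eq_conjTranspose] using hX.star_eq
  exact ⟨X, by rw [hX']; exact h.symm⟩

theorem lintegral_gaussian_pi (ι : Type*) [Fintype ι] :
    ∫⁻ v : ι → ℝ, ENNReal.ofReal (Real.exp (-∑ i, v i ^ 2)) =
      ENNReal.ofReal (Real.pi ^ ((Fintype.card ι : ℝ) / 2)) := by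
  have h1 : ∫⁻ t : ℝ, ENNReal.ofReal (Real.exp (-t ^ 2)) = ENNReal.ofReal (√Real.pi) := by
    rw [← ofReal_integral_eq_lintegral_ofReal]
    · have := integral_gaussian 1
      simp only [neg_mul, one_mul, div_one] at this
      rw [this]
    · simpa using integrable_exp_neg_mul_sq (b := 1) one_pos
    · exact Filter.Eventually.of_forall fun t => (Real.exp_pos _).le
  have h2 : ∀ v : ι → ℝ, ENNReal.ofReal (Real.exp (-∑ i, v i ^ 2)) =
      ∏ i, ENNReal.ofReal (Real.exp (-v i ^ 2)) := by
    intro v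
    rw [← Finset.sum_neg_distrib, Real.exp_sum, ENNReal.ofReal_prod_of_nonneg]
    exact fun i _ => (Real.exp_pos _).le
  simp_rw [h2]
  rw [lintegral_pi_prod (fun _ t => ENNReal.ofReal (Real.exp (-t ^ 2))) (fun _ => by fun_prop)]
  simp_rw [h1]
  rw [Finset.prod_const, Finset.card_univ, ← ENNReal.ofReal_pow (Real.sqrt_nonneg _),
    Real.sqrt_eq_rpow, ← Real.rpow_natCast, ← Real.rpow_mul Real.pi_pos.le]
  congr 2
  ring

/-- The Gaussian integral for a positive definite quadratic form. -/
theorem lintegral_exp_neg_quadForm {ι : Type*} [Fintype ι] [DecidableEq ι]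
    {L : Matrix ι ι ℝ} (hL : L.PosDef) :
    ∫⁻ v : ι → ℝ, ENNReal.ofReal (Real.exp (-(v ⬝ᵥ L.mulVec v))) =
      ENNReal.ofReal (Real.pi ^ ((Fintype.card ι : ℝ) / 2) * L.det ^ (-(1 / 2 : ℝ))) := by
  obtain ⟨B, rfl⟩ := hL.exists_transpose_mul_self
  have hdet : (B.transpose * B).det = B.det ^ 2 := by
    rw [Matrix.det_mul, Matrix.det_transpose, sq]
  have hpos := hL.det_pos
  have hB : B.det ≠ 0 := by
    intro h
    rw [hdet, h] at hpos
    simp at hpos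
  have hq : ∀ v : ι → ℝ, v ⬝ᵥ (B.transpose * B).mulVec v = ∑ i, (B.mulVec v i) ^ 2 := by
    intro v
    rw [← Matrix.mulVec_mulVec, Matrix.dotProduct_mulVec, Matrix.vecMul_transpose]
    simp [dotProduct, sq]
  simp_rw [hq]
  have hmap := Real.map_matrix_volume_pi_eq_smul_volume_pi hB
  have hF : Measurable fun v : ι → ℝ => ENNReal.ofReal (Real.exp (-∑ i, v i ^ 2)) := by fun_prop
  have hlin : Measurable (Matrix.toLin' B) :=
    (LinearMap.continuous_of_finiteDimensional _).measurable
  have h := lintegral_map (μ := volume) hF hlin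
  rw [hmap, lintegral_smul_measure, lintegral_gaussian_pi] at h
  simp only [Matrix.toLin'_apply] at h
  rw [← h, smul_eq_mul, ← ENNReal.ofReal_mul (abs_nonneg _), hdet, mul_comm]
  congr 2
  rw [← sq_abs, abs_inv, ← Real.rpow_natCast, ← Real.rpow_mul (abs_nonneg _),
    ← Real.rpow_neg_one]
  norm_num

namespace FeynmanGraph

variable {nV nE : ℕ} (G : FeynmanGraph nV nE)

theorem assemble_sub (x : Fin nV → ℝ) (y : G.Internal → ℝ) (e : Fin nE) :
    G.assemble x y (G.ends e).1 - G.assemble x y (G.ends e).2 =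
      G.incInt.transpose.mulVec y e + G.incExt x e := by
  have h := G.sum_internal_inc (G.assemble 0 y) (fun v hv => by simp [assemble, hv]) e
  have h2 : G.incInt.transpose.mulVec y e =
      G.assemble 0 y (G.ends e).1 - G.assemble 0 y (G.ends e).2 := by
    rw [← h, Matrix.mulVec, dotProduct]
    refine Finset.sum_congr rfl fun v _ => ?_
    simp [assemble, v.2, incInt, mul_comm]
  rw [h2]
  simp only [assemble, incExt]
  split_ifs <;> simp_all <;> ring

theorem lapInt_quadForm (α : Fin nE → ℝ) (y : G.Internal → ℝ) :
    y ⬝ᵥ (G.lapInt α).mulVec y = ∑ e, α e * (G.incInt.transpose.mulVec y e) ^ 2 := by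
  rw [lapInt, ← Matrix.mulVec_mulVec, ← Matrix.mulVec_mulVec, Matrix.dotProduct_mulVec,
    ← Matrix.mulVec_transpose]
  simp only [dotProduct, Matrix.mulVec_diagonal]
  exact Finset.sum_congr rfl fun e _ => by ring

theorem lapInt_posDef (hcomp : ∀ v : Fin nV, ∃ w ∈ G.ext,
    (G.edgeGraph Finset.univ).Reachable v w) {α : Fin nE → ℝ} (hα : ∀ e, 0 < α e) :
    (G.lapInt α).PosDef := by
  rw [Matrix.posDef_iff_dotProduct_mulVec]
  refine ⟨?_, fun y hy => ?_⟩
  · rw [Matrix.IsHermitian, lapInt]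
    simp [Matrix.mul_assoc]
  · rw [star_trivial, lapInt_quadForm]
    refine lt_of_le_of_ne (Finset.sum_nonneg fun e _ => mul_nonneg (hα e).le (sq_nonneg _)) ?_
    intro h0
    refine hy (funext fun v => ?_)
    have h1 := (Finset.sum_eq_zero_iff_of_nonneg
      fun e _ => mul_nonneg (hα e).le (sq_nonneg _)).1 h0.symm
    obtain ⟨w, hw, hvw⟩ := hcomp v
    have h2 := G.eq_of_reachable (F := G.assemble 0 y) (S := Finset.univ) (fun e _ => ?_) hvw
    · simpa [assemble, v.2, hw] using h2
    · have h3 := G.assemble_sub 0 y e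
      have h4 := h1 e (Finset.mem_univ e)
      have h5 : G.incInt.transpose.mulVec y e = 0 := by
        simpa [(hα e).ne'] using h4
      rw [h5] at h3
      have h6 : G.incExt 0 e = 0 := by simp [incExt]
      rw [h6] at h3
      linarith

theorem psiTilde_pos (hcomp : ∀ v : Fin nV, ∃ w ∈ G.ext,
    (G.edgeGraph Finset.univ).Reachable v w) {α : Fin nE → ℝ} (hα : ∀ e, 0 < α e) :
    0 < G.psiTilde α := by
  rw [psiTilde_eq_det]
  exact (G.lapInt_posDef hcomp hα).det_pos

/-- Completing the square in the energy of a configuration in one coordinate. -/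
theorem exists_energy_eq (hcomp : ∀ v : Fin nV, ∃ w ∈ G.ext,
    (G.edgeGraph Finset.univ).Reachable v w) {α : Fin nE → ℝ} (hα : ∀ e, 0 < α e)
    (x : Fin nV → ℝ) :
    ∃ v₀ : G.Internal → ℝ, ∀ y : G.Internal → ℝ,
      ∑ e, α e * (G.assemble x y (G.ends e).1 - G.assemble x y (G.ends e).2) ^ 2 =
        (y + v₀) ⬝ᵥ (G.lapInt α).mulVec (y + v₀) +
          (∑ i ∈ G.ext, ∑ j ∈ G.ext.filter (fun j => i < j),
            (x i - x j) ^ 2 * G.dualForestPoly (G.pairPart i j) α) / G.psiTilde α := by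
  have hL := G.lapInt_posDef hcomp hα
  have hdet : (G.lapInt α).det ≠ 0 := hL.det_pos.ne'
  have hunit : IsUnit (G.lapInt α).det := isUnit_iff_ne_zero.2 hdet
  set L := G.lapInt α with hLdef
  set A := G.incInt with hA
  set a : Fin nE → ℝ := G.incExt x with ha
  set b : G.Internal → ℝ := A.mulVec (fun e => α e * a e) with hb
  set v₀ := L⁻¹.mulVec b with hv₀
  have hLv : L.mulVec v₀ = b := by
    rw [hv₀, Matrix.mulVec_mulVec, Matrix.mul_nonsing_inv _ hunit, Matrix.one_mulVec]
  have hsymm : ∀ u w : G.Internal → ℝ, u ⬝ᵥ L.mulVec w = w ⬝ᵥ L.mulVec u := by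
    intro u w
    have hT : L.transpose = L := by
      have h := hL.1
      rwa [Matrix.IsHermitian, Matrix.conjTranspose_eq_transpose_of_trivial] at h
    rw [Matrix.dotProduct_mulVec, ← Matrix.mulVec_transpose, hT, dotProduct_comm]
  have hdetB : (G.incBorder x * Matrix.diagonal α * (G.incBorder x).transpose).det =
      L.det * (∑ e, α e * a e ^ 2 - v₀ ⬝ᵥ b) := by
    have hblock : G.incBorder x * Matrix.diagonal α * (G.incBorder x).transpose =
        Matrix.fromBlocks L (Matrix.of fun v _ => b v) (Matrix.of fun _ v => b v)
          (Matrix.of fun _ _ => ∑ e, α e * a e ^ 2) := by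
      rw [incBorder, Matrix.transpose_fromRows, Matrix.fromRows_mul, Matrix.fromRows_mul_fromCols]
      ext (v | v) (w | w)
      · rfl
      all_goals
        simp only [Matrix.fromBlocks_apply₁₂, Matrix.fromBlocks_apply₂₁,
          Matrix.fromBlocks_apply₂₂]
        rw [Matrix.mul_apply]
        simp only [Matrix.mul_diagonal,
          Matrix.transpose_apply, Matrix.of_apply, hb, Matrix.mulVec, dotProduct]
        exact Finset.sum_congr rfl fun e _ => by ring
    rw [hblock]
    have := Matrix.invertibleOfIsUnitDet L hunit
    rw [Matrix.det_fromBlocks₁₁, Matrix.det_unique (n := Unit)]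
    congr 1
    rw [Matrix.sub_apply, Matrix.of_apply, Matrix.mul_assoc, Matrix.invOf_eq_nonsing_inv]
    congr 1
    rw [dotProduct_comm]
    rfl
  refine ⟨v₀, fun y => ?_⟩
  rw [← det_incBorder, psiTilde_eq_det, hdetB, mul_div_cancel_left₀ _ hdet]
  simp only [assemble_sub]
  have h1 : (y + v₀) ⬝ᵥ L.mulVec (y + v₀) = y ⬝ᵥ L.mulVec y + 2 * (y ⬝ᵥ b) + v₀ ⬝ᵥ b := by
    rw [Matrix.mulVec_add, dotProduct_add, add_dotProduct, add_dotProduct, hsymm v₀ y, hLv]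
    ring
  have h2 : y ⬝ᵥ b = ∑ e, α e * (A.transpose.mulVec y e * a e) := by
    rw [hb, Matrix.dotProduct_mulVec, ← Matrix.mulVec_transpose, dotProduct]
    exact Finset.sum_congr rfl fun e _ => by ring
  rw [h1, h2, hLdef, lapInt_quadForm, Finset.mul_sum, add_assoc, add_sub_cancel,
    ← Finset.sum_add_distrib, ← Finset.sum_add_distrib]
  exact Finset.sum_congr rfl fun e _ => by ring

/-- The energy of a configuration with edge conductances `α`. -/
def energy {d : ℕ} (x : Fin nV → EuclideanSpace ℝ (Fin d)) (α : Fin nE → ℝ)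
    (y : G.Internal → EuclideanSpace ℝ (Fin d)) : ℝ :=
  ∑ e, α e * ‖G.assemble x y (G.ends e).1 - G.assemble x y (G.ends e).2‖ ^ 2

theorem assemble_apply {d : ℕ} (x : Fin nV → EuclideanSpace ℝ (Fin d))
    (y : G.Internal → EuclideanSpace ℝ (Fin d)) (v : Fin nV) (c : Fin d) :
    G.assemble x y v c = G.assemble (fun w => x w c) (fun w => y w c) v := by
  simp only [assemble]
  split_ifs <;> rfl

theorem energy_eq_sum {d : ℕ} (x : Fin nV → EuclideanSpace ℝ (Fin d)) (α : Fin nE → ℝ)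
    (y : G.Internal → EuclideanSpace ℝ (Fin d)) :
    G.energy x α y = ∑ c, ∑ e, α e * (G.assemble (fun w => x w c) (fun w => y w c) (G.ends e).1 -
      G.assemble (fun w => x w c) (fun w => y w c) (G.ends e).2) ^ 2 := by
  rw [energy, Finset.sum_comm]
  refine Finset.sum_congr rfl fun e _ => ?_
  rw [EuclideanSpace.norm_sq_eq, Finset.mul_sum]
  refine Finset.sum_congr rfl fun c _ => ?_
  rw [PiLp.sub_apply, assemble_apply, assemble_apply, Real.norm_eq_abs, sq_abs]

theorem phiTilde_eq_sum {d : ℕ} (x : Fin nV → EuclideanSpace ℝ (Fin d)) (α : Fin nE → ℝ) :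
    G.phiTilde x α = ∑ c, ∑ i ∈ G.ext, ∑ j ∈ G.ext.filter (fun j => i < j),
      (x i c - x j c) ^ 2 * G.dualForestPoly (G.pairPart i j) α := by
  rw [phiTilde, Finset.sum_comm]
  refine Finset.sum_congr rfl fun i _ => ?_
  rw [Finset.sum_comm]
  refine Finset.sum_congr rfl fun j _ => ?_
  rw [EuclideanSpace.norm_sq_eq, Finset.sum_mul]
  refine Finset.sum_congr rfl fun c _ => ?_
  rw [PiLp.sub_apply, Real.norm_eq_abs, sq_abs]

/-- The Gaussian integral over the internal positions. -/
theorem lintegral_exp_neg_energy (hcomp : ∀ v : Fin nV, ∃ w ∈ G.ext,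
    (G.edgeGraph Finset.univ).Reachable v w) {α : Fin nE → ℝ} (hα : ∀ e, 0 < α e) {d : ℕ}
    (x : Fin nV → EuclideanSpace ℝ (Fin d)) :
    ∫⁻ y, ENNReal.ofReal (Real.exp (-G.energy x α y)) =
      ENNReal.ofReal (Real.pi ^ ((d : ℝ) / 2 * (Fintype.card G.Internal : ℝ)) *
        (G.psiTilde α ^ (-((d : ℝ) / 2)) * Real.exp (-(G.phiTilde x α / G.psiTilde α)))) := by
  have hmp : MeasurePreserving (fun (y : G.Internal → EuclideanSpace ℝ (Fin d)) (c : Fin d)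
      (v : G.Internal) => y v c) :=
    (measurePreserving_flip G.Internal (Fin d)).comp
      (volume_preserving_pi fun _ : G.Internal => PiLp.volume_preserving_ofLp (Fin d))
  set q : Fin d → (G.Internal → ℝ) → ℝ := fun c w =>
    ∑ e, α e * (G.assemble (fun w => x w c) w (G.ends e).1 -
      G.assemble (fun w => x w c) w (G.ends e).2) ^ 2 with hq
  set φ : Fin d → ℝ := fun c => ∑ i ∈ G.ext, ∑ j ∈ G.ext.filter (fun j => i < j),
      (x i c - x j c) ^ 2 * G.dualForestPoly (G.pairPart i j) α with hφ
  have hqm : ∀ c, Measurable fun w => ENNReal.ofReal (Real.exp (-q c w)) := by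
    intro c
    simp only [hq, assemble_sub, Matrix.mulVec, dotProduct]
    fun_prop
  have h1 : ∀ y : G.Internal → EuclideanSpace ℝ (Fin d),
      ENNReal.ofReal (Real.exp (-G.energy x α y)) =
        ∏ c, ENNReal.ofReal (Real.exp (-q c fun v => y v c)) := by
    intro y
    rw [energy_eq_sum, ← Finset.sum_neg_distrib, Real.exp_sum, ENNReal.ofReal_prod_of_nonneg]
    exact fun i _ => (Real.exp_pos _).le
  have h2 : ∀ c, ∫⁻ w, ENNReal.ofReal (Real.exp (-q c w)) =
      ENNReal.ofReal (Real.pi ^ ((Fintype.card G.Internal : ℝ) / 2) *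
        (G.psiTilde α ^ (-(1 / 2 : ℝ)) * Real.exp (-(φ c / G.psiTilde α)))) := by
    intro c
    obtain ⟨v₀, hv₀⟩ := G.exists_energy_eq hcomp hα (fun w => x w c)
    have h3 : ∀ w, ENNReal.ofReal (Real.exp (-q c w)) =
        ENNReal.ofReal (Real.exp (-((w + v₀) ⬝ᵥ (G.lapInt α).mulVec (w + v₀)))) *
          ENNReal.ofReal (Real.exp (-(φ c / G.psiTilde α))) := by
      intro w
      rw [← ENNReal.ofReal_mul (Real.exp_pos _).le, ← Real.exp_add, ← neg_add, ← hv₀ w]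
    simp_rw [h3]
    rw [lintegral_mul_const' _ _ ENNReal.ofReal_ne_top, lintegral_add_right_eq_self
      (fun w => ENNReal.ofReal (Real.exp (-(w ⬝ᵥ (G.lapInt α).mulVec w)))),
      lintegral_exp_neg_quadForm (G.lapInt_posDef hcomp hα), ← psiTilde_eq_det,
      ← ENNReal.ofReal_mul, mul_assoc]
    have := G.psiTilde_pos hcomp hα
    positivity
  simp_rw [h1]
  have hF : Measurable fun w : Fin d → G.Internal → ℝ =>
      ∏ c, ENNReal.ofReal (Real.exp (-q c (w c))) :=
    Finset.measurable_prod _ fun c _ => (hqm c).comp (measurable_pi_apply c)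
  have h4 := hmp.lintegral_comp hF
  rw [h4, lintegral_pi_prod (fun c w => ENNReal.ofReal (Real.exp (-q c w))) hqm]
  have hψ := G.psiTilde_pos hcomp hα
  simp_rw [h2]
  rw [← ENNReal.ofReal_prod_of_nonneg (fun c _ => by positivity), Finset.prod_mul_distrib,
    Finset.prod_mul_distrib, Finset.prod_const, Finset.prod_const, ← Real.exp_sum,
    Finset.sum_neg_distrib, ← Finset.sum_div, ← phiTilde_eq_sum, Finset.card_univ,
    Fintype.card_fin, ← Real.rpow_natCast, ← Real.rpow_natCast, ← Real.rpow_mul Real.pi_pos.le,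
    ← Real.rpow_mul hψ.le]
  have e1 : (Fintype.card G.Internal : ℝ) / 2 * (d : ℝ) =
      (d : ℝ) / 2 * (Fintype.card G.Internal : ℝ) := by ring
  have e2 : -(1 / 2 : ℝ) * (d : ℝ) = -((d : ℝ) / 2) := by ring
  rw [e1, e2]

/-- `Φ̃` is positive on the open orthant. -/
theorem phiTilde_pos (hcomp : ∀ v : Fin nV, ∃ w ∈ G.ext,
    (G.edgeGraph Finset.univ).Reachable v w) {α : Fin nE → ℝ} (hα : ∀ e, 0 < α e) {d : ℕ}
    (hconn : ∃ i ∈ G.ext, ∃ j ∈ G.ext, i ≠ j ∧ (G.edgeGraph Finset.univ).Reachable i j)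
    (x : Fin nV → EuclideanSpace ℝ (Fin d))
    (hx : ∀ v ∈ G.ext, ∀ w ∈ G.ext, v ≠ w → x v ≠ x w) :
    0 < G.phiTilde x α := by
  have hψ := G.psiTilde_pos hcomp hα
  have hE := fun c => G.exists_energy_eq hcomp hα (fun w => x w c)
  choose v₀ hv₀ using hE
  set y : G.Internal → EuclideanSpace ℝ (Fin d) := fun v => WithLp.toLp 2 fun c => -v₀ c v with hy
  have h1 : G.energy x α y = G.phiTilde x α / G.psiTilde α := by
    rw [energy_eq_sum, phiTilde_eq_sum, Finset.sum_div]
    refine Finset.sum_congr rfl fun c _ => ?_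
    rw [hv₀ c]
    have : (fun w => y w c) + v₀ c = 0 := by
      funext v
      simp [hy]
    rw [this]
    simp
  have h2 : 0 < G.energy x α y := by
    refine lt_of_le_of_ne (Finset.sum_nonneg fun e _ => mul_nonneg (hα e).le (sq_nonneg _)) ?_
    intro h0
    have h3 := (Finset.sum_eq_zero_iff_of_nonneg
      fun e _ => mul_nonneg (hα e).le (sq_nonneg _)).1 h0.symm
    obtain ⟨i, hi, j, hj, hij, hr⟩ := hconn
    have h4 := G.eq_of_reachable (F := G.assemble x y) (S := Finset.univ) (fun e _ => ?_) hr
    · exact hx i hi j hj hij (by simpa [assemble, hi, hj] using h4)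
    · have h5 := h3 e (Finset.mem_univ e)
      simpa [(hα e).ne', sub_eq_zero] using h5
  rw [h1] at h2
  exact (div_pos_iff_of_pos_right hψ).1 h2

end FeynmanGraph

section LaplaceTransform

variable {Ω : Type*} {m : ℕ}

/-- The integrand of a derivative of a multivariate Laplace transform. -/
def laplaceKernel (ρ : Fin (m + 1) → Ω → ℝ) (k : Fin (m + 1) → ℕ) (α : Fin (m + 1) → ℝ)
    (ω : Ω) : ℝ :=
  (∏ e, ρ e ω ^ k e) * Real.exp (-∑ e, α e * ρ e ω)

variable {ρ : Fin (m + 1) → Ω → ℝ}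

theorem laplaceKernel_nonneg (k : Fin (m + 1) → ℕ) (α : Fin (m + 1) → ℝ) {ω : Ω}
    (h0 : ∀ e, 0 ≤ ρ e ω) : 0 ≤ laplaceKernel ρ k α ω :=
  mul_nonneg (Finset.prod_nonneg fun e _ => pow_nonneg (h0 e) _) (Real.exp_pos _).le

theorem laplaceKernel_add_single (k : Fin (m + 1) → ℕ) (α : Fin (m + 1) → ℝ) (e : Fin (m + 1))
    (ω : Ω) : laplaceKernel ρ (k + Pi.single e 1) α ω = ρ e ω * laplaceKernel ρ k α ω := by
  have : ∏ e', ρ e' ω ^ (k + Pi.single e 1 : Fin (m + 1) → ℕ) e' =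
      ρ e ω * ∏ e', ρ e' ω ^ k e' := by
    simp only [Pi.add_apply, pow_add, Finset.prod_mul_distrib]
    rw [mul_comm]
    congr 1
    rw [Finset.prod_eq_single e]
    · simp
    · intro b _ hb
      simp [Pi.single_eq_of_ne hb]
    · simp
  rw [laplaceKernel, laplaceKernel, this, mul_assoc]

theorem laplaceKernel_update (k : Fin (m + 1) → ℕ) (α : Fin (m + 1) → ℝ) (e : Fin (m + 1))
    (t : ℝ) (ω : Ω) : laplaceKernel ρ k (Function.update α e t) ω =
      laplaceKernel ρ k α ω * Real.exp (-((t - α e) * ρ e ω)) := by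
  rw [laplaceKernel, laplaceKernel, mul_assoc, ← Real.exp_add]
  congr 2
  have : ∑ e', Function.update α e t e' * ρ e' ω =
      ∑ e', (α e' * ρ e' ω + if e' = e then (t - α e) * ρ e ω else 0) := by
    refine Finset.sum_congr rfl fun e' _ => ?_
    split_ifs with h
    · subst h
      simp
      ring
    · simp [h]
  rw [this, Finset.sum_add_distrib, Finset.sum_ite_eq' Finset.univ e, if_pos (Finset.mem_univ e),
    neg_add]

variable [MeasurableSpace Ω] {μ : Measure Ω}

theorem measurable_laplaceKernel (hρ : ∀ e, Measurable (ρ e)) (k : Fin (m + 1) → ℕ)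
    (α : Fin (m + 1) → ℝ) : Measurable (laplaceKernel ρ k α) := by
  unfold laplaceKernel
  fun_prop

theorem integrable_laplaceKernel (hρ : ∀ e, Measurable (ρ e)) (h0 : ∀ᵐ ω ∂μ, ∀ e, 0 ≤ ρ e ω)
    (hInt : ∀ α, (∀ e, 0 < α e) → Integrable (laplaceKernel ρ 0 α) μ) (k : Fin (m + 1) → ℕ)
    {α : Fin (m + 1) → ℝ} (hα : ∀ e, 0 < α e) : Integrable (laplaceKernel ρ k α) μ := by
  have hbase := (hInt (fun e => α e / 2) fun e => half_pos (hα e)).const_mul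
    (∏ e, ((k e).factorial * (2 / α e) ^ k e : ℝ))
  refine hbase.mono' (measurable_laplaceKernel hρ k α).aestronglyMeasurable ?_
  filter_upwards [h0] with ω hω
  rw [Real.norm_of_nonneg (laplaceKernel_nonneg k α hω)]
  simp only [laplaceKernel, Pi.zero_apply, pow_zero, Finset.prod_const_one, one_mul,
    ← Finset.sum_neg_distrib, Real.exp_sum]
  rw [← Finset.prod_mul_distrib, ← Finset.prod_mul_distrib]
  refine Finset.prod_le_prod (fun e _ => mul_nonneg (pow_nonneg (hω e) _) (Real.exp_pos _).le)
    fun e _ => ?_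
  have ht : 0 ≤ α e / 2 * ρ e ω := mul_nonneg (half_pos (hα e)).le (hω e)
  have h1 := Real.pow_div_factorial_le_exp _ ht (k e)
  have hf : (0 : ℝ) < (k e).factorial := by exact_mod_cast Nat.factorial_pos _
  rw [div_le_iff₀ hf] at h1
  have h2 : ρ e ω ^ k e = (2 / α e) ^ k e * (α e / 2 * ρ e ω) ^ k e := by
    rw [← mul_pow]
    congr 1
    have := (hα e).ne'
    field_simp
  have h3 : Real.exp (-(α e * ρ e ω)) =
      Real.exp (-(α e / 2 * ρ e ω)) * Real.exp (-(α e / 2 * ρ e ω)) := by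
    rw [← Real.exp_add]
    congr 1
    ring
  have h4 : Real.exp (α e / 2 * ρ e ω) * Real.exp (-(α e / 2 * ρ e ω)) = 1 := by
    rw [← Real.exp_add]
    simp
  have hpos : 0 ≤ (2 / α e) ^ k e := by
    have := hα e
    positivity
  calc ρ e ω ^ k e * Real.exp (-(α e * ρ e ω))
      = (2 / α e) ^ k e * (α e / 2 * ρ e ω) ^ k e *
        (Real.exp (-(α e / 2 * ρ e ω)) * Real.exp (-(α e / 2 * ρ e ω))) := by rw [h2, h3]
    _ ≤ (2 / α e) ^ k e * (Real.exp (α e / 2 * ρ e ω) * (k e).factorial) *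
        (Real.exp (-(α e / 2 * ρ e ω)) * Real.exp (-(α e / 2 * ρ e ω))) := by gcongr
    _ = (k e).factorial * (2 / α e) ^ k e *
        (Real.exp (α e / 2 * ρ e ω) * Real.exp (-(α e / 2 * ρ e ω))) *
          Real.exp (-(α e / 2 * ρ e ω)) := by ring
    _ = _ := by rw [h4, mul_one]

theorem hasDerivAt_laplace (hρ : ∀ e, Measurable (ρ e)) (h0 : ∀ᵐ ω ∂μ, ∀ e, 0 ≤ ρ e ω)
    (hInt : ∀ α, (∀ e, 0 < α e) → Integrable (laplaceKernel ρ 0 α) μ) (k : Fin (m + 1) → ℕ)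
    {α : Fin (m + 1) → ℝ} (hα : ∀ e, 0 < α e) (e : Fin (m + 1)) :
    HasDerivAt (fun t => ∫ ω, laplaceKernel ρ k (Function.update α e t) ω ∂μ)
      (-∫ ω, laplaceKernel ρ (k + Pi.single e 1) α ω ∂μ) (α e) := by
  have hα' : ∀ e', 0 < Function.update α e (α e / 2) e' := by
    intro e'
    by_cases h : e' = e
    · subst h
      simpa using hα e'
    · simpa [h] using hα e'
  have hderiv : ∀ ω t, HasDerivAt (fun t => laplaceKernel ρ k (Function.update α e t) ω)
      (-laplaceKernel ρ (k + Pi.single e 1) (Function.update α e t) ω) t := by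
    intro ω t
    rw [laplaceKernel_add_single]
    simp only [laplaceKernel_update]
    have h1 : HasDerivAt (fun t : ℝ => -((t - α e) * ρ e ω)) (-(1 * ρ e ω)) t :=
      (((hasDerivAt_id t).sub_const (α e)).mul_const (ρ e ω)).neg
    have h2 := h1.exp.const_mul (laplaceKernel ρ k α ω)
    refine h2.congr_deriv ?_
    ring
  have hmeas : ∀ t, AEStronglyMeasurable (laplaceKernel ρ k (Function.update α e t)) μ :=
    fun t => (measurable_laplaceKernel hρ _ _).aestronglyMeasurable
  have hInt₀ : Integrable (laplaceKernel ρ k (Function.update α e (α e))) μ := by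
    rw [Function.update_eq_self]
    exact integrable_laplaceKernel hρ h0 hInt k hα
  have hmeas' : AEStronglyMeasurable
      (fun ω => -laplaceKernel ρ (k + Pi.single e 1) (Function.update α e (α e)) ω) μ :=
    (measurable_laplaceKernel hρ _ _).neg.aestronglyMeasurable
  have hbound : ∀ᵐ ω ∂μ, ∀ t ∈ Set.Ioi (α e / 2),
      ‖-laplaceKernel ρ (k + Pi.single e 1) (Function.update α e t) ω‖ ≤
        laplaceKernel ρ (k + Pi.single e 1) (Function.update α e (α e / 2)) ω := by
    filter_upwards [h0] with ω hω t ht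
    rw [norm_neg, Real.norm_of_nonneg (laplaceKernel_nonneg _ _ hω), laplaceKernel_update,
      laplaceKernel_update]
    refine mul_le_mul_of_nonneg_left ?_ (laplaceKernel_nonneg _ _ hω)
    rw [Real.exp_le_exp, neg_le_neg_iff]
    exact mul_le_mul_of_nonneg_right (sub_le_sub_right (le_of_lt ht) _) (hω e)
  have key := (hasDerivAt_integral_of_dominated_loc_of_deriv_le
    (Ioi_mem_nhds (half_lt_self (hα e))) (Filter.Eventually.of_forall hmeas) hInt₀ hmeas' hbound
    (integrable_laplaceKernel hρ h0 hInt _ hα')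
    (Filter.Eventually.of_forall fun ω t _ => hderiv ω t)).2
  rw [integral_neg, Function.update_eq_self] at key
  exact key

theorem pderivE_laplace (hρ : ∀ e, Measurable (ρ e)) (h0 : ∀ᵐ ω ∂μ, ∀ e, 0 ≤ ρ e ω)
    (hInt : ∀ α, (∀ e, 0 < α e) → Integrable (laplaceKernel ρ 0 α) μ) (k : Fin (m + 1) → ℕ)
    (c : ℝ) (f : (Fin (m + 1) → ℝ) → ℝ)
    (hf : ∀ α, (∀ e, 0 < α e) → f α = c * ∫ ω, laplaceKernel ρ k α ω ∂μ) (e : Fin (m + 1))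
    (α : Fin (m + 1) → ℝ) (hα : ∀ e, 0 < α e) :
    pderivE e f α = (-c) * ∫ ω, laplaceKernel ρ (k + Pi.single e 1) α ω ∂μ := by
  have h1 : (fun t => f (Function.update α e t)) =ᶠ[nhds (α e)]
      fun t => c * ∫ ω, laplaceKernel ρ k (Function.update α e t) ω ∂μ := by
    filter_upwards [Ioi_mem_nhds (hα e)] with t ht
    refine hf _ fun e' => ?_
    by_cases h : e' = e
    · subst h
      simpa using ht
    · simpa [h] using hα e'
  rw [pderivE, h1.deriv_eq, ((hasDerivAt_laplace hρ h0 hInt k hα e).const_mul c).deriv]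
  ring

theorem iterate_pderivE_laplace (hρ : ∀ e, Measurable (ρ e)) (h0 : ∀ᵐ ω ∂μ, ∀ e, 0 ≤ ρ e ω)
    (hInt : ∀ α, (∀ e, 0 < α e) → Integrable (laplaceKernel ρ 0 α) μ) (k : Fin (m + 1) → ℕ)
    (c : ℝ) (f : (Fin (m + 1) → ℝ) → ℝ)
    (hf : ∀ α, (∀ e, 0 < α e) → f α = c * ∫ ω, laplaceKernel ρ k α ω ∂μ) (e : Fin (m + 1))
    (j : ℕ) : ∀ α : Fin (m + 1) → ℝ, (∀ e, 0 < α e) → (pderivE e)^[j] f α =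
      ((-1) ^ j * c) * ∫ ω, laplaceKernel ρ (k + Pi.single e j) α ω ∂μ := by
  induction j with
  | zero => simpa using hf
  | succ j ih =>
    intro α hα
    rw [Function.iterate_succ_apply', pderivE_laplace hρ h0 hInt _ _ _ ih e α hα, add_assoc,
      ← Pi.single_add]
    congr 1
    ring

theorem multiDeriv_laplace (hρ : ∀ e, Measurable (ρ e)) (h0 : ∀ᵐ ω ∂μ, ∀ e, 0 ≤ ρ e ω)
    (hInt : ∀ α, (∀ e, 0 < α e) → Integrable (laplaceKernel ρ 0 α) μ) (n : Fin (m + 1) → ℕ)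
    (c : ℝ) (f : (Fin (m + 1) → ℝ) → ℝ)
    (hf : ∀ α, (∀ e, 0 < α e) → f α = c * ∫ ω, laplaceKernel ρ 0 α ω ∂μ)
    (α : Fin (m + 1) → ℝ) (hα : ∀ e, 0 < α e) :
    multiDeriv n f α = ((-1) ^ (∑ e, n e) * c) * ∫ ω, laplaceKernel ρ n α ω ∂μ := by
  have key : ∀ l : List (Fin (m + 1)), ∀ α : Fin (m + 1) → ℝ, (∀ e, 0 < α e) →
      l.foldr (fun e g => (pderivE e)^[n e] g) f α =
        ((-1) ^ (l.map n).sum * c) *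
          ∫ ω, laplaceKernel ρ (l.map fun e => Pi.single e (n e)).sum α ω ∂μ := by
    intro l
    induction l with
    | nil => simpa using hf
    | cons e l ih =>
      intro α hα
      rw [List.foldr_cons, iterate_pderivE_laplace hρ h0 hInt _ _ _ ih e (n e) α hα]
      simp only [List.map_cons, List.sum_cons]
      rw [add_comm (Pi.single e (n e) : Fin (m + 1) → ℕ), pow_add]
      congr 1
      ring
  rw [multiDeriv, key _ α hα, Finset.sum_map_toList, Finset.sum_map_toList,
    Finset.univ_sum_single]

end LaplaceTransform

theorem lintegral_rpow_mul_exp_neg_mul_Ioi {a r : ℝ} (ha : 0 < a) (hr : 0 < r) :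
    ∫⁻ t in Set.Ioi (0 : ℝ), ENNReal.ofReal (t ^ (a - 1) * Real.exp (-(r * t))) =
      ENNReal.ofReal (r ^ (-a) * Real.Gamma a) := by
  have h := Real.integral_rpow_mul_exp_neg_mul_Ioi ha hr
  rw [← ofReal_integral_eq_lintegral_ofReal, h, one_div, Real.inv_rpow hr.le, Real.rpow_neg hr.le]
  · by_contra hcon
    rw [integral_undef hcon] at h
    have : 0 < (1 / r) ^ a * Real.Gamma a := mul_pos (by positivity) (Real.Gamma_pos_of_pos ha)
    exact this.ne h
  · filter_upwards [ae_restrict_mem measurableSet_Ioi] with t ht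
    exact mul_nonneg (Real.rpow_nonneg (le_of_lt ht) _) (Real.exp_pos _).le

theorem lintegral_comp_smul_pi {ι : Type*} [Fintype ι] (F : (ι → ℝ) → ℝ≥0∞) (hF : Measurable F)
    {s : ℝ} (hs : 0 < s) :
    ∫⁻ γ, F γ = ENNReal.ofReal (s ^ Fintype.card ι) * ∫⁻ β, F (s • β) := by
  have h := Measure.map_addHaar_smul (volume : Measure (ι → ℝ)) hs.ne'
  have h1 := lintegral_map (μ := volume) hF (measurable_const_smul s : Measurable fun β : ι → ℝ => s • β)
  rw [h, lintegral_smul_measure, smul_eq_mul, Module.finrank_fintype_fun_eq_card] at h1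
  rw [← h1, ← mul_assoc, ← ENNReal.ofReal_mul (by positivity), abs_inv,
    abs_of_pos (by positivity : 0 < s ^ Fintype.card ι), mul_inv_cancel₀ (by positivity),
    ENNReal.ofReal_one, one_mul]

theorem measurable_chart {m : ℕ} :
    Measurable (chart : ({e : Fin (m + 1) // e ≠ 0} → ℝ) → Fin (m + 1) → ℝ) := by
  refine measurable_pi_iff.2 fun e => ?_
  unfold chart
  split_ifs <;> fun_prop

theorem chart_pos {m : ℕ} {β : {e : Fin (m + 1) // e ≠ 0} → ℝ} (hβ : ∀ e, 0 < β e)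
    (e : Fin (m + 1)) : 0 < chart β e := by
  unfold chart
  split_ifs
  · exact one_pos
  · exact hβ _

/-- Projective coordinates on the open orthant: a scale and a point of the affine chart. -/
theorem setLIntegral_orthant_eq_chart {m : ℕ} (F : (Fin (m + 1) → ℝ) → ℝ≥0∞) (hF : Measurable F) :
    ∫⁻ α in {α : Fin (m + 1) → ℝ | ∀ e, 0 < α e}, F α =
      ∫⁻ β in {β : {e : Fin (m + 1) // e ≠ 0} → ℝ | ∀ e, 0 < β e}, ∫⁻ s in Set.Ioi (0 : ℝ),
        ENNReal.ofReal (s ^ m) * F (s • chart β) := by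
  have hmα : MeasurableSet {α : Fin (m + 1) → ℝ | ∀ e, 0 < α e} := by
    rw [Set.ofPred_forall]
    exact MeasurableSet.iInter fun e => measurableSet_lt measurable_const (measurable_pi_apply e)
  have hmβ : MeasurableSet {β : {e : Fin (m + 1) // e ≠ 0} → ℝ | ∀ e, 0 < β e} := by
    rw [Set.ofPred_forall]
    exact MeasurableSet.iInter fun e => measurableSet_lt measurable_const (measurable_pi_apply e)
  let join : ℝ × ({e : Fin (m + 1) // e ≠ 0} → ℝ) → Fin (m + 1) → ℝ :=
    fun q e => if h : e = 0 then q.1 else q.2 ⟨e, h⟩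
  have hjoin : MeasurePreserving join := by
    have h1 := (volume_preserving_piEquivPiSubtypeProd (fun _ : Fin (m + 1) => ℝ)
      (fun e => e = 0)).symm
    have h2' : ∀ inst : Fintype {e : Fin (m + 1) // e = 0},
        MeasurePreserving (MeasurableEquiv.funUnique {e : Fin (m + 1) // e = 0} ℝ).symm volume
          (@Measure.pi _ _ inst _ fun _ => (volume : Measure ℝ)) := by
      intro inst
      obtain rfl : inst = Unique.fintype := Subsingleton.elim _ _
      exact (volume_preserving_funUnique {e : Fin (m + 1) // e = 0} ℝ).symm
    have h2 := h2' (Subtype.fintype fun e => e = 0)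
    have h3 := h2.prod (MeasurePreserving.id (volume : Measure ({e : Fin (m + 1) // ¬ e = 0} → ℝ)))
    exact MeasurePreserving.comp h1 h3
  have hcard : Fintype.card {e : Fin (m + 1) // e ≠ 0} = m := by
    rw [Fintype.card_subtype_compl]
    simp
  set F' := Set.indicator {α : Fin (m + 1) → ℝ | ∀ e, 0 < α e} F with hF'
  have hF'm : Measurable F' := hF.indicator hmα
  rw [← lintegral_indicator hmα, ← hF', ← hjoin.lintegral_comp hF'm]
  have hm1 : Measurable fun q => F' (join q) := hF'm.comp hjoin.measurable
  change ∫⁻ q, F' (join q) ∂(volume.prod volume) = _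
  rw [lintegral_prod _ hm1.aemeasurable, ← setLIntegral_univ,
    ← lintegral_inter_add_sdiff _ _ (measurableSet_Ioi (a := (0 : ℝ)))]
  have hz : ∫⁻ s in Set.univ \ Set.Ioi (0 : ℝ), ∫⁻ γ, F' (join (s, γ)) = 0 := by
    rw [setLIntegral_eq_zero (MeasurableSet.univ.diff measurableSet_Ioi)]
    intro s hs
    have : ∀ γ, F' (join (s, γ)) = 0 := by
      intro γ
      refine Set.indicator_of_notMem (fun h => hs.2 ?_) _
      simpa [join] using h 0
    simp [this]
  rw [hz, add_zero, Set.univ_inter]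
  have h4 : ∀ s ∈ Set.Ioi (0 : ℝ), ∫⁻ γ, F' (join (s, γ)) =
      ∫⁻ β in {β : {e : Fin (m + 1) // e ≠ 0} → ℝ | ∀ e, 0 < β e},
        ENNReal.ofReal (s ^ m) * F (s • chart β) := by
    intro s hs
    have hs' : 0 < s := hs
    have hms : Measurable fun γ => F' (join (s, γ)) := hm1.comp measurable_prodMk_left
    rw [lintegral_comp_smul_pi (fun γ => F' (join (s, γ))) hms hs', hcard,
      ← lintegral_const_mul _ ?_, ← lintegral_indicator hmβ]
    · congr 1
      funext β
      have hj : join (s, s • β) = s • chart β := by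
        funext e
        simp only [join, chart, Pi.smul_apply, smul_eq_mul]
        split_ifs <;> simp
      by_cases hβ : ∀ e, 0 < β e
      · rw [Set.indicator_of_mem (show β ∈ {β : {e : Fin (m + 1) // e ≠ 0} → ℝ | ∀ e, 0 < β e}
          from hβ), hj, hF', Set.indicator_of_mem]
        exact fun e => mul_pos hs' (chart_pos hβ e)
      · rw [Set.indicator_of_notMem (show β ∉ {β : {e : Fin (m + 1) // e ≠ 0} → ℝ | ∀ e, 0 < β e}
          from hβ), hj, hF', Set.indicator_of_notMem, mul_zero]
        refine fun h => hβ fun e => ?_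
        have := h e
        simp only [Pi.smul_apply, smul_eq_mul, chart, e.2, dite_false] at this
        exact (pos_iff_pos_of_mul_pos this).1 hs'
    · exact hms.comp (measurable_const_smul s)
  rw [setLIntegral_congr_fun measurableSet_Ioi h4, lintegral_lintegral_swap]
  refine Measurable.aemeasurable ?_
  have : Measurable fun q : ℝ × ({e : Fin (m + 1) // e ≠ 0} → ℝ) => q.1 • chart q.2 :=
    measurable_fst.smul (measurable_chart.comp measurable_snd)
  exact (by fun_prop : Measurable fun q : ℝ × ({e : Fin (m + 1) // e ≠ 0} → ℝ) =>
    ENNReal.ofReal (q.1 ^ m)).mul (hF.comp this)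

namespace FeynmanGraph

variable {nV nE : ℕ} (G : FeynmanGraph nV nE)

theorem card_intVerts : G.intVerts.card = Fintype.card G.Internal := by
  rw [Fintype.card_subtype, intVerts]

theorem dualForestPoly_smul {p : Finset (Finset (Fin nV))} {k : ℕ} (hk : k + p.card = nV) (s : ℝ)
    (α : Fin nE → ℝ) : G.dualForestPoly p (s • α) = s ^ k * G.dualForestPoly p α := by
  rw [dualForestPoly, dualForestPoly, Finset.mul_sum]
  refine Finset.sum_congr rfl fun F hF => ?_
  have h := (Finset.mem_filter.1 hF).2.1
  have hc : F.card = k := by omega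
  simp [Finset.prod_mul_distrib, hc]

theorem psiTilde_smul (s : ℝ) (α : Fin nE → ℝ) :
    G.psiTilde (s • α) = s ^ Fintype.card G.Internal * G.psiTilde α :=
  G.dualForestPoly_smul (by rw [card_singlePart, card_internal]) s α

theorem phiTilde_smul {d : ℕ} (x : Fin nV → EuclideanSpace ℝ (Fin d)) (s : ℝ) (α : Fin nE → ℝ) :
    G.phiTilde x (s • α) = s ^ (Fintype.card G.Internal + 1) * G.phiTilde x α := by
  rw [phiTilde, phiTilde, Finset.mul_sum]
  refine Finset.sum_congr rfl fun i hi => ?_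
  rw [Finset.mul_sum]
  refine Finset.sum_congr rfl fun j hj => ?_
  rw [Finset.mem_filter] at hj
  have hc : Fintype.card G.Internal + 1 + (G.pairPart i j).card = nV := by
    rw [G.card_pairPart hj.1 hj.2.ne, add_assoc, add_comm 1, Finset.card_erase_add_one hi,
      card_internal]
  rw [G.dualForestPoly_smul hc]
  ring

/-- The squared edge lengths of a configuration of the internal vertices, times a scale. -/
def scaledSq {d : ℕ} (x : Fin nV → EuclideanSpace ℝ (Fin d)) (e : Fin nE)
    (ω : ℝ × (G.Internal → EuclideanSpace ℝ (Fin d))) : ℝ :=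
  ω.1 * ‖G.assemble x ω.2 (G.ends e).1 - G.assemble x ω.2 (G.ends e).2‖ ^ 2

/-- The measure `s^(λν_G - 1) ds dy` on scales and configurations. -/
def scaleMeasure (d : ℕ) : Measure (ℝ × (G.Internal → EuclideanSpace ℝ (Fin d))) :=
  ((volume.restrict (Set.Ioi (0 : ℝ))).withDensity
    fun s => ENNReal.ofReal (s ^ (lam d * ∑ e, G.ν e - 1))).prod volume

theorem measurable_assemble {d : ℕ} (x : Fin nV → EuclideanSpace ℝ (Fin d)) (v : Fin nV) :
    Measurable fun y : G.Internal → EuclideanSpace ℝ (Fin d) => G.assemble x y v := by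
  unfold assemble
  split_ifs <;> fun_prop

theorem measurable_scaledSq {d : ℕ} (x : Fin nV → EuclideanSpace ℝ (Fin d)) (e : Fin nE) :
    Measurable (G.scaledSq x e) :=
  measurable_fst.mul ((((G.measurable_assemble x _).comp measurable_snd).sub
    ((G.measurable_assemble x _).comp measurable_snd)).norm.pow_const 2)

theorem lintegral_scaleMeasure {d : ℕ}
    {F : ℝ × (G.Internal → EuclideanSpace ℝ (Fin d)) → ℝ≥0∞} (hF : Measurable F) :
    ∫⁻ ω, F ω ∂(G.scaleMeasure d) = ∫⁻ s in Set.Ioi (0 : ℝ),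
      ENNReal.ofReal (s ^ (lam d * ∑ e, G.ν e - 1)) * ∫⁻ y, F (s, y) := by
  rw [scaleMeasure, lintegral_prod _ hF.aemeasurable, lintegral_withDensity_eq_lintegral_mul _
    (by fun_prop) hF.lintegral_prod_right']
  rfl

theorem ae_scaledSq_nonneg {d : ℕ} (x : Fin nV → EuclideanSpace ℝ (Fin d)) :
    ∀ᵐ ω ∂(G.scaleMeasure d), ∀ e, 0 ≤ G.scaledSq x e ω := by
  have h : ∀ᵐ s ∂((volume.restrict (Set.Ioi (0 : ℝ))).withDensity
      fun s => ENNReal.ofReal (s ^ (lam d * ∑ e, G.ν e - 1))), 0 < s :=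
    (withDensity_absolutelyContinuous _ _).ae_le (ae_restrict_mem measurableSet_Ioi)
  filter_upwards [Measure.quasiMeasurePreserving_fst.ae h] with ω hω e
  exact mul_nonneg hω.le (by positivity)

theorem laplaceKernel_scaledSq {m d : ℕ} (G : FeynmanGraph nV (m + 1))
    (x : Fin nV → EuclideanSpace ℝ (Fin d)) (k : Fin (m + 1) → ℕ) (α : Fin (m + 1) → ℝ) (s : ℝ)
    (y : G.Internal → EuclideanSpace ℝ (Fin d)) :
    laplaceKernel (G.scaledSq x) k α (s, y) = s ^ (∑ e, k e) *
      ((∏ e, ‖G.assemble x y (G.ends e).1 - G.assemble x y (G.ends e).2‖ ^ (2 * k e)) *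
        Real.exp (-G.energy x (s • α) y)) := by
  rw [laplaceKernel, energy, ← mul_assoc, ← Finset.prod_pow_eq_pow_sum, ← Finset.prod_mul_distrib]
  congr 1
  · refine Finset.prod_congr rfl fun e _ => ?_
    rw [scaledSq, mul_pow, pow_mul]
  · congr 2
    refine Finset.sum_congr rfl fun e _ => ?_
    simp only [scaledSq, Pi.smul_apply, smul_eq_mul]
    ring

theorem lintegral_laplaceKernel_zero {m d : ℕ} (G : FeynmanGraph nV (m + 1)) (hM : 0 < G.Mdeg d)
    (hcomp : ∀ v : Fin nV, ∃ w ∈ G.ext, (G.edgeGraph Finset.univ).Reachable v w)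
    (hconn : ∃ i ∈ G.ext, ∃ j ∈ G.ext, i ≠ j ∧ (G.edgeGraph Finset.univ).Reachable i j)
    (x : Fin nV → EuclideanSpace ℝ (Fin d))
    (hx : ∀ v ∈ G.ext, ∀ w ∈ G.ext, v ≠ w → x v ≠ x w) {α : Fin (m + 1) → ℝ}
    (hα : ∀ e, 0 < α e) :
    ∫⁻ ω, ENNReal.ofReal (laplaceKernel (G.scaledSq x) 0 α ω) ∂(G.scaleMeasure d) =
      ENNReal.ofReal (Real.pi ^ ((d : ℝ) / 2 * (Fintype.card G.Internal : ℝ)) *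
        Real.Gamma (G.Mdeg d) * (G.phiTilde x α ^ (-(G.Mdeg d)) *
          G.psiTilde α ^ (-((d : ℝ) / 2 - G.Mdeg d)))) := by
  have hΨ := G.psiTilde_pos hcomp hα
  have hΦ := G.phiTilde_pos hcomp hα hconn x hx
  set k := Fintype.card G.Internal with hk
  set A := lam d * ∑ e, G.ν e with hA
  have hAM : A = G.Mdeg d + (d : ℝ) / 2 * (k : ℝ) := by
    rw [Mdeg, card_intVerts]
    ring
  rw [lintegral_scaleMeasure _
    (measurable_laplaceKernel (G.measurable_scaledSq x) 0 α).ennreal_ofReal]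
  have h1 : ∀ s ∈ Set.Ioi (0 : ℝ), ENNReal.ofReal (s ^ (A - 1)) *
      ∫⁻ y, ENNReal.ofReal (laplaceKernel (G.scaledSq x) 0 α (s, y)) =
      ENNReal.ofReal (Real.pi ^ ((d : ℝ) / 2 * (k : ℝ)) * G.psiTilde α ^ (-((d : ℝ) / 2))) *
        ENNReal.ofReal (s ^ (G.Mdeg d - 1) *
          Real.exp (-((G.phiTilde x α / G.psiTilde α) * s))) := by
    intro s hs
    have hs' : 0 < s := hs
    have h2 := G.lintegral_exp_neg_energy hcomp (α := s • α) (fun e => mul_pos hs' (hα e)) x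
    simp only [laplaceKernel_scaledSq, Pi.zero_apply, Finset.sum_const_zero, pow_zero, one_mul,
      mul_zero, Finset.prod_const_one]
    rw [h2, ← ENNReal.ofReal_mul (by positivity), ← ENNReal.ofReal_mul (by positivity)]
    congr 1
    rw [psiTilde_smul, phiTilde_smul, Real.mul_rpow (by positivity) hΨ.le, ← hk]
    have h3 : s ^ (k + 1) * G.phiTilde x α / (s ^ k * G.psiTilde α) =
        G.phiTilde x α / G.psiTilde α * s := by
      rw [pow_succ]
      field_simp
    have h4 : s ^ (A - 1) * (s ^ k) ^ (-((d : ℝ) / 2)) = s ^ (G.Mdeg d - 1) := by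
      rw [← Real.rpow_natCast, ← Real.rpow_mul hs'.le, ← Real.rpow_add hs', hAM]
      congr 1
      ring
    rw [h3, ← h4]
    ring
  rw [setLIntegral_congr_fun measurableSet_Ioi h1, lintegral_const_mul _ (by fun_prop),
    lintegral_rpow_mul_exp_neg_mul_Ioi hM (div_pos hΦ hΨ), ← ENNReal.ofReal_mul (by positivity)]
  congr 1
  have h5 : G.psiTilde α ^ (-((d : ℝ) / 2 - G.Mdeg d)) =
      G.psiTilde α ^ (-((d : ℝ) / 2)) * G.psiTilde α ^ (G.Mdeg d) := by
    rw [← Real.rpow_add hΨ]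
    congr 1
    ring
  rw [h5, Real.div_rpow hΦ.le hΨ.le, Real.rpow_neg hΨ.le (G.Mdeg d)]
  field_simp

/-- Almost surely a pair of distinct vertices that are not both external has distinct positions. -/
theorem ae_assemble_ne {d : ℕ} (hd : 0 < d) (x : Fin nV → EuclideanSpace ℝ (Fin d))
    (hx : ∀ v ∈ G.ext, ∀ w ∈ G.ext, v ≠ w → x v ≠ x w) :
    ∀ᵐ y : G.Internal → EuclideanSpace ℝ (Fin d), ∀ v w, v ≠ w →
      G.assemble x y v ≠ G.assemble x y w := by
  have : Nonempty (Fin d) := ⟨⟨0, hd⟩⟩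
  have : Nontrivial (EuclideanSpace ℝ (Fin d)) := inferInstance
  have hone : ∀ v, v ∉ G.ext → ∀ w, v ≠ w → ∀ᵐ y : G.Internal → EuclideanSpace ℝ (Fin d),
      G.assemble x y v ≠ G.assemble x y w := by
    intro v hv w hvw
    by_cases hw : w ∈ G.ext
    · have h := Measure.ae_eval_ne (μ := fun _ : G.Internal =>
        (volume : Measure (EuclideanSpace ℝ (Fin d)))) ⟨v, hv⟩ (x w)
      filter_upwards [h] with y hy
      simpa [assemble, hv, hw] using hy
    · let S : Submodule ℝ (G.Internal → EuclideanSpace ℝ (Fin d)) :=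
        LinearMap.ker ((LinearMap.proj ⟨v, hv⟩ : (G.Internal → EuclideanSpace ℝ (Fin d)) →ₗ[ℝ] _) -
          LinearMap.proj ⟨w, hw⟩)
      have hS : S ≠ ⊤ := by
        obtain ⟨a, ha⟩ := exists_ne (0 : EuclideanSpace ℝ (Fin d))
        intro hT
        have : (Pi.single (⟨v, hv⟩ : G.Internal) a) ∈ S := hT ▸ Submodule.mem_top
        have hne : (⟨w, hw⟩ : G.Internal) ≠ ⟨v, hv⟩ := fun h => hvw (congrArg Subtype.val h).symm
        simp [S, LinearMap.mem_ker, Pi.single_eq_of_ne hne, ha] at this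
      have h0 := Measure.addHaar_submodule
        (volume : Measure (G.Internal → EuclideanSpace ℝ (Fin d))) S hS
      have h1 : ∀ᵐ y : G.Internal → EuclideanSpace ℝ (Fin d), y ∉ S :=
        measure_eq_zero_iff_ae_notMem.1 h0
      filter_upwards [h1] with y hy h
      refine hy ?_
      simpa [S, LinearMap.mem_ker, sub_eq_zero, assemble, hv, hw] using h
  have hall : ∀ v w, v ≠ w → ∀ᵐ y : G.Internal → EuclideanSpace ℝ (Fin d),
      G.assemble x y v ≠ G.assemble x y w := by
    intro v w hvw
    by_cases hv : v ∈ G.ext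
    · by_cases hw : w ∈ G.ext
      · refine Filter.Eventually.of_forall fun y => ?_
        simpa [assemble, hv, hw] using hx v hv w hw hvw
      · filter_upwards [hone w hw v hvw.symm] with y hy using hy.symm
    · exact hone v hv w hvw
  rw [ae_all_iff]
  intro v
  rw [ae_all_iff]
  intro w
  by_cases h : v = w
  · exact Filter.Eventually.of_forall fun y hn => absurd h hn
  · filter_upwards [hall v w h] with y hy _ using hy

end FeynmanGraph

theorem measurableSet_orthant (ι : Type*) [Fintype ι] :
    MeasurableSet {α : ι → ℝ | ∀ e, 0 < α e} := by
  rw [Set.ofPred_forall]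
  exact MeasurableSet.iInter fun e => measurableSet_lt measurable_const (measurable_pi_apply e)

theorem setLIntegral_orthant_prod_rpow_mul_exp {ι : Type*} [Fintype ι] {b q : ι → ℝ}
    (hb : ∀ e, 0 < b e) (hq : ∀ e, 0 < q e) :
    ∫⁻ α in {α : ι → ℝ | ∀ e, 0 < α e},
      ENNReal.ofReal ((∏ e, α e ^ (b e - 1)) * Real.exp (-∑ e, α e * q e)) =
      ENNReal.ofReal (∏ e, (q e ^ (-b e) * Real.Gamma (b e))) := by
  rw [← lintegral_indicator (measurableSet_orthant ι),
    ENNReal.ofReal_prod_of_nonneg fun e _ => mul_nonneg (Real.rpow_nonneg (hq e).le _)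
      (Real.Gamma_pos_of_pos (hb e)).le]
  have h := lintegral_pi_prod (fun (e : ι) => Set.indicator (Set.Ioi (0 : ℝ)) fun t =>
    ENNReal.ofReal (t ^ (b e - 1) * Real.exp (-(q e * t))))
    (fun e => Measurable.indicator (by fun_prop) measurableSet_Ioi)
  simp_rw [lintegral_indicator measurableSet_Ioi,
    fun e => lintegral_rpow_mul_exp_neg_mul_Ioi (hb e) (hq e)] at h
  rw [← h]
  congr 1
  funext α
  by_cases hα : ∀ e, 0 < α e
  · rw [Set.indicator_of_mem (show α ∈ {α : ι → ℝ | ∀ e, 0 < α e} from hα),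
      Finset.prod_congr rfl fun e _ => Set.indicator_of_mem (show α e ∈ Set.Ioi (0 : ℝ) from hα e) _,
      ← ENNReal.ofReal_prod_of_nonneg fun e _ => mul_nonneg (Real.rpow_nonneg (hα e).le _)
      (Real.exp_pos _).le, Finset.prod_mul_distrib, ← Real.exp_sum, Finset.sum_neg_distrib]
    simp_rw [mul_comm]
  · rw [Set.indicator_of_notMem (show α ∉ {α : ι → ℝ | ∀ e, 0 < α e} from hα)]
    push Not at hα
    obtain ⟨e, he⟩ := hα
    refine (Finset.prod_eq_zero (Finset.mem_univ e) ?_).symm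
    exact Set.indicator_of_notMem (fun h => absurd h (not_lt.2 he)) _

namespace FeynmanGraph

variable {nV m d : ℕ} (G : FeynmanGraph nV (m + 1))

theorem measurable_energy (x : Fin nV → EuclideanSpace ℝ (Fin d)) :
    Measurable fun p : (Fin (m + 1) → ℝ) × (G.Internal → EuclideanSpace ℝ (Fin d)) =>
      G.energy x p.1 p.2 := by
  unfold energy
  refine Finset.measurable_sum _ fun e _ => ?_
  exact ((measurable_pi_apply e).comp measurable_fst).mul
    ((((G.measurable_assemble x _).comp measurable_snd).sub
      ((G.measurable_assemble x _).comp measurable_snd)).norm.pow_const 2)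

theorem ofReal_prod_norm_rpow (n : Fin (m + 1) → ℕ) (hn : ∀ e, 0 < (n e : ℝ) + lam d * G.ν e)
    (x : Fin nV → EuclideanSpace ℝ (Fin d)) (y : G.Internal → EuclideanSpace ℝ (Fin d))
    (hy : ∀ v w, v ≠ w → G.assemble x y v ≠ G.assemble x y w) :
    ENNReal.ofReal (∏ e,
        ‖G.assemble x y (G.ends e).1 - G.assemble x y (G.ends e).2‖ ^ (-(2 * lam d * G.ν e))) =
      ENNReal.ofReal (∏ e, Real.Gamma ((n e : ℝ) + lam d * G.ν e))⁻¹ *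
        ∫⁻ α in {α : Fin (m + 1) → ℝ | ∀ e, 0 < α e},
          ENNReal.ofReal (∏ e, α e ^ ((n e : ℝ) + lam d * G.ν e - 1)) *
          ENNReal.ofReal
            ((∏ e, ‖G.assemble x y (G.ends e).1 - G.assemble x y (G.ends e).2‖ ^ (2 * n e)) *
              Real.exp (-G.energy x α y)) := by
  set r : Fin (m + 1) → ℝ :=
    fun e => ‖G.assemble x y (G.ends e).1 - G.assemble x y (G.ends e).2‖ with hr
  have hr0 : ∀ e, 0 < r e := fun e => norm_pos_iff.2 (sub_ne_zero.2 (hy _ _ (G.ends_ne e)))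
  have hΓ : 0 < ∏ e, Real.Gamma ((n e : ℝ) + lam d * G.ν e) :=
    Finset.prod_pos fun e _ => Real.Gamma_pos_of_pos (hn e)
  have hP : 0 ≤ ∏ e, r e ^ (2 * n e) := Finset.prod_nonneg fun e _ => pow_nonneg (hr0 e).le _
  have h1 : ∀ α ∈ {α : Fin (m + 1) → ℝ | ∀ e, 0 < α e},
      ENNReal.ofReal (∏ e, α e ^ ((n e : ℝ) + lam d * G.ν e - 1)) *
        ENNReal.ofReal ((∏ e, r e ^ (2 * n e)) * Real.exp (-G.energy x α y)) =
      ENNReal.ofReal (∏ e, r e ^ (2 * n e)) *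
        ENNReal.ofReal ((∏ e, α e ^ ((n e : ℝ) + lam d * G.ν e - 1)) *
          Real.exp (-∑ e, α e * r e ^ 2)) := by
    intro α hα
    rw [← ENNReal.ofReal_mul (Finset.prod_nonneg fun e _ => Real.rpow_nonneg (hα e).le _),
      ← ENNReal.ofReal_mul hP]
    congr 1
    simp only [energy, hr]
    ring
  rw [setLIntegral_congr_fun (measurableSet_orthant _) h1, lintegral_const_mul _ (by fun_prop),
    setLIntegral_orthant_prod_rpow_mul_exp hn fun e => pow_pos (hr0 e) 2,
    ← ENNReal.ofReal_mul hP, ← ENNReal.ofReal_mul (inv_nonneg.2 hΓ.le)]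
  congr 1
  rw [← Finset.prod_inv_distrib, ← Finset.prod_mul_distrib, ← Finset.prod_mul_distrib]
  refine Finset.prod_congr rfl fun e _ => ?_
  have hΓe := Real.Gamma_pos_of_pos (hn e)
  have h2 : r e ^ (2 * n e) * (r e ^ 2) ^ (-((n e : ℝ) + lam d * G.ν e)) =
      r e ^ (-(2 * lam d * G.ν e)) := by
    rw [← Real.rpow_natCast, ← Real.rpow_natCast (r e) 2, ← Real.rpow_mul (hr0 e).le,
      ← Real.rpow_add (hr0 e)]
    congr 1
    push_cast
    ring
  rw [← h2]
  field_simp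

/-- The position space integral as an iterated integral over the affine chart and the scale. -/
theorem lintegral_prod_norm_rpow (hd : 0 < d) (n : Fin (m + 1) → ℕ)
    (hn : ∀ e, 0 < (n e : ℝ) + lam d * G.ν e) (x : Fin nV → EuclideanSpace ℝ (Fin d))
    (hx : ∀ v ∈ G.ext, ∀ w ∈ G.ext, v ≠ w → x v ≠ x w) :
    ∫⁻ y : G.Internal → EuclideanSpace ℝ (Fin d), ENNReal.ofReal (∏ e,
        ‖G.assemble x y (G.ends e).1 - G.assemble x y (G.ends e).2‖ ^ (-(2 * lam d * G.ν e))) =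
      ENNReal.ofReal (∏ e, Real.Gamma ((n e : ℝ) + lam d * G.ν e))⁻¹ *
        ∫⁻ β in {β : {e : Fin (m + 1) // e ≠ 0} → ℝ | ∀ e, 0 < β e},
          ENNReal.ofReal (∏ e, chart β e ^ ((n e : ℝ) + lam d * G.ν e - 1)) *
            ∫⁻ ω, ENNReal.ofReal (laplaceKernel (G.scaledSq x) n (chart β) ω)
              ∂(G.scaleMeasure d) := by
  set B : Fin (m + 1) → ℝ := fun e => (n e : ℝ) + lam d * G.ν e with hB
  set P : (G.Internal → EuclideanSpace ℝ (Fin d)) → ℝ := fun y =>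
    ∏ e, ‖G.assemble x y (G.ends e).1 - G.assemble x y (G.ends e).2‖ ^ (2 * n e) with hP
  have hPm : Measurable P := Finset.measurable_prod _ fun e _ =>
    ((G.measurable_assemble x _).sub (G.measurable_assemble x _)).norm.pow_const _
  have hP0 : ∀ y, 0 ≤ P y := fun y => Finset.prod_nonneg fun e _ => by positivity
  have hjm : Measurable fun p : (Fin (m + 1) → ℝ) × (G.Internal → EuclideanSpace ℝ (Fin d)) =>
      ENNReal.ofReal (P p.2 * Real.exp (-G.energy x p.1 p.2)) :=
    ((hPm.comp measurable_snd).mul (G.measurable_energy x).neg.exp).ennreal_ofReal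
  have hBm : Measurable fun α : Fin (m + 1) → ℝ => ENNReal.ofReal (∏ e, α e ^ (B e - 1)) :=
    (Finset.measurable_prod _ fun e _ =>
      (measurable_pi_apply e).pow_const _).ennreal_ofReal
  have hIm : Measurable fun α : Fin (m + 1) → ℝ =>
      ∫⁻ y, ENNReal.ofReal (P y * Real.exp (-G.energy x α y)) := hjm.lintegral_prod_right'
  have hcurry : ∀ α : Fin (m + 1) → ℝ,
      Measurable fun y => ENNReal.ofReal (P y * Real.exp (-G.energy x α y)) := by
    intro α
    have h : Measurable fun y => G.energy x α y :=
      (G.measurable_energy x).comp (measurable_prodMk_left (x := α))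
    exact (hPm.mul h.neg.exp).ennreal_ofReal
  have h1 := lintegral_congr_ae ((G.ae_assemble_ne hd x hx).mono
    fun y hy => G.ofReal_prod_norm_rpow n hn x y hy)
  rw [h1, lintegral_const_mul' _ _ ENNReal.ofReal_ne_top, lintegral_lintegral_swap]
  · congr 1
    have h2 : ∀ α : Fin (m + 1) → ℝ, ∫⁻ y, ENNReal.ofReal (∏ e, α e ^ (B e - 1)) *
        ENNReal.ofReal (P y * Real.exp (-G.energy x α y)) =
        ENNReal.ofReal (∏ e, α e ^ (B e - 1)) *
          ∫⁻ y, ENNReal.ofReal (P y * Real.exp (-G.energy x α y)) :=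
      fun α => lintegral_const_mul _ (hcurry α)
    rw [lintegral_congr h2]
    refine (setLIntegral_orthant_eq_chart _ (hBm.mul hIm)).trans ?_
    refine setLIntegral_congr_fun (measurableSet_orthant _) fun β hβ => ?_
    have hc := chart_pos hβ
    rw [lintegral_scaleMeasure _
      (measurable_laplaceKernel (G.measurable_scaledSq x) n (chart β)).ennreal_ofReal,
      ← lintegral_const_mul' _ _ ENNReal.ofReal_ne_top]
    refine setLIntegral_congr_fun measurableSet_Ioi fun s hs => ?_
    have hs' : 0 < s := hs
    have h3 : ∫⁻ y, ENNReal.ofReal (laplaceKernel (G.scaledSq x) n (chart β) (s, y)) =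
        ENNReal.ofReal (s ^ (∑ e, n e)) *
          ∫⁻ y, ENNReal.ofReal (P y * Real.exp (-G.energy x (s • chart β) y)) := by
      rw [← lintegral_const_mul _ (hcurry _)]
      refine lintegral_congr fun y => ?_
      rw [laplaceKernel_scaledSq, ENNReal.ofReal_mul (by positivity)]
    have h4 : s ^ m * ∏ e, (s • chart β) e ^ (B e - 1) =
        (∏ e, chart β e ^ (B e - 1)) *
          (s ^ (lam d * ∑ e, G.ν e - 1) * s ^ (∑ e, n e)) := by
      have h5 : ∏ e, (s • chart β) e ^ (B e - 1) =
          s ^ (∑ e, (B e - 1)) * ∏ e, chart β e ^ (B e - 1) := by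
        rw [Real.rpow_sum_of_pos hs', ← Finset.prod_mul_distrib]
        refine Finset.prod_congr rfl fun e _ => ?_
        rw [Pi.smul_apply, smul_eq_mul, Real.mul_rpow hs'.le (hc e).le]
      rw [h5, ← mul_assoc, mul_comm]
      congr 1
      rw [← Real.rpow_natCast, ← Real.rpow_natCast s (∑ e, n e), ← Real.rpow_add hs',
        ← Real.rpow_add hs']
      congr 1
      simp only [hB, Finset.sum_sub_distrib, Finset.sum_add_distrib, Finset.mul_sum]
      simp
      ring
    have hc0 : 0 ≤ ∏ e, chart β e ^ (B e - 1) :=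
      Finset.prod_nonneg fun e _ => Real.rpow_nonneg (hc e).le _
    simp only [Pi.mul_apply]
    rw [h3, ← mul_assoc, ← mul_assoc, ← mul_assoc, ← ENNReal.ofReal_mul (by positivity),
      ← ENNReal.ofReal_mul hc0, ← ENNReal.ofReal_mul (by positivity), h4, mul_assoc]
  · refine Measurable.aemeasurable ?_
    have h : Measurable fun p : (G.Internal → EuclideanSpace ℝ (Fin d)) × (Fin (m + 1) → ℝ) =>
        G.energy x p.2 p.1 := (G.measurable_energy x).comp measurable_swap
    exact (hBm.comp measurable_snd).mul
      ((hPm.comp measurable_fst).mul h.neg.exp).ennreal_ofReal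

end FeynmanGraph

namespace FeynmanGraph

instance {nV nE : ℕ} (G : FeynmanGraph nV nE) (d : ℕ) : SFinite (G.scaleMeasure d) := by
  unfold scaleMeasure
  infer_instance

variable {nV m d : ℕ} (G : FeynmanGraph nV (m + 1))

theorem lintegral_laplaceKernel_eq_ofReal {Ω : Type*} [MeasurableSpace Ω] {μ : Measure Ω}
    {ρ : Fin (m + 1) → Ω → ℝ} (hρ : ∀ e, Measurable (ρ e)) (h0 : ∀ᵐ ω ∂μ, ∀ e, 0 ≤ ρ e ω)
    (hInt : ∀ α, (∀ e, 0 < α e) → Integrable (laplaceKernel ρ 0 α) μ) (k : Fin (m + 1) → ℕ)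
    {α : Fin (m + 1) → ℝ} (hα : ∀ e, 0 < α e) :
    ENNReal.ofReal (∫ ω, laplaceKernel ρ k α ω ∂μ) =
      ∫⁻ ω, ENNReal.ofReal (laplaceKernel ρ k α ω) ∂μ :=
  ofReal_integral_eq_lintegral_ofReal (integrable_laplaceKernel hρ h0 hInt k hα)
    (h0.mono fun _ h => laplaceKernel_nonneg k α h)

/-- The dual parametric representation, assuming that the position space integral is finite. -/
theorem dual_representation_of_lintegral_ne_top (hd : 0 < d) (hM : 0 < G.Mdeg d)
    (hcomp : ∀ v : Fin nV, ∃ w ∈ G.ext, (G.edgeGraph Finset.univ).Reachable v w)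
    (hconn : ∃ i ∈ G.ext, ∃ j ∈ G.ext, i ≠ j ∧ (G.edgeGraph Finset.univ).Reachable i j)
    (n : Fin (m + 1) → ℕ) (hn : ∀ e, 0 < (n e : ℝ) + lam d * G.ν e)
    (x : Fin nV → EuclideanSpace ℝ (Fin d))
    (hx : ∀ v ∈ G.ext, ∀ w ∈ G.ext, v ≠ w → x v ≠ x w)
    (hfin : ∫⁻ y : G.Internal → EuclideanSpace ℝ (Fin d), ENNReal.ofReal (∏ e,
        ‖G.assemble x y (G.ends e).1 - G.assemble x y (G.ends e).2‖ ^ (-(2 * lam d * G.ν e))) ≠ ⊤) :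
    IntegrableOn (dualIntegrand d G n x)
      {β : {e : Fin (m + 1) // e ≠ 0} → ℝ | ∀ e, 0 < β e} volume ∧
    G.posIntegral d x =
      ENNReal.ofReal
        (((-1 : ℝ) ^ (∑ e, n e) * Real.Gamma (G.Mdeg d) /
            ∏ e, Real.Gamma ((n e : ℝ) + lam d * G.ν e)) *
          ∫ β in {β : {e : Fin (m + 1) // e ≠ 0} → ℝ | ∀ e, 0 < β e},
            dualIntegrand d G n x β) := by
  set K : ℝ := Real.pi ^ ((d : ℝ) / 2 * (Fintype.card G.Internal : ℝ)) with hK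
  have hK0 : 0 < K := Real.rpow_pos_of_pos Real.pi_pos _
  have hΓM := Real.Gamma_pos_of_pos hM
  set Γs : ℝ := ∏ e, Real.Gamma ((n e : ℝ) + lam d * G.ν e) with hΓs
  have hΓ0 : 0 < Γs := Finset.prod_pos fun e _ => Real.Gamma_pos_of_pos (hn e)
  set c : ℝ := (K * Real.Gamma (G.Mdeg d))⁻¹ with hc
  have hc0 : 0 < c := inv_pos.2 (mul_pos hK0 hΓM)
  have hρ := G.measurable_scaledSq x
  have h0 := G.ae_scaledSq_nonneg x
  have hzero := fun (α : Fin (m + 1) → ℝ) (hα : ∀ e, 0 < α e) =>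
    G.lintegral_laplaceKernel_zero hM hcomp hconn x hx hα
  have hInt : ∀ α, (∀ e, 0 < α e) →
      Integrable (laplaceKernel (G.scaledSq x) 0 α) (G.scaleMeasure d) := by
    intro α hα
    refine ⟨(measurable_laplaceKernel hρ 0 α).aestronglyMeasurable, ?_⟩
    rw [hasFiniteIntegral_iff_ofReal (h0.mono fun _ h => laplaceKernel_nonneg 0 α h), hzero α hα]
    exact ENNReal.ofReal_lt_top
  have hker := fun (α : Fin (m + 1) → ℝ) (hα : ∀ e, 0 < α e) (k : Fin (m + 1) → ℕ) =>
    lintegral_laplaceKernel_eq_ofReal hρ h0 hInt k hα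
  have hnn : ∀ (α : Fin (m + 1) → ℝ) (k : Fin (m + 1) → ℕ),
      0 ≤ ∫ ω, laplaceKernel (G.scaledSq x) k α ω ∂(G.scaleMeasure d) := fun α k =>
    integral_nonneg_of_ae (h0.mono fun _ h => laplaceKernel_nonneg k α h)
  set h : (Fin (m + 1) → ℝ) → ℝ := fun α => G.phiTilde x α ^ (-(G.Mdeg d)) *
        G.psiTilde α ^ (-((d : ℝ) / 2 - G.Mdeg d)) with hh
  have hf : ∀ α, (∀ e, 0 < α e) →
      h α = c * ∫ ω, laplaceKernel (G.scaledSq x) 0 α ω ∂(G.scaleMeasure d) := by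
    intro α hα
    have h1 := (hker α hα 0).trans (hzero α hα)
    have hΨ := G.psiTilde_pos hcomp hα
    have hΦ := G.phiTilde_pos hcomp hα hconn x hx
    rw [ENNReal.ofReal_eq_ofReal_iff (hnn α 0) (by positivity)] at h1
    rw [h1, hc, ← hK]
    change _ = _ * (_ * h α)
    field_simp
  have hmd := multiDeriv_laplace hρ h0 hInt n c h hf
  set S := {β : {e : Fin (m + 1) // e ≠ 0} → ℝ | ∀ e, 0 < β e} with hS
  have hSm : MeasurableSet S := measurableSet_orthant _
  set J : ({e : Fin (m + 1) // e ≠ 0} → ℝ) → ℝ := fun β =>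
    (∏ e, chart β e ^ ((n e : ℝ) + lam d * G.ν e - 1)) *
      (c * ∫ ω, laplaceKernel (G.scaledSq x) n (chart β) ω ∂(G.scaleMeasure d)) with hJ
  have hDJ : ∀ β ∈ S, dualIntegrand d G n x β = (-1) ^ (∑ e, n e) * J β := by
    intro β hβ
    rw [dualIntegrand, hmd _ (chart_pos hβ), hJ]
    ring
  have hP0 : ∀ β ∈ S, 0 ≤ ∏ e, chart β e ^ ((n e : ℝ) + lam d * G.ν e - 1) := fun β hβ =>
    Finset.prod_nonneg fun e _ => Real.rpow_nonneg (chart_pos hβ e).le _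
  have hJ0 : ∀ β ∈ S, 0 ≤ J β := fun β hβ =>
    mul_nonneg (hP0 β hβ) (mul_nonneg hc0.le (hnn _ _))
  have hce : ∀ e, Measurable fun β : {e : Fin (m + 1) // e ≠ 0} → ℝ => chart β e :=
    fun e => (measurable_pi_apply e).comp measurable_chart
  have hJm : Measurable J := by
    refine (Finset.measurable_prod _ fun e _ => (hce e).pow_const _).mul (Measurable.const_mul ?_ c)
    refine StronglyMeasurable.measurable ?_
    refine StronglyMeasurable.integral_prod_right
      (f := fun β ω => laplaceKernel (G.scaledSq x) n (chart β) ω) (Measurable.stronglyMeasurable ?_)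
    refine Measurable.mul ?_ (Measurable.exp (Measurable.neg ?_))
    · exact Finset.measurable_prod _ fun e _ => ((hρ e).comp measurable_snd).pow_const _
    · exact Finset.measurable_sum _ fun e _ =>
        ((hce e).comp measurable_fst).mul ((hρ e).comp measurable_snd)
  set X : ℝ≥0∞ := ∫⁻ β in S,
      ENNReal.ofReal (∏ e, chart β e ^ ((n e : ℝ) + lam d * G.ν e - 1)) *
        ∫⁻ ω, ENNReal.ofReal (laplaceKernel (G.scaledSq x) n (chart β) ω) ∂(G.scaleMeasure d)
    with hX
  have hL := G.lintegral_prod_norm_rpow hd n hn x hx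
  rw [← hΓs, ← hX] at hL
  have hXtop : X ≠ ⊤ := by
    intro htop
    rw [hL, htop] at hfin
    exact hfin (ENNReal.mul_top (ENNReal.ofReal_pos.2 (inv_pos.2 hΓ0)).ne')
  have hJX : ∫⁻ β in S, ENNReal.ofReal (J β) = ENNReal.ofReal c * X := by
    rw [hX, ← lintegral_const_mul' _ _ ENNReal.ofReal_ne_top]
    refine setLIntegral_congr_fun hSm fun β hβ => ?_
    simp only [hJ]
    rw [ENNReal.ofReal_mul (hP0 β hβ), ENNReal.ofReal_mul hc0.le, hker _ (chart_pos hβ) n]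
    ring
  have hJ0' : 0 ≤ᵐ[volume.restrict S] J :=
    (ae_restrict_mem hSm).mono fun β hβ => hJ0 β hβ
  have hJint : IntegrableOn J S volume := by
    refine ⟨hJm.aestronglyMeasurable, ?_⟩
    rw [hasFiniteIntegral_iff_ofReal hJ0', hJX]
    exact ENNReal.mul_lt_top ENNReal.ofReal_lt_top hXtop.lt_top
  refine ⟨(hJint.const_mul ((-1) ^ (∑ e, n e))).congr
    ((ae_restrict_mem hSm).mono fun β hβ => (hDJ β hβ).symm), ?_⟩
  have hsq : (-1 : ℝ) ^ (∑ e, n e) * (-1) ^ (∑ e, n e) = 1 := by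
    rw [← mul_pow]
    norm_num
  have hval : (-1 : ℝ) ^ (∑ e, n e) * Real.Gamma (G.Mdeg d) / Γs *
      ∫ β in S, dualIntegrand d G n x β =
      Real.Gamma (G.Mdeg d) / Γs * ∫ β in S, J β := by
    rw [setIntegral_congr_fun hSm hDJ, integral_const_mul]
    calc _ = ((-1 : ℝ) ^ (∑ e, n e) * (-1) ^ (∑ e, n e)) *
        (Real.Gamma (G.Mdeg d) / Γs * ∫ β in S, J β) := by ring
      _ = _ := by rw [hsq, one_mul]
  rw [hval, ENNReal.ofReal_mul (by positivity), ofReal_integral_eq_lintegral_ofReal hJint hJ0', hJX,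
    ← mul_assoc, ← ENNReal.ofReal_mul (by positivity), posIntegral, card_intVerts, ← hK]
  change (∫⁻ y : G.Internal → EuclideanSpace ℝ (Fin d), _) / _ = _
  rw [hL, ENNReal.div_eq_inv_mul, ← mul_assoc, ← ENNReal.ofReal_inv_of_pos hK0,
    ← ENNReal.ofReal_mul (by positivity)]
  congr 2
  rw [hc]
  field_simp

end FeynmanGraph

/-- A minimal spanning forest of the points `z v` rooted at the points indexed by `S`, as produced
by Prim's algorithm: `pos` is the order in which the vertices are attached, `par v` is the vertex
to which `v` is attached and `root v` the element of `S` from which `v` descends. -/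
structure IsPrimForest {V X : Type*} [PseudoMetricSpace X] (S : Finset V) (z : V → X) (pos : V → ℕ)
    (par root : V → V) : Prop where
  pos_eq_zero_iff : ∀ v, pos v = 0 ↔ v ∈ S
  pos_inj : ∀ v w, v ∉ S → w ∉ S → pos v = pos w → v = w
  par_lt : ∀ v, v ∉ S → pos (par v) < pos v
  dist_par_le : ∀ v, v ∉ S → ∀ u w, pos u < pos v → pos v ≤ pos w →
    dist (z v) (z (par v)) ≤ dist (z u) (z w)
  root_of_mem : ∀ v ∈ S, root v = v
  root_of_notMem : ∀ v, v ∉ S → root v = root (par v)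

theorem exists_isPrimForest {V X : Type*} [Fintype V] [PseudoMetricSpace X] {S : Finset V}
    (hS : S.Nonempty) (z : V → X) :
    ∃ pos par root, IsPrimForest S z pos par root ∧ ∀ v, pos v ≤ Fintype.card V + 1 := by
  have key : ∀ c j : ℕ, ∀ (pos : V → ℕ) (par root : V → V),
      j + c ≤ Fintype.card V → (Finset.univ.filter fun v => pos v = j + 1).card = c →
      (∀ v, pos v ≤ j + 1) → (∀ v, pos v = 0 ↔ v ∈ S) →
      (∀ v w, v ∉ S → w ∉ S → pos v ≤ j → pos v = pos w → v = w) →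
      (∀ v, v ∉ S → pos v ≤ j → pos (par v) < pos v) →
      (∀ v, v ∉ S → pos v ≤ j → ∀ u w, pos u < pos v → pos v ≤ pos w →
        dist (z v) (z (par v)) ≤ dist (z u) (z w)) →
      (∀ v ∈ S, root v = v) → (∀ v, v ∉ S → pos v ≤ j → root v = root (par v)) →
      ∃ pos par root, IsPrimForest S z pos par root ∧ ∀ v, pos v ≤ Fintype.card V + 1 := by
    intro c
    induction c with
    | zero =>
      intro j pos par root hj hc hle hz hinj hpar hd hr hr'
      have hle' : ∀ v, pos v ≤ j := by
        intro v
        have h1 : pos v ≠ j + 1 := fun h => by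
          rw [Finset.card_eq_zero] at hc
          exact Finset.notMem_empty v (hc ▸ Finset.mem_filter.2 ⟨Finset.mem_univ v, h⟩)
        have := hle v
        omega
      refine ⟨pos, par, root, ⟨hz, fun v w hv hw => hinj v w hv hw (hle' v),
        fun v hv => hpar v hv (hle' v), fun v hv => hd v hv (hle' v), hr,
        fun v hv => hr' v hv (hle' v)⟩, fun v => ?_⟩
      have := hle' v
      omega
    | succ c ih =>
      intro j pos par root hj hc hle hz hinj hpar hd hr hr'
      set A := Finset.univ.filter fun v => pos v = j + 1 with hA
      set B := Finset.univ.filter fun v => pos v ≤ j with hB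
      have hAne : A.Nonempty := Finset.card_pos.1 (by omega)
      obtain ⟨s, hs⟩ := hS
      have hBne : B.Nonempty := ⟨s, by simp [hB, (hz s).2 hs]⟩
      obtain ⟨⟨q, v⟩, hqv, hmin⟩ := Finset.exists_min_image (B ×ˢ A)
        (fun p => dist (z p.1) (z p.2)) (hBne.product hAne)
      rw [Finset.mem_product] at hqv
      have hq : pos q ≤ j := (Finset.mem_filter.1 hqv.1).2
      have hv : pos v = j + 1 := (Finset.mem_filter.1 hqv.2).2
      have hvS : v ∉ S := fun h => by
        have := (hz v).2 h
        omega
      have hqv' : q ≠ v := fun h => by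
        rw [h] at hq
        omega
      set pos' : V → ℕ := fun w => if w = v then j + 1 else if pos w = j + 1 then j + 2 else pos w
        with hpos'
      have hp1 : pos' v = j + 1 := by simp [hpos']
      have hp2 : ∀ w, pos w ≤ j → pos' w = pos w := by
        intro w hw
        have h1 : w ≠ v := fun h => by
          rw [h] at hw
          omega
        have h2 : pos w ≠ j + 1 := by omega
        simp [hpos', h1, h2]
      have hp3 : ∀ w, w ≠ v → pos w = j + 1 → pos' w = j + 2 := by
        intro w h1 h2
        simp [hpos', h1, h2]
      have hp4 : ∀ w, w = v ∨ (w ≠ v ∧ pos w = j + 1) ∨ pos w ≤ j := by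
        intro w
        have := hle w
        by_cases h : w = v
        · exact Or.inl h
        · by_cases h2 : pos w = j + 1
          · exact Or.inr (Or.inl ⟨h, h2⟩)
          · exact Or.inr (Or.inr (by omega))
      have hp5 : ∀ w, pos w ≤ pos' w := by
        intro w
        rcases hp4 w with rfl | ⟨h1, h2⟩ | h
        · omega
        · rw [hp3 w h1 h2]
          omega
        · rw [hp2 w h]
      have hlt : ∀ w, pos' w ≤ j + 1 → w = v ∨ pos w ≤ j := by
        intro w hw
        rcases hp4 w with h | ⟨h1, h2⟩ | h
        · exact Or.inl h
        · rw [hp3 w h1 h2] at hw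
          omega
        · exact Or.inr h
      have hne : ∀ w, pos w ≤ j → w ≠ v := fun w hw h => by
        rw [h] at hw
        omega
      refine ih (j + 1) pos' (Function.update par v q) (Function.update root v (root q))
        (by omega) ?_ ?_ ?_ ?_ ?_ ?_ ?_ ?_
      · have : (Finset.univ.filter fun w => pos' w = j + 1 + 1) = A.erase v := by
          ext w
          rw [Finset.mem_erase, hA, Finset.mem_filter, Finset.mem_filter]
          rcases hp4 w with rfl | ⟨h1, h2⟩ | h
          · simp [hp1]
          · simp [hp3 w h1 h2, h1, h2]
          · rw [hp2 w h]
            simp only [Finset.mem_univ, true_and]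
            constructor
            · intro h'
              omega
            · rintro ⟨-, h'⟩
              omega
        rw [this, Finset.card_erase_of_mem hqv.2]
        omega
      · intro w
        rcases hp4 w with rfl | ⟨h1, h2⟩ | h
        · omega
        · rw [hp3 w h1 h2]
        · rw [hp2 w h]
          omega
      · intro w
        rw [← hz w]
        rcases hp4 w with rfl | ⟨h1, h2⟩ | h
        · omega
        · rw [hp3 w h1 h2]
          omega
        · rw [hp2 w h]
      · intro w w' hw hw' hwj heq
        have h' := hlt w' (by omega)
        rcases hlt w hwj with rfl | h
        · rcases h' with rfl | h'
          · rfl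
          · rw [hp1, hp2 w' h'] at heq
            omega
        · rcases h' with rfl | h'
          · rw [hp1, hp2 w h] at heq
            omega
          · rw [hp2 w h, hp2 w' h'] at heq
            exact hinj w w' hw hw' h heq
      · intro w hw hwj
        rcases hlt w hwj with rfl | h
        · rw [Function.update_self, hp1, hp2 q hq]
          omega
        · have h2 := hpar w hw h
          rw [Function.update_of_ne (hne w h), hp2 w h, hp2 _ (by omega)]
          exact h2
      · intro w hw hwj u u' hu hu'
        rcases hlt w hwj with rfl | h
        · rw [Function.update_self]
          rw [hp1] at hu hu'
          have h1 : pos u ≤ j := by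
            have := hp5 u
            omega
          have h2 : pos u' = j + 1 := by
            rcases hp4 u' with rfl | ⟨-, h2⟩ | h2
            · exact hv
            · exact h2
            · rw [hp2 u' h2] at hu'
              omega
          rw [dist_comm]
          exact hmin (u, u') (Finset.mem_product.2 ⟨by simp [hB, h1], by simp [hA, h2]⟩)
        · rw [Function.update_of_ne (hne w h)]
          rw [hp2 w h] at hu hu'
          refine hd w hw h u u' ((hp5 u).trans_lt hu) ?_
          rcases hp4 u' with rfl | ⟨-, h2⟩ | h2
          · omega
          · omega
          · rwa [hp2 u' h2] at hu'
      · intro w hw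
        rw [Function.update_of_ne (show w ≠ v from fun h => hvS (h ▸ hw)), hr w hw]
      · intro w hw hwj
        rcases hlt w hwj with rfl | h
        · rw [Function.update_self, Function.update_self, Function.update_of_ne hqv']
        · have h2 := hpar w hw h
          rw [Function.update_of_ne (hne w h), Function.update_of_ne (hne w h),
            Function.update_of_ne (hne _ (by omega)), hr' w hw h]
  refine key (Finset.univ.filter fun v => v ∉ S).card 0 (fun v => if v ∈ S then 0 else 1) id id
    (by rw [zero_add]; exact Finset.card_le_univ _) ?_ ?_ ?_ ?_ ?_ ?_ ?_ ?_
  · congr 1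
    ext v
    by_cases h : v ∈ S <;> simp [h]
  · intro v
    by_cases h : v ∈ S <;> simp [h]
  · intro v
    by_cases h : v ∈ S <;> simp [h]
  · intro v w hv _ h
    simp [hv] at h
  · intro v hv h
    simp [hv] at h
  · intro v hv h
    simp [hv] at h
  · intro v _
    rfl
  · intro v hv h
    simp [hv] at h

namespace IsPrimForest

variable {V X : Type*} [PseudoMetricSpace X] {S : Finset V} {z : V → X} {pos : V → ℕ}
  {par root : V → V}

theorem root_mem (hF : IsPrimForest S z pos par root) (v : V) : root v ∈ S := by
  induction hk : pos v using Nat.strong_induction_on generalizing v with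
  | _ k ih =>
    by_cases hv : v ∈ S
    · rwa [hF.root_of_mem v hv]
    · rw [hF.root_of_notMem v hv]
      exact ih _ (hk ▸ hF.par_lt v hv) _ rfl

variable [Fintype V]

/-- The position at which the single-linkage cluster of `u` at scale `T` starts; it is `0` for the
clusters that contain an element of `S`. -/
def key (S : Finset V) (z : V → X) (pos : V → ℕ) (par : V → V) (T : ℝ) (u : V) : ℕ :=
  (Finset.univ.filter fun v => v ∉ S ∧ pos v ≤ pos u ∧ T < dist (z v) (z (par v))).sup pos

/-- The largest attaching distance occurring between `u` and `w`. -/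
def gap (S : Finset V) (z : V → X) (pos : V → ℕ) (par : V → V) (u w : V) : ℝ :=
  ((Finset.univ.filter fun v => v ∉ S ∧ min (pos u) (pos w) < pos v ∧
    pos v ≤ max (pos u) (pos w)).sup fun v => nndist (z v) (z (par v)) : NNReal)

theorem gap_nonneg (u w : V) : 0 ≤ gap S z pos par u w := NNReal.coe_nonneg _

theorem gap_comm (u w : V) : gap S z pos par u w = gap S z pos par w u := by
  rw [gap, gap]
  simp only [min_comm, max_comm]

theorem gap_le_iff {T : ℝ} (hT : 0 ≤ T) (u w : V) : gap S z pos par u w ≤ T ↔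
    ∀ v, v ∉ S → min (pos u) (pos w) < pos v → pos v ≤ max (pos u) (pos w) →
      dist (z v) (z (par v)) ≤ T := by
  lift T to NNReal using hT
  rw [gap, NNReal.coe_le_coe, Finset.sup_le_iff]
  constructor
  · intro h v h1 h2 h3
    exact h v (Finset.mem_filter.2 ⟨Finset.mem_univ v, h1, h2, h3⟩)
  · intro h v hv
    obtain ⟨-, h1, h2, h3⟩ := Finset.mem_filter.1 hv
    exact h v h1 h2 h3

theorem key_le (T : ℝ) (u : V) : key S z pos par T u ≤ pos u :=
  Finset.sup_le fun _ hv => (Finset.mem_filter.1 hv).2.2.1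

theorem le_key {T : ℝ} {u v : V} (hv : v ∉ S) (hvu : pos v ≤ pos u)
    (hT : T < dist (z v) (z (par v))) : pos v ≤ key S z pos par T u :=
  Finset.le_sup (f := pos) (Finset.mem_filter.2 ⟨Finset.mem_univ v, hv, hvu, hT⟩)

theorem key_of_lt {T : ℝ} {v : V} (hv : v ∉ S) (hT : T < dist (z v) (z (par v))) :
    key S z pos par T v = pos v :=
  (key_le T v).antisymm (le_key hv le_rfl hT)

theorem exists_of_key_ne_zero {T : ℝ} {u : V} (h : key S z pos par T u ≠ 0) :
    ∃ v, v ∉ S ∧ pos v = key S z pos par T u ∧ T < dist (z v) (z (par v)) := by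
  have hne : (Finset.univ.filter fun v => v ∉ S ∧ pos v ≤ pos u ∧
      T < dist (z v) (z (par v))).Nonempty := by
    rw [Finset.nonempty_iff_ne_empty]
    intro hemp
    rw [key, hemp] at h
    exact h rfl
  obtain ⟨v, hv, hve⟩ := Finset.exists_mem_eq_sup _ hne pos
  obtain ⟨-, h1, -, h3⟩ := Finset.mem_filter.1 hv
  exact ⟨v, h1, hve.symm, h3⟩

theorem key_eq_key_iff {T : ℝ} (hT : 0 ≤ T) (u w : V) :
    key S z pos par T u = key S z pos par T w ↔ gap S z pos par u w ≤ T := by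
  wlog huw : pos u ≤ pos w generalizing u w
  · rw [gap_comm, eq_comm]
    exact this w u (le_of_not_ge huw)
  rw [gap_le_iff hT, min_eq_left huw, max_eq_right huw]
  constructor
  · intro h v hv h1 h2
    by_contra hcon
    have h3 := le_key hv h2 (not_le.1 hcon)
    have h4 : key S z pos par T u ≤ pos u := key_le T u
    omega
  · intro h
    rw [key, key]
    congr 1
    ext v
    simp only [Finset.mem_filter, Finset.mem_univ, true_and]
    constructor
    · rintro ⟨h1, h2, h3⟩
      exact ⟨h1, h2.trans huw, h3⟩
    · rintro ⟨h1, h2, h3⟩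
      refine ⟨h1, ?_, h3⟩
      by_contra hcon
      exact absurd (h v h1 (not_le.1 hcon) h2) (not_le.2 h3)

theorem key_of_mem (hF : IsPrimForest S z pos par root) (T : ℝ) {u : V} (hu : u ∈ S) :
    key S z pos par T u = 0 := by
  have h : key S z pos par T u ≤ pos u := key_le T u
  rw [(hF.pos_eq_zero_iff u).2 hu] at h
  omega

theorem gap_le_dist (hF : IsPrimForest S z pos par root) (u w : V) :
    gap S z pos par u w ≤ dist (z u) (z w) := by
  wlog huw : pos u ≤ pos w generalizing u w
  · rw [gap_comm, dist_comm]
    exact this w u (le_of_not_ge huw)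
  rw [gap_le_iff dist_nonneg, min_eq_left huw, max_eq_right huw]
  intro v hv h1 h2
  exact hF.dist_par_le v hv u w h1 h2

/-- Every vertex is close to the first vertex of its cluster. -/
theorem exists_anchor (hF : IsPrimForest S z pos par root) {T : ℝ} (hT : 0 ≤ T) (u : V) :
    ∃ q, (key S z pos par T u = 0 → q = root u) ∧ pos q = key S z pos par T u ∧
      root q = root u ∧ dist (z u) (z q) ≤ pos u * T := by
  induction hk : pos u using Nat.strong_induction_on generalizing u with
  | _ k ih =>
    by_cases hku : key S z pos par T u = pos u
    · refine ⟨u, fun h => ?_, hku.symm, rfl, ?_⟩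
      · rw [hku, hF.pos_eq_zero_iff] at h
        exact (hF.root_of_mem u h).symm
      · rw [dist_self]
        positivity
    · have hlt : key S z pos par T u < pos u := lt_of_le_of_ne (key_le T u) hku
      have hu : u ∉ S := fun h => by
        have := (hF.pos_eq_zero_iff u).2 h
        omega
      have ht : dist (z u) (z (par u)) ≤ T := by
        by_contra hcon
        exact hku (key_of_lt hu (not_le.1 hcon))
      have hpar := hF.par_lt u hu
      have hle : key S z pos par T u ≤ pos (par u) := by
        by_contra hcon
        obtain ⟨v, hv, hvk, hvT⟩ := exists_of_key_ne_zero (S := S) (z := z) (pos := pos)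
          (par := par) (T := T) (u := u) (by omega)
        have := hF.dist_par_le v hv (par u) u (by omega) (by omega)
        rw [dist_comm (z (par u))] at this
        linarith
      have hkey : key S z pos par T (par u) = key S z pos par T u := by
        rw [key_eq_key_iff hT, gap_le_iff hT, min_eq_left hpar.le, max_eq_right hpar.le]
        intro v hv h1 h2
        by_contra hcon
        have := le_key hv h2 (not_le.1 hcon)
        omega
      obtain ⟨q, h1, h2, h3, h4⟩ := ih _ (hk ▸ hpar) (par u) rfl
      rw [← hF.root_of_notMem u hu, hkey] at h1
      refine ⟨q, h1, h2.trans hkey, h3.trans (hF.root_of_notMem u hu).symm, ?_⟩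
      have h5 : ((pos (par u) : ℝ) + 1) ≤ (k : ℝ) := by
        rw [← hk]
        exact_mod_cast hpar
      calc dist (z u) (z q) ≤ dist (z u) (z (par u)) + dist (z (par u)) (z q) := dist_triangle _ _ _
        _ ≤ T + pos (par u) * T := add_le_add ht h4
        _ = (pos (par u) + 1) * T := by ring
        _ ≤ k * T := mul_le_mul_of_nonneg_right h5 hT

theorem dist_le_of_root_eq (hF : IsPrimForest S z pos par root) {N : ℕ} (hN : ∀ v, pos v ≤ N)
    {u w : V} (hr : root u = root w) : dist (z u) (z w) ≤ 2 * N * gap S z pos par u w := by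
  have hτ : 0 ≤ gap S z pos par u w := gap_nonneg u w
  obtain ⟨q, h1, h2, h3, h4⟩ := hF.exists_anchor hτ u
  obtain ⟨q', h1', h2', h3', h4'⟩ := hF.exists_anchor hτ w
  have hkey := (key_eq_key_iff (S := S) (z := z) (pos := pos) (par := par) hτ u w).2 le_rfl
  have hq : q = q' := by
    by_cases hk : key S z pos par (gap S z pos par u w) u = 0
    · rw [h1 hk, h1' (hkey ▸ hk), hr]
    · refine hF.pos_inj q q' ?_ ?_ ?_
      · rw [← hF.pos_eq_zero_iff]
        omega
      · rw [← hF.pos_eq_zero_iff]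
        omega
      · omega
  have hu : (pos u : ℝ) ≤ N := by exact_mod_cast hN u
  have hw : (pos w : ℝ) ≤ N := by exact_mod_cast hN w
  have h5 := dist_triangle_right (z u) (z w) (z q)
  rw [← hq] at h4'
  nlinarith [mul_le_mul_of_nonneg_right hu hτ, mul_le_mul_of_nonneg_right hw hτ]

theorem dist_root_le_of_root_ne (hF : IsPrimForest S z pos par root) {N : ℕ}
    (hN : ∀ v, pos v ≤ N) {u w : V} (hr : root u ≠ root w) :
    dist (z u) (z (root u)) ≤ N * gap S z pos par u w ∧
      dist (z w) (z (root w)) ≤ N * gap S z pos par u w := by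
  have hτ : 0 ≤ gap S z pos par u w := gap_nonneg u w
  obtain ⟨q, h1, h2, h3, h4⟩ := hF.exists_anchor hτ u
  obtain ⟨q', h1', h2', h3', h4'⟩ := hF.exists_anchor hτ w
  have hkey := (key_eq_key_iff (S := S) (z := z) (pos := pos) (par := par) hτ u w).2 le_rfl
  have hk : key S z pos par (gap S z pos par u w) u = 0 := by
    by_contra hk
    refine hr ?_
    rw [← h3, ← h3']
    congr 1
    refine hF.pos_inj q q' ?_ ?_ ?_
    · rw [← hF.pos_eq_zero_iff]
      omega
    · rw [← hF.pos_eq_zero_iff]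
      omega
    · omega
  have hu : (pos u : ℝ) ≤ N := by exact_mod_cast hN u
  have hw : (pos w : ℝ) ≤ N := by exact_mod_cast hN w
  rw [h1 hk] at h4
  rw [h1' (hkey ▸ hk)] at h4'
  exact ⟨h4.trans (mul_le_mul_of_nonneg_right hu hτ), h4'.trans (mul_le_mul_of_nonneg_right hw hτ)⟩

/-- The distance between two points up to constants, in terms of attaching distances. -/
def sep (S : Finset V) (z : V → X) (pos : V → ℕ) (par root : V → V) (u w : V) : ℝ :=
  if root u = root w then gap S z pos par u w else max (gap S z pos par u w) 1

theorem sep_bounds (hF : IsPrimForest S z pos par root) {N : ℕ} (hN : ∀ v, pos v ≤ N) {δ D : ℝ}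
    (hδ : 0 < δ) (hD : 0 ≤ D) (hδD : ∀ v ∈ S, ∀ w ∈ S, v ≠ w →
      δ ≤ dist (z v) (z w) ∧ dist (z v) (z w) ≤ D) (u w : V) :
    sep S z pos par root u w ≤ (1 + 2 * N + D + (1 + 2 * N) / δ) * dist (z u) (z w) ∧
      dist (z u) (z w) ≤ (1 + 2 * N + D + (1 + 2 * N) / δ) * sep S z pos par root u w := by
  have hτ : 0 ≤ gap S z pos par u w := gap_nonneg u w
  have hτr := hF.gap_le_dist u w
  have hN0 : (0 : ℝ) ≤ N := Nat.cast_nonneg N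
  have hq : 0 ≤ (1 + 2 * (N : ℝ)) / δ := by positivity
  have hr0 : 0 ≤ dist (z u) (z w) := dist_nonneg
  rw [sep]
  split_ifs with hr
  · have h := hF.dist_le_of_root_eq hN hr
    constructor <;> nlinarith [mul_nonneg hN0 hr0, mul_nonneg hD hr0, mul_nonneg hq hr0,
      mul_nonneg hN0 hτ, mul_nonneg hD hτ, mul_nonneg hq hτ]
  · obtain ⟨h1, h2⟩ := hF.dist_root_le_of_root_ne hN hr
    obtain ⟨h3, h4⟩ := hδD _ (hF.root_mem u) _ (hF.root_mem w) hr
    set τ := gap S z pos par u w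
    set r := dist (z u) (z w)
    have h5 : dist (z (root u)) (z (root w)) ≤ dist (z u) (z (root u)) + r +
        dist (z w) (z (root w)) := by
      have ha := dist_triangle4 (z (root u)) (z u) (z w) (z (root w))
      rwa [dist_comm (z (root u)) (z u)] at ha
    have h6 : r ≤ dist (z u) (z (root u)) + dist (z (root u)) (z (root w)) +
        dist (z w) (z (root w)) := by
      have ha := dist_triangle4 (z u) (z (root u)) (z (root w)) (z w)
      rwa [dist_comm (z (root w)) (z w)] at ha
    constructor
    · have h7 : 1 ≤ (1 + 2 * (N : ℝ)) / δ * r := by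
        rw [div_mul_eq_mul_div, le_div_iff₀ hδ]
        nlinarith [mul_le_mul_of_nonneg_left hτr hN0]
      refine max_le ?_ ?_ <;> nlinarith [mul_nonneg hN0 hr0, mul_nonneg hD hr0]
    · have h8 : τ ≤ max τ 1 := le_max_left _ _
      have h9 : 1 ≤ max τ 1 := le_max_right _ _
      nlinarith [mul_le_mul_of_nonneg_left h8 hN0, mul_le_mul_of_nonneg_left h9 hD,
        mul_nonneg hq (zero_le_one.trans h9)]

end IsPrimForest

/-- The signed indicator function of the interval between `0` and `l`. -/
def signedStep (l θ : ℝ) : ℝ :=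
  (Set.Ico 0 l).indicator 1 θ - (Set.Ico l 0).indicator 1 θ

theorem integrable_indicator_Ico_one (a b : ℝ) :
    Integrable ((Set.Ico a b).indicator (1 : ℝ → ℝ)) :=
  (integrable_indicator_iff measurableSet_Ico).2 (integrableOn_const (by simp))

theorem integral_indicator_Ico_one (a b : ℝ) :
    ∫ θ, (Set.Ico a b).indicator (1 : ℝ → ℝ) θ = max (b - a) 0 := by
  rw [integral_indicator_one measurableSet_Ico]
  simp [Measure.real, ENNReal.toReal_ofReal']

theorem integrable_signedStep (l : ℝ) : Integrable (signedStep l) :=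
  (integrable_indicator_Ico_one _ _).sub (integrable_indicator_Ico_one _ _)

theorem integral_signedStep (l : ℝ) : ∫ θ, signedStep l θ = l := by
  simp only [signedStep]
  rw [integral_sub (integrable_indicator_Ico_one _ _) (integrable_indicator_Ico_one _ _),
    integral_indicator_Ico_one, integral_indicator_Ico_one]
  rcases le_total 0 l with h | h
  · rw [max_eq_left (by linarith), max_eq_right (by linarith)]; ring
  · rw [max_eq_right (by linarith), max_eq_left (by linarith)]; ring

theorem signedStep_of_nonneg {l θ : ℝ} (h : 0 ≤ θ) :
    signedStep l θ = if θ < l then 1 else 0 := by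
  simp [signedStep, Set.indicator_apply, h, not_lt.2 h]

theorem signedStep_of_neg {l θ : ℝ} (h : θ < 0) :
    signedStep l θ = -(if l ≤ θ then 1 else 0) := by
  simp [signedStep, Set.indicator_apply, h, not_le.2 h]

theorem abs_signedStep (l θ : ℝ) : |signedStep l θ| = (if 0 ≤ l then 1 else -1) * signedStep l θ := by
  rcases le_or_gt 0 θ with h | h
  · rw [signedStep_of_nonneg h]
    split_ifs <;> simp
    linarith
  · rw [signedStep_of_neg h]
    split_ifs <;> simp
    linarith

/-- A linear inequality between real numbers follows from its layer-cake version. -/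
theorem sum_mul_le_of_layers {ι κ : Type*} [Fintype ι] [Fintype κ] (a L : ι → ℝ) (l : κ → ℝ)
    (b ε : ℝ)
    (hpos : ∀ θ, 0 ≤ θ → (b + ε) * ((Finset.univ.filter fun v => θ < l v).card : ℝ) ≤
      ∑ e ∈ Finset.univ.filter (fun e => θ < L e), a e)
    (hneg : ∀ θ, θ < 0 → ∑ e ∈ Finset.univ.filter (fun e => L e ≤ θ), a e ≤
      (b - ε) * ((Finset.univ.filter fun v => l v ≤ θ).card : ℝ)) :
    b * ∑ v, l v + ε * ∑ v, |l v| ≤ ∑ e, a e * L e := by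
  have hle : ∀ θ, ∑ v, (b + ε * (if 0 ≤ l v then 1 else -1)) * signedStep (l v) θ ≤
      ∑ e, a e * signedStep (L e) θ := by
    intro θ
    have h1 : ∀ v, (b + ε * (if 0 ≤ l v then 1 else -1)) * signedStep (l v) θ =
        b * signedStep (l v) θ + ε * |signedStep (l v) θ| := fun v => by
      rw [abs_signedStep]; ring
    simp only [h1]
    rcases le_or_gt 0 θ with h | h
    · have := hpos θ h
      simp only [signedStep_of_nonneg h]
      have h2 : ∀ v, b * (if θ < l v then (1 : ℝ) else 0) + ε * |if θ < l v then (1 : ℝ) else 0| =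
          if θ < l v then b + ε else 0 := fun v => by split_ifs <;> simp
      rw [Finset.sum_congr rfl fun v _ => h2 v]
      simp only [mul_ite, mul_one, mul_zero]
      rw [← Finset.sum_filter, ← Finset.sum_filter, Finset.sum_const, nsmul_eq_mul, mul_comm]
      exact this
    · have := hneg θ h
      simp only [signedStep_of_neg h]
      have h2 : ∀ v, b * -(if l v ≤ θ then (1 : ℝ) else 0) + ε * |-(if l v ≤ θ then (1 : ℝ) else 0)|
          = -if l v ≤ θ then b - ε else 0 := fun v => by
        split_ifs <;> simp
        ring
      rw [Finset.sum_congr rfl fun v _ => h2 v]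
      simp only [mul_neg, mul_ite, mul_one, mul_zero, Finset.sum_neg_distrib]
      rw [← Finset.sum_filter, ← Finset.sum_filter, Finset.sum_const, nsmul_eq_mul, mul_comm]
      linarith
  have hInt := integral_mono (integrable_finsetSum Finset.univ fun v _ =>
      (integrable_signedStep (l v)).const_mul (b + ε * (if 0 ≤ l v then 1 else -1)))
    (integrable_finsetSum Finset.univ fun e _ => (integrable_signedStep (L e)).const_mul (a e)) hle
  rw [integral_finsetSum _ fun v _ => (integrable_signedStep (l v)).const_mul _,
    integral_finsetSum _ fun e _ => (integrable_signedStep (L e)).const_mul _] at hInt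
  simp only [integral_const_mul, integral_signedStep] at hInt
  refine le_trans (le_of_eq ?_) hInt
  rw [Finset.mul_sum, Finset.mul_sum, ← Finset.sum_add_distrib]
  refine Finset.sum_congr rfl fun v _ => ?_
  split_ifs with h
  · rw [abs_of_nonneg h]; ring
  · rw [abs_of_neg (not_le.1 h)]; ring

namespace FeynmanGraph

variable {nV nE : ℕ} (G : FeynmanGraph nV nE)

/-- The edges with an endpoint in `I`. -/
def edgesMeeting (I : Finset (Fin nV)) : Finset (Fin nE) :=
  Finset.univ.filter fun e => (G.ends e).1 ∈ I ∨ (G.ends e).2 ∈ I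

theorem IRConvergent.lt_sum_edgesMeeting {G : FeynmanGraph nV nE} {d : ℕ} (h : G.IRConvergent d)
    {I : Finset (Fin nV)} (hI : ∀ v ∈ I, v ∉ G.ext) (hne : I.Nonempty) :
    (d : ℝ) / 2 * (I.card : ℝ) < ∑ e ∈ G.edgesMeeting I, lam d * G.ν e := by
  have hsub : I ⊆ G.gInternalSet Finset.univ (G.edgesMeeting I) := by
    intro v hv
    refine Finset.mem_filter.2 ⟨Finset.mem_univ v, hI v hv, Finset.mem_univ v, fun e he => ?_⟩
    refine Finset.mem_filter.2 ⟨Finset.mem_univ e, ?_⟩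
    rcases he with he | he
    · exact Or.inl (he ▸ hv)
    · exact Or.inr (he ▸ hv)
  have hmem : ∀ v ∈ I, G.GInternal Finset.univ (G.edgesMeeting I) v := fun v hv =>
    (Finset.mem_filter.1 (hsub hv)).2
  have := h Finset.univ (G.edgesMeeting I) (fun e _ => ⟨Finset.mem_univ _, Finset.mem_univ _⟩)
    ((Finset.card_pos.2 hne).trans_le (Finset.card_le_card hsub))
    (fun e he => (Finset.mem_filter.1 he).2.imp (hmem _) (hmem _))
  rw [← Finset.mul_sum]
  refine lt_of_le_of_lt ?_ this
  gcongr

theorem edgesWithin_eq_empty {Vg : Finset (Fin nV)} (h : Vg.card ≤ 1) :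
    G.edgesWithin Vg = ∅ := by
  refine Finset.filter_eq_empty_iff.2 fun e _ he => G.ends_ne e ?_
  exact Finset.card_le_one.1 h _ he.1 _ he.2

/-- Finitely many strict convergence conditions hold with a uniform margin. -/
theorem exists_convergence_margin {d : ℕ} (hd : 0 < d) (hUV : G.UVConvergent d)
    (hIR : G.IRConvergent d) : ∃ ε : ℝ, 0 < ε ∧ ε ≤ (d : ℝ) / 2 ∧
      (∀ Vg : Finset (Fin nV), Vg.Nonempty → (Vg ∩ G.ext).card ≤ 1 →
        ∑ e ∈ G.edgesWithin Vg, lam d * G.ν e ≤ ((d : ℝ) / 2 - ε) * ((Vg.card : ℝ) - 1)) ∧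
      (∀ I : Finset (Fin nV), (∀ v ∈ I, v ∉ G.ext) →
        ((d : ℝ) / 2 + ε) * (I.card : ℝ) ≤ ∑ e ∈ G.edgesMeeting I, lam d * G.ν e) := by
  have hd' : (0 : ℝ) < (d : ℝ) / 2 := by positivity
  have h1 : ∀ᶠ ε in nhdsWithin (0 : ℝ) (Set.Ioi 0), ∀ Vg : Finset (Fin nV), Vg.Nonempty →
      (Vg ∩ G.ext).card ≤ 1 →
        ∑ e ∈ G.edgesWithin Vg, lam d * G.ν e ≤ ((d : ℝ) / 2 - ε) * ((Vg.card : ℝ) - 1) := by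
    refine Filter.eventually_all.2 fun Vg => ?_
    rcases Nat.lt_or_ge Vg.card 2 with hc | hc
    · refine Filter.Eventually.of_forall fun ε hne _ => ?_
      have : Vg.card = 1 := le_antisymm (by omega) (Finset.card_pos.2 hne)
      rw [G.edgesWithin_eq_empty (by omega), this]
      simp
    · by_cases hx : (Vg ∩ G.ext).card ≤ 1
      · have hlt := hUV Vg hc hx
        rw [Finset.mul_sum] at hlt
        have hcont : Filter.Tendsto (fun ε : ℝ => ((d : ℝ) / 2 - ε) * ((Vg.card : ℝ) - 1)) (nhds 0)
            (nhds (((d : ℝ) / 2 - 0) * ((Vg.card : ℝ) - 1))) :=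
          Continuous.tendsto (by fun_prop) 0
        rw [sub_zero] at hcont
        filter_upwards [(hcont.eventually_const_lt hlt).filter_mono nhdsWithin_le_nhds]
          with ε hε _ _ using hε.le
      · exact Filter.Eventually.of_forall fun ε _ h => absurd h hx
  have h2 : ∀ᶠ ε in nhdsWithin (0 : ℝ) (Set.Ioi 0), ∀ I : Finset (Fin nV), (∀ v ∈ I, v ∉ G.ext) →
        ((d : ℝ) / 2 + ε) * (I.card : ℝ) ≤ ∑ e ∈ G.edgesMeeting I, lam d * G.ν e := by
    refine Filter.eventually_all.2 fun I => ?_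
    rcases I.eq_empty_or_nonempty with rfl | hne
    · exact Filter.Eventually.of_forall fun ε _ => by simp [edgesMeeting]
    · by_cases hI : ∀ v ∈ I, v ∉ G.ext
      · have hlt := hIR.lt_sum_edgesMeeting hI hne
        have hcont : Filter.Tendsto (fun ε : ℝ => ((d : ℝ) / 2 + ε) * (I.card : ℝ)) (nhds 0)
            (nhds (((d : ℝ) / 2 + 0) * (I.card : ℝ))) :=
          Continuous.tendsto (by fun_prop) 0
        rw [add_zero] at hcont
        filter_upwards [(hcont.eventually_lt_const hlt).filter_mono nhdsWithin_le_nhds]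
          with ε hε _ using hε.le
      · exact Filter.Eventually.of_forall fun ε h => absurd h hI
  have h3 : ∀ᶠ ε in nhdsWithin (0 : ℝ) (Set.Ioi 0), ε ≤ (d : ℝ) / 2 :=
    (Iic_mem_nhds hd' : Set.Iic _ ∈ nhds (0 : ℝ)) |> fun h => nhdsWithin_le_nhds h
  obtain ⟨ε, hε1, hε2, hε3, hε4⟩ :=
    (h1.and (h2.and (h3.and self_mem_nhdsWithin))).exists
  exact ⟨ε, hε4, hε3, hε1, hε2⟩

/-- The edges inside the clusters of a partition obey the summed ultraviolet bound. -/
theorem sum_within_clusters_le {K : Type*} [DecidableEq K] {a : Fin nE → ℝ} {c : ℝ}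
    (hUV : ∀ Vg : Finset (Fin nV), Vg.Nonempty → (Vg ∩ G.ext).card ≤ 1 →
      ∑ e ∈ G.edgesWithin Vg, a e ≤ c * ((Vg.card : ℝ) - 1))
    (κ : Fin nV → K) (Q : Finset K) (hQ : ∀ q ∈ Q, ∃ v, κ v = q)
    (hext : ∀ v ∈ G.ext, ∀ w ∈ G.ext, κ v ∈ Q → κ v = κ w → v = w) :
    ∑ e ∈ Finset.univ.filter (fun e => κ (G.ends e).1 = κ (G.ends e).2 ∧ κ (G.ends e).1 ∈ Q), a e ≤
      c * (((Finset.univ.filter fun v => κ v ∈ Q).card : ℝ) - (Q.card : ℝ)) := by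
  have h1 : ∑ e ∈ Finset.univ.filter
      (fun e => κ (G.ends e).1 = κ (G.ends e).2 ∧ κ (G.ends e).1 ∈ Q), a e =
      ∑ q ∈ Q, ∑ e ∈ G.edgesWithin (Finset.univ.filter fun v => κ v = q), a e := by
    rw [← Finset.sum_fiberwise_of_maps_to (t := Q) (g := fun e => κ (G.ends e).1)
      (fun e he => (Finset.mem_filter.1 he).2.2)]
    refine Finset.sum_congr rfl fun q hq => Finset.sum_congr ?_ fun _ _ => rfl
    ext e
    simp only [edgesWithin, Finset.mem_filter, Finset.mem_univ, true_and]
    constructor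
    · rintro ⟨⟨h1, h2⟩, h3⟩
      exact ⟨h3, h1 ▸ h3⟩
    · rintro ⟨h1, h2⟩
      exact ⟨⟨h1.trans h2.symm, h1 ▸ hq⟩, h1⟩
  have h2 : (Finset.univ.filter fun v => κ v ∈ Q).card =
      ∑ q ∈ Q, (Finset.univ.filter fun v => κ v = q).card := by
    rw [Finset.card_eq_sum_card_fiberwise (f := κ) (t := Q)
      (s := Finset.univ.filter fun v => κ v ∈ Q)
      (fun v hv => Finset.mem_coe.2 (Finset.mem_filter.1 (Finset.mem_coe.1 hv)).2)]
    refine Finset.sum_congr rfl fun q hq => ?_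
    congr 1
    ext v
    simp only [Finset.mem_filter, Finset.mem_univ, true_and]
    exact ⟨fun h => h.2, fun h => ⟨h ▸ hq, h⟩⟩
  have h3 : ((Finset.univ.filter fun v => κ v ∈ Q).card : ℝ) - (Q.card : ℝ) =
      ∑ q ∈ Q, (((Finset.univ.filter fun v => κ v = q).card : ℝ) - 1) := by
    rw [h2, Finset.sum_sub_distrib]
    simp
  rw [h1, h3, Finset.mul_sum]
  refine Finset.sum_le_sum fun q hq => hUV _ ?_ ?_
  · obtain ⟨v, hv⟩ := hQ q hq
    exact ⟨v, Finset.mem_filter.2 ⟨Finset.mem_univ v, hv⟩⟩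
  · refine Finset.card_le_one.2 fun v hv w hw => ?_
    simp only [Finset.mem_inter, Finset.mem_filter, Finset.mem_univ, true_and] at hv hw
    exact hext v hv.2 w hw.2 (hv.1 ▸ hq) (hv.1.trans hw.1.symm)

end FeynmanGraph

namespace FeynmanGraph

variable {nV nE : ℕ} (G : FeynmanGraph nV nE)

/-- Power counting in a Hepp sector: the weighted sum of the logarithmic edge lengths is controlled
by the logarithms of the attaching distances of a Prim forest. -/
theorem sum_log_sep_ge {X : Type*} [PseudoMetricSpace X] {z : Fin nV → X} {pos : Fin nV → ℕ}
    {par root : Fin nV → Fin nV} (hF : IsPrimForest G.ext z pos par root) {a : Fin nE → ℝ} {b ε : ℝ}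
    (hε : 0 ≤ ε) (hεb : ε ≤ b)
    (hUV : ∀ Vg : Finset (Fin nV), Vg.Nonempty → (Vg ∩ G.ext).card ≤ 1 →
      ∑ e ∈ G.edgesWithin Vg, a e ≤ (b - ε) * ((Vg.card : ℝ) - 1))
    (hIR : ∀ I : Finset (Fin nV), (∀ v ∈ I, v ∉ G.ext) →
      (b + ε) * (I.card : ℝ) ≤ ∑ e ∈ G.edgesMeeting I, a e)
    (hsep : ∀ e, 0 < IsPrimForest.sep G.ext z pos par root (G.ends e).1 (G.ends e).2)
    (hpar : ∀ v, v ∉ G.ext → 0 < dist (z v) (z (par v))) :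
    b * ∑ v : {v // v ∉ G.ext}, Real.log (dist (z v) (z (par v))) +
      ε * ∑ v : {v // v ∉ G.ext}, |Real.log (dist (z v) (z (par v)))| ≤
      ∑ e, a e * Real.log (IsPrimForest.sep G.ext z pos par root (G.ends e).1 (G.ends e).2) := by
  set t : Fin nV → ℝ := fun v => dist (z v) (z (par v)) with ht
  refine sum_mul_le_of_layers a _ (fun v : {v // v ∉ G.ext} => Real.log (t v)) b ε ?_ ?_
  · intro θ hθ
    set T := Real.exp θ with hT
    have hT0 : 0 ≤ T := (Real.exp_pos θ).le
    have hT1 : 1 ≤ T := Real.one_le_exp hθ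
    set κ := IsPrimForest.key G.ext z pos par T with hκ
    set A := Finset.univ.filter fun v => v ∉ G.ext ∧ T < t v with hA
    have hcardA : (Finset.univ.filter fun v : {v // v ∉ G.ext} => θ < Real.log (t v)).card =
        A.card := by
      rw [← Finset.card_map (Function.Embedding.subtype _)]
      congr 1
      ext v
      simp only [Finset.mem_map, Finset.mem_filter, Finset.mem_univ, true_and,
        Function.Embedding.subtype_apply, Subtype.exists, exists_and_right, exists_eq_right, hA]
      constructor
      · rintro ⟨hv, h⟩
        exact ⟨hv, (Real.lt_log_iff_exp_lt (hpar v hv)).1 h⟩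
      · rintro ⟨hv, h⟩
        exact ⟨hv, (Real.lt_log_iff_exp_lt (hpar v hv)).2 h⟩
    have hcut : ∀ e, θ < Real.log (IsPrimForest.sep G.ext z pos par root (G.ends e).1 (G.ends e).2)
        ↔ κ (G.ends e).1 ≠ κ (G.ends e).2 := by
      intro e
      rw [Real.lt_log_iff_exp_lt (hsep e), ← hT, Ne, hκ, IsPrimForest.key_eq_key_iff hT0, not_le,
        IsPrimForest.sep]
      split_ifs
      · rfl
      · exact ⟨fun h => (lt_max_iff.1 h).resolve_right (not_lt.2 hT1), fun h => lt_max_of_lt_left h⟩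
    set Q := A.image pos with hQ
    have hQcard : Q.card = A.card := Finset.card_image_of_injOn fun v hv w hw h =>
      hF.pos_inj v w (Finset.mem_filter.1 hv).2.1 (Finset.mem_filter.1 hw).2.1 h
    have hmemQ : ∀ v, κ v ∈ Q ↔ κ v ≠ 0 := by
      intro v
      constructor
      · intro h h0
        obtain ⟨w, hw, hwv⟩ := Finset.mem_image.1 h
        rw [h0] at hwv
        exact (Finset.mem_filter.1 hw).2.1 ((hF.pos_eq_zero_iff w).1 hwv)
      · intro h
        obtain ⟨w, hw1, hw2, hw3⟩ := IsPrimForest.exists_of_key_ne_zero h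
        exact Finset.mem_image.2 ⟨w, Finset.mem_filter.2 ⟨Finset.mem_univ w, hw1, hw3⟩, hw2⟩
    have hkext : ∀ v ∈ G.ext, κ v = 0 := fun v hv => hF.key_of_mem T hv
    have hcl := G.sum_within_clusters_le hUV κ Q
      (fun q hq => by
        obtain ⟨w, hw, hwq⟩ := Finset.mem_image.1 hq
        have hw' := (Finset.mem_filter.1 hw).2
        exact ⟨w, (IsPrimForest.key_of_lt hw'.1 hw'.2).trans hwq⟩)
      (fun v hv w _ h => absurd (hkext v hv) ((hmemQ v).1 h))
    set I := Finset.univ.filter fun v => κ v ∈ Q with hI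
    have hIext : ∀ v ∈ I, v ∉ G.ext := fun v hv hve =>
      (hmemQ v).1 (Finset.mem_filter.1 hv).2 (hkext v hve)
    have hir := hIR I hIext
    have hsplit : ∑ e ∈ G.edgesMeeting I, a e =
        ∑ e ∈ Finset.univ.filter (fun e => κ (G.ends e).1 ≠ κ (G.ends e).2), a e +
        ∑ e ∈ Finset.univ.filter
          (fun e => κ (G.ends e).1 = κ (G.ends e).2 ∧ κ (G.ends e).1 ∈ Q), a e := by
      rw [← Finset.sum_union]
      · refine Finset.sum_congr ?_ fun _ _ => rfl
        ext e
        simp only [edgesMeeting, hI, Finset.mem_filter, Finset.mem_univ, true_and,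
          Finset.mem_union, hmemQ]
        by_cases h : κ (G.ends e).1 = κ (G.ends e).2
        · simp [h]
        · simp only [h, ne_eq, not_false_eq_true, false_and, or_false, iff_true]
          by_contra hcon
          push Not at hcon
          exact h (hcon.1.trans hcon.2.symm)
      · rw [Finset.disjoint_left]
        intro e he he'
        exact (Finset.mem_filter.1 he).2 (Finset.mem_filter.1 he').2.1
    have hAI : (A.card : ℝ) ≤ I.card := by
      have : A ⊆ I := fun v hv => by
        have hv' := (Finset.mem_filter.1 hv).2
        refine Finset.mem_filter.2 ⟨Finset.mem_univ v, ?_⟩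
        rw [hκ, IsPrimForest.key_of_lt hv'.1 hv'.2]
        exact Finset.mem_image_of_mem _ hv
      exact_mod_cast Finset.card_le_card this
    rw [hcardA, Finset.filter_congr fun e _ => hcut e]
    rw [hQcard] at hcl
    nlinarith
  · intro θ hθ
    set T := Real.exp θ with hT
    have hT0 : 0 ≤ T := (Real.exp_pos θ).le
    have hT1 : T < 1 := Real.exp_lt_one_iff.2 hθ
    set κ : Fin nV → ℕ × Fin nV := fun v => (IsPrimForest.key G.ext z pos par T v, root v) with hκ
    set A := Finset.univ.filter fun v => v ∉ G.ext ∧ t v ≤ T with hA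
    have hcardA : (Finset.univ.filter fun v : {v // v ∉ G.ext} => Real.log (t v) ≤ θ).card =
        A.card := by
      rw [← Finset.card_map (Function.Embedding.subtype _)]
      congr 1
      ext v
      simp only [Finset.mem_map, Finset.mem_filter, Finset.mem_univ, true_and,
        Function.Embedding.subtype_apply, Subtype.exists, exists_and_right, exists_eq_right, hA]
      constructor
      · rintro ⟨hv, h⟩
        exact ⟨hv, (Real.log_le_iff_le_exp (hpar v hv)).1 h⟩
      · rintro ⟨hv, h⟩
        exact ⟨hv, (Real.log_le_iff_le_exp (hpar v hv)).2 h⟩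
    set Q := Finset.univ.image κ with hQ
    have hmemQ : ∀ v, κ v ∈ Q := fun v => Finset.mem_image_of_mem _ (Finset.mem_univ v)
    have hcut : ∀ e, Real.log (IsPrimForest.sep G.ext z pos par root (G.ends e).1 (G.ends e).2) ≤ θ
        ↔ κ (G.ends e).1 = κ (G.ends e).2 ∧ κ (G.ends e).1 ∈ Q := by
      intro e
      rw [Real.log_le_iff_le_exp (hsep e), ← hT, IsPrimForest.sep, and_iff_left (hmemQ _)]
      simp only [hκ, Prod.mk.injEq, IsPrimForest.key_eq_key_iff hT0]
      split_ifs with h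
      · simp [h]
      · simp only [h, and_false, iff_false, not_le]
        exact lt_max_of_lt_right hT1
    have hkext : ∀ v ∈ G.ext, κ v = (0, v) := fun v hv => by
      rw [hκ]
      simp only [hF.key_of_mem T hv, hF.root_of_mem v hv]
    have hcl := G.sum_within_clusters_le hUV κ Q
      (fun q hq => by
        obtain ⟨w, _, hwq⟩ := Finset.mem_image.1 hq
        exact ⟨w, hwq⟩)
      (fun v hv w hw _ h => by
        rw [hkext v hv, hkext w hw] at h
        exact (Prod.mk.inj h).2)
    have hkbig : ∀ v, v ∉ G.ext → T < t v → (κ v).1 = pos v := fun v hv h =>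
      IsPrimForest.key_of_lt hv h
    have hB : (Finset.univ \ A).card ≤ Q.card := by
      refine Finset.card_le_card_of_injOn κ (fun v _ => hmemQ v) ?_
      have hcase : ∀ v ∈ ((Finset.univ \ A : Finset (Fin nV)) : Set (Fin nV)),
          v ∉ G.ext → T < t v := by
        intro v hv hve
        by_contra hcon
        refine (Finset.mem_sdiff.1 (Finset.mem_coe.1 hv)).2 ?_
        exact Finset.mem_filter.2 ⟨Finset.mem_univ v, hve, not_lt.1 hcon⟩
      intro v hv w hw h
      by_cases hve : v ∈ G.ext
      · by_cases hwe : w ∈ G.ext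
        · rw [hkext v hve, hkext w hwe] at h
          exact (Prod.mk.inj h).2
        · have h1 := hkbig w hwe (hcase w hw hwe)
          rw [← h, hkext v hve] at h1
          exact absurd ((hF.pos_eq_zero_iff w).1 h1.symm) hwe
      · have h2 := hkbig v hve (hcase v hv hve)
        by_cases hwe : w ∈ G.ext
        · rw [h, hkext w hwe] at h2
          exact absurd ((hF.pos_eq_zero_iff v).1 h2.symm) hve
        · have h1 := hkbig w hwe (hcase w hw hwe)
          exact hF.pos_inj v w hve hwe (by rw [← h1, ← h2, h])
    have hcard : ((Finset.univ.filter fun v => κ v ∈ Q).card : ℝ) ≤ (A.card : ℝ) + Q.card := by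
      have h1 := Finset.card_sdiff_add_card_eq_card (Finset.subset_univ A)
      have h2 := Finset.card_le_univ (Finset.univ.filter fun v => κ v ∈ Q)
      rw [Finset.card_univ] at h1
      exact_mod_cast (by omega : (Finset.univ.filter fun v => κ v ∈ Q).card ≤ A.card + Q.card)
    rw [hcardA, Finset.filter_congr fun e _ => hcut e]
    refine hcl.trans (mul_le_mul_of_nonneg_left ?_ (by linarith))
    linarith

end FeynmanGraph

/-- The function `r ^ (-d)`, improved by a factor `r ^ (2ε)` at `0` and `r ^ (-2ε)` at infinity. -/
def radialBound (d : ℕ) (ε r : ℝ) : ℝ :=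
  Real.exp (-(d * Real.log r) - 2 * ε * |Real.log r|)

theorem measurable_radialBound (d : ℕ) (ε : ℝ) : Measurable (radialBound d ε) := by
  have h : Measurable fun r : ℝ => |Real.log r| := Real.measurable_log.abs
  exact Real.measurable_exp.comp
    ((Real.measurable_log.const_mul _).neg.sub (h.const_mul _))

theorem integrableOn_pow_smul_radialBound {d : ℕ} (hd : 0 < d) {ε : ℝ} (hε : 0 < ε) :
    IntegrableOn (fun r => r ^ (d - 1) • radialBound d ε r) (Set.Ioi 0) := by
  have hpow : ∀ r : ℝ, 0 < r → r ^ (d - 1) • radialBound d ε r =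
      Real.exp (-Real.log r - 2 * ε * |Real.log r|) := by
    intro r hr
    have h1 : r ^ (d - 1) = Real.exp (((d : ℝ) - 1) * Real.log r) := by
      rw [mul_comm, Real.exp_mul, Real.exp_log hr, ← Nat.cast_pred hd, Real.rpow_natCast]
    rw [radialBound, smul_eq_mul, h1, ← Real.exp_add]
    congr 1
    ring
  rw [← Set.Ioc_union_Ioi_eq_Ioi (zero_le_one' ℝ)]
  refine IntegrableOn.union ?_ ?_
  · have h := (intervalIntegral.intervalIntegrable_rpow' (a := 0) (b := 1)
      (show -1 < 2 * ε - 1 by linarith)).1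
    refine h.congr_fun (fun r hr => ?_) measurableSet_Ioc
    have hlog : Real.log r ≤ 0 := Real.log_nonpos hr.1.le hr.2
    simp only
    rw [hpow r hr.1, abs_of_nonpos hlog, Real.rpow_def_of_pos hr.1]
    congr 1
    ring
  · have h := integrableOn_Ioi_rpow_of_lt (show -1 - 2 * ε < -1 by linarith) zero_lt_one
    refine h.congr_fun (fun r hr => ?_) measurableSet_Ioi
    have hr0 : 0 < r := zero_lt_one.trans hr
    have hlog : 0 ≤ Real.log r := Real.log_nonneg (le_of_lt hr)
    simp only
    rw [hpow r hr0, abs_of_nonneg hlog, Real.rpow_def_of_pos hr0]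
    congr 1
    ring

theorem lintegral_radialBound_ne_top {d : ℕ} (hd : 0 < d) {ε : ℝ} (hε : 0 < ε) :
    ∫⁻ t : EuclideanSpace ℝ (Fin d), ENNReal.ofReal (radialBound d ε ‖t‖) ≠ ⊤ := by
  have : Nontrivial (EuclideanSpace ℝ (Fin d)) := by
    have : Nonempty (Fin d) := ⟨⟨0, hd⟩⟩
    infer_instance
  have h : Integrable (fun t : EuclideanSpace ℝ (Fin d) => radialBound d ε ‖t‖) := by
    rw [integrable_fun_norm_addHaar volume, finrank_euclideanSpace_fin]
    exact integrableOn_pow_smul_radialBound hd hε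
  exact h.lintegral_lt_top.ne

namespace FeynmanGraph

variable {nV nE : ℕ} (G : FeynmanGraph nV nE)

/-- The integral of the product of radial functions along the edges of a rooted forest
factorizes. -/
theorem lintegral_prod_radialBound_ne_top {d : ℕ} (hd : 0 < d) {ε : ℝ} (hε : 0 < ε)
    (x : Fin nV → EuclideanSpace ℝ (Fin d)) (par : Fin nV → Fin nV) (rank : Fin nV → ℕ)
    (hrank : ∀ v, v ∉ G.ext → rank (par v) < rank v) :
    ∫⁻ y : G.Internal → EuclideanSpace ℝ (Fin d), ∏ v : G.Internal,
      ENNReal.ofReal (radialBound d ε ‖y v - G.assemble x y (par v)‖) ≠ ⊤ := by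
  have hupd : ∀ (i j : G.Internal) (y y' : G.Internal → EuclideanSpace ℝ (Fin d)),
      (∀ k, k ≠ j → y' k = y k) → rank i ≤ rank j →
        G.assemble x y' (par i) = G.assemble x y (par i) := by
    intro i j y y' hy hij
    simp only [assemble]
    split_ifs with h
    · rfl
    · refine hy _ fun heq => ?_
      have h1 := hrank i i.2
      have h2 : par i = (j : Fin nV) := congrArg Subtype.val heq
      rw [h2] at h1
      omega
  rw [lintegral_pi_prod_of_rank
    (fun (v : G.Internal) y => ENNReal.ofReal (radialBound d ε ‖y v - G.assemble x y (par v)‖))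
    (fun v => ((measurable_radialBound d ε).comp
      ((measurable_pi_apply v).sub (G.measurable_assemble x (par v))).norm).ennreal_ofReal)
    (fun _ => ∫⁻ t : EuclideanSpace ℝ (Fin d), ENNReal.ofReal (radialBound d ε ‖t‖))
    (fun v => rank v)]
  · exact ENNReal.prod_ne_top fun _ _ => lintegral_radialBound_ne_top hd hε
  · intro i y
    refine (lintegral_congr fun t => ?_).trans (lintegral_sub_right_eq_self
      (fun t : EuclideanSpace ℝ (Fin d) => ENNReal.ofReal (radialBound d ε ‖t‖))
      (G.assemble x y (par i)))
    rw [hupd i i y _ (fun k hk => @Function.update_of_ne _ _ (_) _ _ hk _ _) le_rfl,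
      @Function.update_self _ _ (_)]
  · intro i j y t hij hr
    rw [hupd i j y _ (fun k hk => @Function.update_of_ne _ _ (_) _ _ hk _ _) hr,
      @Function.update_of_ne _ _ (_) _ _ hij]

/-- The position space integrand is bounded in every Hepp sector by a product of radial functions
along the edges of a Prim forest. -/
theorem prod_norm_rpow_le {d : ℕ} {z : Fin nV → EuclideanSpace ℝ (Fin d)} {pos : Fin nV → ℕ}
    {par root : Fin nV → Fin nV} (hF : IsPrimForest G.ext z pos par root) {N : ℕ}
    (hN : ∀ v, pos v ≤ N) {δ D : ℝ} (hδ : 0 < δ) (hD : 0 ≤ D)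
    (hδD : ∀ v ∈ G.ext, ∀ w ∈ G.ext, v ≠ w → δ ≤ dist (z v) (z w) ∧ dist (z v) (z w) ≤ D)
    (hz : ∀ v w, v ≠ w → z v ≠ z w) {ε : ℝ} (hε : 0 ≤ ε) (hεd : ε ≤ (d : ℝ) / 2)
    (hUV : ∀ Vg : Finset (Fin nV), Vg.Nonempty → (Vg ∩ G.ext).card ≤ 1 →
      ∑ e ∈ G.edgesWithin Vg, lam d * G.ν e ≤ ((d : ℝ) / 2 - ε) * ((Vg.card : ℝ) - 1))
    (hIR : ∀ I : Finset (Fin nV), (∀ v ∈ I, v ∉ G.ext) →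
      ((d : ℝ) / 2 + ε) * (I.card : ℝ) ≤ ∑ e ∈ G.edgesMeeting I, lam d * G.ν e) :
    ∏ e, ‖z (G.ends e).1 - z (G.ends e).2‖ ^ (-(2 * lam d * G.ν e)) ≤
      Real.exp (∑ e, 2 * |lam d * G.ν e| * Real.log (1 + 2 * N + D + (1 + 2 * N) / δ)) *
        ∏ v : G.Internal, radialBound d ε ‖z v - z (par v)‖ := by
  set C : ℝ := 1 + 2 * N + D + (1 + 2 * N) / δ with hC
  have hC0 : 0 < C := by positivity
  have hr : ∀ e, 0 < dist (z (G.ends e).1) (z (G.ends e).2) := fun e =>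
    dist_pos.2 (hz _ _ (G.ends_ne e))
  set L : Fin nE → ℝ := fun e => IsPrimForest.sep G.ext z pos par root (G.ends e).1 (G.ends e).2
    with hL
  have hb : ∀ e, L e ≤ C * dist (z (G.ends e).1) (z (G.ends e).2) ∧
      dist (z (G.ends e).1) (z (G.ends e).2) ≤ C * L e := fun e =>
    hF.sep_bounds hN hδ hD hδD _ _
  have hL0 : ∀ e, 0 < L e := fun e => pos_of_mul_pos_right ((hr e).trans_le (hb e).2) hC0.le
  have hlog : ∀ e, |Real.log (dist (z (G.ends e).1) (z (G.ends e).2)) - Real.log (L e)| ≤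
      Real.log C := by
    intro e
    have h1 := Real.log_le_log (hL0 e) (hb e).1
    have h2 := Real.log_le_log (hr e) (hb e).2
    rw [Real.log_mul hC0.ne' (hr e).ne'] at h1
    rw [Real.log_mul hC0.ne' (hL0 e).ne'] at h2
    rw [abs_le]
    constructor <;> linarith
  have hmain := G.sum_log_sep_ge hF hε hεd hUV hIR hL0
    (fun v hv => dist_pos.2 (hz _ _ fun h => by
      have := hF.par_lt v hv
      rw [← h] at this
      exact lt_irrefl _ this))
  have hlhs : ∏ e, ‖z (G.ends e).1 - z (G.ends e).2‖ ^ (-(2 * lam d * G.ν e)) =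
      Real.exp (∑ e, -(2 * (lam d * G.ν e) *
        Real.log (dist (z (G.ends e).1) (z (G.ends e).2)))) := by
    rw [Real.exp_sum]
    refine Finset.prod_congr rfl fun e _ => ?_
    rw [← dist_eq_norm, Real.rpow_def_of_pos (hr e)]
    congr 1
    ring
  simp only [radialBound]
  rw [hlhs, ← Real.exp_sum, ← Real.exp_add, Real.exp_le_exp]
  simp only [← dist_eq_norm]
  have hterm : ∑ e, -(2 * (lam d * G.ν e) *
        Real.log (dist (z (G.ends e).1) (z (G.ends e).2))) ≤
      ∑ e, (2 * |lam d * G.ν e| * Real.log C - 2 * (lam d * G.ν e * Real.log (L e))) := by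
    refine Finset.sum_le_sum fun e _ => ?_
    have h1 := abs_mul (lam d * G.ν e)
      (Real.log (dist (z (G.ends e).1) (z (G.ends e).2)) - Real.log (L e))
    have h2 := mul_le_mul_of_nonneg_left (hlog e) (abs_nonneg (lam d * G.ν e))
    have h3 := neg_abs_le (lam d * G.ν e *
      (Real.log (dist (z (G.ends e).1) (z (G.ends e).2)) - Real.log (L e)))
    rw [h1] at h3
    nlinarith
  refine hterm.trans ?_
  rw [Finset.sum_sub_distrib, Finset.sum_sub_distrib, Finset.sum_neg_distrib, ← Finset.mul_sum,
    ← Finset.mul_sum (f := fun v : G.Internal => Real.log (dist (z v) (z (par v)))),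
    ← Finset.mul_sum (f := fun v : G.Internal => |Real.log (dist (z v) (z (par v)))|)]
  linarith

theorem lintegral_prod_norm_rpow_ne_top {d : ℕ} (hd : 0 < d) (hUV : G.UVConvergent d)
    (hIR : G.IRConvergent d) (hext : G.ext.Nonempty) (x : Fin nV → EuclideanSpace ℝ (Fin d))
    (hx : ∀ v ∈ G.ext, ∀ w ∈ G.ext, v ≠ w → x v ≠ x w) :
    ∫⁻ y : G.Internal → EuclideanSpace ℝ (Fin d), ENNReal.ofReal (∏ e,
      ‖G.assemble x y (G.ends e).1 - G.assemble x y (G.ends e).2‖ ^ (-(2 * lam d * G.ν e))) ≠ ⊤ := by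
  obtain ⟨ε, hε, hεd, hUV', hIR'⟩ := G.exists_convergence_margin hd hUV hIR
  obtain ⟨δ, hδ, hδx⟩ : ∃ δ : ℝ, 0 < δ ∧ ∀ p : Fin nV × Fin nV, p.1 ∈ G.ext → p.2 ∈ G.ext →
      p.1 ≠ p.2 → δ ≤ dist (x p.1) (x p.2) := by
    have hev : ∀ᶠ δ in nhdsWithin (0 : ℝ) (Set.Ioi 0), ∀ p : Fin nV × Fin nV, p.1 ∈ G.ext →
        p.2 ∈ G.ext → p.1 ≠ p.2 → δ ≤ dist (x p.1) (x p.2) := by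
      refine Filter.eventually_all.2 fun p => ?_
      by_cases h : p.1 ∈ G.ext ∧ p.2 ∈ G.ext ∧ p.1 ≠ p.2
      · have h0 : 0 < dist (x p.1) (x p.2) := dist_pos.2 (hx _ h.1 _ h.2.1 h.2.2)
        filter_upwards [nhdsWithin_le_nhds (Iic_mem_nhds h0)] with δ hδ _ _ _ using hδ
      · exact Filter.Eventually.of_forall fun δ h1 h2 h3 => absurd ⟨h1, h2, h3⟩ h
    obtain ⟨δ, h1, h2⟩ := (hev.and self_mem_nhdsWithin).exists
    exact ⟨δ, h2, h1⟩
  set D : ℝ := ∑ p : Fin nV × Fin nV, dist (x p.1) (x p.2) with hDdef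
  have hDx : ∀ p : Fin nV × Fin nV, dist (x p.1) (x p.2) ≤ D := fun p =>
    Finset.single_le_sum (f := fun p : Fin nV × Fin nV => dist (x p.1) (x p.2))
      (fun _ _ => dist_nonneg) (Finset.mem_univ p)
  have hD : 0 ≤ D := Finset.sum_nonneg fun _ _ => dist_nonneg
  have hassx : ∀ (y : G.Internal → EuclideanSpace ℝ (Fin d)) v, v ∈ G.ext →
      G.assemble x y v = x v := fun y v hv => by simp [assemble, hv]
  have hassy : ∀ (y : G.Internal → EuclideanSpace ℝ (Fin d)) (v : G.Internal),
      G.assemble x y v = y v := fun y v => by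
    simp only [assemble]
    exact dif_pos v.2
  set K : ℝ := Real.exp (∑ e, 2 * |lam d * G.ν e| * Real.log
    (1 + 2 * (Fintype.card (Fin nV) + 1 : ℕ) + D + (1 + 2 * (Fintype.card (Fin nV) + 1 : ℕ)) / δ))
    with hK
  set P : Finset (Fin nV → Fin nV) := Finset.univ.filter fun par =>
    ∃ rank : Fin nV → ℕ, ∀ v, v ∉ G.ext → rank (par v) < rank v with hP
  have hmeas : ∀ (par : Fin nV → Fin nV) (v : G.Internal),
      Measurable fun y : G.Internal → EuclideanSpace ℝ (Fin d) =>
        ENNReal.ofReal (radialBound d ε ‖y v - G.assemble x y (par v)‖) := fun par v =>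
    ((measurable_radialBound d ε).comp
      ((measurable_pi_apply v).sub (G.measurable_assemble x (par v))).norm).ennreal_ofReal
  have hmeas' : ∀ par : Fin nV → Fin nV,
      Measurable fun y : G.Internal → EuclideanSpace ℝ (Fin d) => ∏ v : G.Internal,
        ENNReal.ofReal (radialBound d ε ‖y v - G.assemble x y (par v)‖) := fun par =>
    Finset.measurable_prod _ fun v _ => hmeas par v
  have hle : ∀ᵐ y : G.Internal → EuclideanSpace ℝ (Fin d), ENNReal.ofReal (∏ e,
      ‖G.assemble x y (G.ends e).1 - G.assemble x y (G.ends e).2‖ ^ (-(2 * lam d * G.ν e))) ≤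
      ENNReal.ofReal K * ∑ par ∈ P, ∏ v : G.Internal,
        ENNReal.ofReal (radialBound d ε ‖y v - G.assemble x y (par v)‖) := by
    filter_upwards [G.ae_assemble_ne hd x hx] with y hy
    obtain ⟨pos, par, root, hF, hN⟩ := exists_isPrimForest hext (G.assemble x y)
    have h1 := G.prod_norm_rpow_le hF hN hδ hD
      (fun v hv w hw hvw => by
        rw [hassx y v hv, hassx y w hw]
        exact ⟨hδx (v, w) hv hw hvw, hDx (v, w)⟩) hy hε.le hεd hUV' hIR'
    refine (ENNReal.ofReal_le_ofReal h1).trans ?_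
    rw [ENNReal.ofReal_mul (Real.exp_pos _).le,
      ENNReal.ofReal_prod_of_nonneg fun v _ => show 0 ≤ radialBound d ε _ from (Real.exp_pos _).le]
    refine mul_le_mul_right ?_ _
    simp only [hassy]
    exact Finset.single_le_sum (f := fun par : Fin nV → Fin nV => ∏ v : G.Internal,
        ENNReal.ofReal (radialBound d ε ‖y v - G.assemble x y (par v)‖)) (fun _ _ => zero_le)
      (Finset.mem_filter.2 ⟨Finset.mem_univ par, pos, hF.par_lt⟩)
  refine ne_top_of_le_ne_top ?_ (lintegral_mono_ae hle)
  rw [lintegral_const_mul _ (Finset.measurable_sum _ fun par _ => hmeas' par),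
    lintegral_finsetSum _ fun par _ => hmeas' par]
  refine ENNReal.mul_ne_top ENNReal.ofReal_ne_top (ENNReal.sum_ne_top.2 fun par hpar => ?_)
  obtain ⟨rank, hrank⟩ := (Finset.mem_filter.1 hpar).2
  exact G.lintegral_prod_radialBound_ne_top hd hε x par rank hrank

end FeynmanGraph

/-- The dual parametric representation of position-space Feynman
integrals: for a convergent graph (ultraviolet and infrared convergent, `M_G > 0`,
every connected component containing an external vertex, two external vertices in a
common component), any `n_e ∈ ℕ` with `n_e + λν_e > 0` and pairwise distinct external
positions `x`, the affine parametric integral converges absolutely and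
`f_G(x) = ((-1)^{Σ n_e} Γ(M_G)/∏_e Γ(n_e + λν_e)) ∫_{(0,∞)^{E-1}} dualIntegrand`. -/
theorem dual_parametric_representation {d nV m : ℕ} (hd : 2 < d)
    (G : FeynmanGraph nV (m + 1))
    (hUV : G.UVConvergent d) (hIR : G.IRConvergent d)
    (hM : 0 < G.Mdeg d)
    (hcomp : ∀ v : Fin nV, ∃ w ∈ G.ext, (G.edgeGraph Finset.univ).Reachable v w)
    (hconn : ∃ i ∈ G.ext, ∃ j ∈ G.ext, i ≠ j ∧ (G.edgeGraph Finset.univ).Reachable i j)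
    (n : Fin (m + 1) → ℕ) (hn : ∀ e, 0 < (n e : ℝ) + lam d * G.ν e)
    (x : Fin nV → EuclideanSpace ℝ (Fin d))
    (hx : ∀ v ∈ G.ext, ∀ w ∈ G.ext, v ≠ w → x v ≠ x w) :
    IntegrableOn (dualIntegrand d G n x)
      {β : {e : Fin (m + 1) // e ≠ 0} → ℝ | ∀ e, 0 < β e} volume ∧
    G.posIntegral d x =
      ENNReal.ofReal
        (((-1 : ℝ) ^ (∑ e, n e) * Real.Gamma (G.Mdeg d) /
            ∏ e, Real.Gamma ((n e : ℝ) + lam d * G.ν e)) *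
          ∫ β in {β : {e : Fin (m + 1) // e ≠ 0} → ℝ | ∀ e, 0 < β e},
            dualIntegrand d G n x β) := by
  have hext : G.ext.Nonempty := hconn.imp fun _ h => h.1
  exact G.dual_representation_of_lintegral_ne_top (by omega) hM hcomp hconn n hn x hx
    (G.lintegral_prod_norm_rpow_ne_top (by omega) hUV hIR hext x hx)
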